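/- Let a = (a_n)_{n≥1} be a sequence of positive integers and let (p_n/q_n)_{n≥1} denote the convergents of α = [0; a₁, a₂, …]. Assume that the sequence (q_ℓ^{1/ℓ})_{ℓ≥1} converges. Let w and w' be positive rational numbers with w' > 1. If a satisfies Condition (*)_{w,w'}, then α is transcendental. -/

import Mathlib

open Filter Topology

/-- Numerators of the convergents of `[0; a 1, a 2, ...]`. -/
def cfNum (a : ℕ → ℕ) : ℕ → ℕ
  | 0 => 0
  | 1 => 1
  | n + 2 => a (n + 2) * cfNum a (n + 1) + cfNum a n

/-- Denominators of the convergents of `[0; a 1, a 2, ...]`. -/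
def cfDen (a : ℕ → ℕ) : ℕ → ℕ
  | 0 => 1
  | 1 => a 1
  | n + 2 => a (n + 2) * cfDen a (n + 1) + cfDen a n

/-- The infinite word `a 1, a 2, a 3, ...` is eventually periodic. -/
def EventuallyPeriodic (a : ℕ → ℕ) : Prop :=
  ∃ n₀ T : ℕ, 0 < T ∧ ∀ n, n₀ ≤ n → a (n + T) = a n

/-- The finite word `L` is a prefix of the infinite word `a 1, a 2, a 3, ...`. -/
def IsPrefixOfSeq (L : List ℕ) (a : ℕ → ℕ) : Prop :=
  ∀ i, i < L.length → L.getD i 0 = a (i + 1)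

/-- Condition `(*)_{w,w'}`: the word `a 1 a 2 ...` is not eventually periodic and begins in
prefixes `Wₙ Uₙ Vₙ Ūₙ` with `|Vₙ|/|Uₙ| ≤ w`, `|Uₙ|/|Wₙ| ≥ w'` and `|Uₙ|` increasing. -/
def ConditionStarStar (w w' : ℚ) (a : ℕ → ℕ) : Prop :=
  ¬ EventuallyPeriodic a ∧
    ∃ U V W : ℕ → List ℕ,
      (∀ n, 1 ≤ n → IsPrefixOfSeq (W n ++ U n ++ V n ++ (U n).reverse) a) ∧
      (∀ n, 1 ≤ n → ((V n).length : ℚ) ≤ w * (U n).length) ∧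
      (∀ n, 1 ≤ n → w' * ((W n).length : ℚ) ≤ (U n).length) ∧
      StrictMono (fun n => (U n).length)

namespace ST
open MvPolynomial

/-- l1 norm of coefficients -/
noncomputable def l1 {σ R : Type*} [CommRing R] (N : RingSeminorm R) (F : MvPolynomial σ R) : ℝ :=
  ∑ e ∈ F.support, N (F.coeff e)

section
variable {σ τ R : Type*} [CommRing R] (N : RingSeminorm R)

lemma l1_eq_sum {F : MvPolynomial σ R} {s : Finset (σ →₀ ℕ)} (h : F.support ⊆ s) :
    l1 N F = ∑ e ∈ s, N (F.coeff e) := by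
  refine Finset.sum_subset h ?_
  intro e _ he
  rw [notMem_support_iff.mp he, map_zero]

lemma l1_nonneg (F : MvPolynomial σ R) : 0 ≤ l1 N F :=
  Finset.sum_nonneg fun _ _ => apply_nonneg N _

lemma coeff_le_l1 (F : MvPolynomial σ R) (e : σ →₀ ℕ) : N (F.coeff e) ≤ l1 N F := by
  by_cases he : e ∈ F.support
  · exact Finset.single_le_sum (f := fun e => N (F.coeff e)) (fun _ _ => apply_nonneg N _) he
  · rw [notMem_support_iff.mp he, map_zero]; exact l1_nonneg N F

lemma l1_zero : l1 N (0 : MvPolynomial σ R) = 0 := by simp [l1]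

lemma l1_add (F G : MvPolynomial σ R) : l1 N (F + G) ≤ l1 N F + l1 N G := by
  classical
  rw [l1_eq_sum N (s := F.support ∪ G.support) (support_add),
    l1_eq_sum N (F := F) (s := F.support ∪ G.support) Finset.subset_union_left,
    l1_eq_sum N (F := G) (s := F.support ∪ G.support) Finset.subset_union_right,
    ← Finset.sum_add_distrib]
  refine Finset.sum_le_sum fun e _ => ?_
  rw [coeff_add]; exact map_add_le_add N _ _

lemma l1_sum {ι : Type*} (s : Finset ι) (F : ι → MvPolynomial σ R) :
    l1 N (∑ i ∈ s, F i) ≤ ∑ i ∈ s, l1 N (F i) := by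
  classical
  induction s using Finset.induction_on with
  | empty => simp [l1_zero]
  | insert a s ha ih =>
    rw [Finset.sum_insert ha, Finset.sum_insert ha]
    exact (l1_add N _ _).trans (by linarith)

lemma l1_monomial (e : σ →₀ ℕ) (c : R) : l1 N (monomial e c) = N c := by
  classical
  rw [l1_eq_sum N (s := {e}) support_monomial_subset]; simp

lemma l1_C (c : R) : l1 N (C c : MvPolynomial σ R) = N c := l1_monomial N 0 c

lemma l1_X (i : σ) : l1 N (X i : MvPolynomial σ R) = N 1 := l1_monomial N _ 1

lemma l1_one : l1 N (1 : MvPolynomial σ R) = N 1 := l1_C N 1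

lemma l1_mul (F G : MvPolynomial σ R) : l1 N (F * G) ≤ l1 N F * l1 N G := by
  classical
  have h : F * G = ∑ e ∈ F.support, ∑ f ∈ G.support,
      monomial (e + f) (F.coeff e * G.coeff f) := by
    conv_lhs => rw [F.as_sum, G.as_sum, Finset.sum_mul_sum]
    simp [monomial_mul]
  rw [h]
  refine (l1_sum N _ _).trans ?_
  rw [l1, l1, Finset.sum_mul_sum]
  refine Finset.sum_le_sum fun e _ => (l1_sum N _ _).trans (Finset.sum_le_sum fun f _ => ?_)
  rw [l1_monomial]; exact map_mul_le_mul N _ _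

lemma l1_neg (F : MvPolynomial σ R) : l1 N (-F) = l1 N F := by
  rw [l1, l1, support_neg]; exact Finset.sum_congr rfl fun e _ => by rw [coeff_neg, map_neg_eq_map]

lemma l1_pow (h1 : N 1 ≤ 1) (F : MvPolynomial σ R) (k : ℕ) : l1 N (F ^ k) ≤ l1 N F ^ k := by
  induction k with
  | zero => simpa [l1_one] using h1
  | succ k ih =>
    rw [pow_succ, pow_succ]
    exact (l1_mul N _ _).trans (mul_le_mul_of_nonneg_right ih (l1_nonneg N _))

lemma l1_prod (h1 : N 1 ≤ 1) {ι : Type*} (s : Finset ι) (F : ι → MvPolynomial σ R) :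
    l1 N (∏ i ∈ s, F i) ≤ ∏ i ∈ s, l1 N (F i) := by
  classical
  induction s using Finset.induction_on with
  | empty => simpa [l1_one] using h1
  | insert a s ha ih =>
    rw [Finset.prod_insert ha, Finset.prod_insert ha]
    exact (l1_mul N _ _).trans (mul_le_mul_of_nonneg_left ih (l1_nonneg N _))

/-- substitution bound -/
lemma l1_bind (h1 : N 1 ≤ 1) (f : σ → MvPolynomial τ R) (F : MvPolynomial σ R) (M : ℝ)
    (hM : ∀ e ∈ F.support, ∏ i ∈ e.support, l1 N (f i) ^ e i ≤ M) :
    l1 N (bind₁ f F) ≤ M * l1 N F := by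
  classical
  have h : bind₁ f F = ∑ e ∈ F.support, C (F.coeff e) * ∏ i ∈ e.support, f i ^ e i := by
    conv_lhs => rw [F.as_sum, map_sum]
    refine Finset.sum_congr rfl fun e _ => ?_
    rw [bind₁_monomial]
  rw [h]
  refine (l1_sum N _ _).trans ?_
  rw [l1, Finset.mul_sum]
  refine Finset.sum_le_sum fun e he => ?_
  refine (l1_mul N _ _).trans ?_
  rw [l1_C, mul_comm]
  refine mul_le_mul_of_nonneg_right ?_ (apply_nonneg N _)
  refine (l1_prod N h1 _ _).trans (le_trans ?_ (hM e he))
  exact Finset.prod_le_prod (fun i _ => l1_nonneg N _) (fun i _ => l1_pow N h1 _ _)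

end

/-- weighted order at least θ -/
def Ord {σ R : Type*} [CommSemiring R] (w : σ → ℝ) (θ : ℝ) (F : MvPolynomial σ R) : Prop :=
  ∀ e ∈ F.support, θ ≤ Finsupp.weight w e

section
variable {σ R : Type*} [CommRing R] {w : σ → ℝ}

lemma Ord.mono {θ θ' : ℝ} (h : θ' ≤ θ) {F : MvPolynomial σ R} (hF : Ord w θ F) : Ord w θ' F :=
  fun e he => h.trans (hF e he)

lemma Ord.zero (θ : ℝ) : Ord w θ (0 : MvPolynomial σ R) := by intro e he; simp at he

lemma Ord.add {θ : ℝ} {F G : MvPolynomial σ R} (hF : Ord w θ F) (hG : Ord w θ G) :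
    Ord w θ (F + G) := by
  classical
  intro e he
  rcases Finset.mem_union.mp (support_add he) with h | h
  · exact hF e h
  · exact hG e h

lemma Ord.neg {θ : ℝ} {F : MvPolynomial σ R} (hF : Ord w θ F) : Ord w θ (-F) := by
  intro e he; rw [support_neg] at he; exact hF e he

lemma Ord.sum {θ : ℝ} {ι : Type*} (s : Finset ι) {F : ι → MvPolynomial σ R}
    (hF : ∀ i ∈ s, Ord w θ (F i)) : Ord w θ (∑ i ∈ s, F i) := by
  classical
  induction s using Finset.induction_on with
  | empty => simpa using Ord.zero θ
  | insert a s ha ih =>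
    rw [Finset.sum_insert ha]
    exact (hF a (by simp)).add (ih fun i hi => hF i (by simp [hi]))

lemma Ord.mul {θ η : ℝ} {F G : MvPolynomial σ R} (hF : Ord w θ F) (hG : Ord w η G) :
    Ord w (θ + η) (F * G) := by
  classical
  intro e he
  obtain ⟨a, ha, b, hb, rfl⟩ := Finset.mem_add.mp (support_mul F G he)
  rw [map_add]; exact add_le_add (hF a ha) (hG b hb)

lemma Ord.one : Ord w 0 (1 : MvPolynomial σ R) := by
  classical
  intro e he
  have := (support_monomial_subset (s := 0) (a := (1:R))) he
  simp at this; simp [this]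

lemma Ord.C (c : R) : Ord w 0 (MvPolynomial.C c : MvPolynomial σ R) := by
  classical
  intro e he
  have := (support_monomial_subset (s := 0) (a := c)) he
  simp at this; simp [this]

lemma Ord.prod {ι : Type*} (s : Finset ι) {F : ι → MvPolynomial σ R} {θ : ι → ℝ}
    (hF : ∀ i ∈ s, Ord w (θ i) (F i)) : Ord w (∑ i ∈ s, θ i) (∏ i ∈ s, F i) := by
  classical
  induction s using Finset.induction_on with
  | empty => simpa using Ord.one
  | insert a s ha ih =>
    rw [Finset.prod_insert ha, Finset.sum_insert ha]
    exact (hF a (by simp)).mul (ih fun i hi => hF i (by simp [hi]))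

lemma Ord.det {k : ℕ} {A : Matrix (Fin k) (Fin k) (MvPolynomial σ R)} {θ : Fin k → ℝ}
    (hF : ∀ i j, Ord w (θ j) (A i j)) : Ord w (∑ j, θ j) A.det := by
  rw [Matrix.det_apply]
  refine Ord.sum _ fun s _ => ?_
  have := Ord.prod Finset.univ (F := fun i => A (s i) i) (θ := θ) (fun i _ => hF _ _)
  rcases Int.units_eq_one_or (Equiv.Perm.sign s) with h | h <;> rw [h]
  · simpa using this
  · simpa using this.neg

lemma weight_nonneg (hw : ∀ i, 0 ≤ w i) (e : σ →₀ ℕ) : 0 ≤ Finsupp.weight w e := by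
  rw [Finsupp.weight_apply]
  exact Finsupp.sum_nonneg fun i _ => smul_nonneg (Nat.zero_le _) (hw i)

lemma Ord.of_nonpos (hw : ∀ i, 0 ≤ w i) {θ : ℝ} (hθ : θ ≤ 0) (F : MvPolynomial σ R) :
    Ord w θ F := fun e _ => hθ.trans (weight_nonneg hw e)

end
end ST

namespace ST
open MvPolynomial

/-- multi-binomial -/
def mch {σ : Type*} (e i : σ →₀ ℕ) : ℕ := i.prod fun h k => (e h).choose k

lemma mch_eq {σ : Type*} (e i : σ →₀ ℕ) (s : Finset σ) (h : i.support ⊆ s) :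
    mch e i = ∏ x ∈ s, (e x).choose (i x) :=
  Finsupp.prod_of_support_subset _ h _ (by simp)

lemma mch_zero_of {σ : Type*} (e i : σ →₀ ℕ) (h : ¬ i ≤ e) : mch e i = 0 := by
  rw [Finsupp.le_def] at h; push Not at h
  obtain ⟨x, hx⟩ := h
  refine Finset.prod_eq_zero (i := x) ?_ (Nat.choose_eq_zero_of_lt hx)
  simp; omega

lemma mch_le {σ : Type*} (e i : σ →₀ ℕ) (s : ℕ) (h : e.degree ≤ s) : mch e i ≤ 2 ^ s := by
  classical
  rw [mch_eq e i (i.support ∪ e.support) Finset.subset_union_left]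
  calc _ ≤ ∏ x ∈ i.support ∪ e.support, 2 ^ (e x) := by
        refine Finset.prod_le_prod' fun x _ => ?_
        exact Nat.choose_le_two_pow _ _
    _ = 2 ^ (∑ x ∈ i.support ∪ e.support, e x) := by rw [Finset.prod_pow_eq_pow_sum]
    _ = 2 ^ e.degree := by
        congr 1
        rw [Finsupp.degree_apply]
        symm
        refine Finset.sum_subset Finset.subset_union_right ?_
        intro x _ hx; simpa using hx
    _ ≤ _ := Nat.pow_le_pow_right (by norm_num) h

/-- divided derivative -/
noncomputable def hd {σ R : Type*} [CommRing R] (i : σ →₀ ℕ) (F : MvPolynomial σ R) :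
    MvPolynomial σ R :=
  ∑ e ∈ F.support, monomial (e - i) ((mch e i : R) * F.coeff e)

section
variable {σ R : Type*} [CommRing R]

lemma coeff_hd (i e : σ →₀ ℕ) (F : MvPolynomial σ R) :
    (hd i F).coeff e = (mch (e + i) i : R) * F.coeff (e + i) := by
  classical
  rw [hd, coeff_sum]
  simp only [coeff_monomial]
  rw [Finset.sum_eq_single (e + i)]
  · simp
  · intro b _ hb
    split_ifs with h
    · by_cases hi : i ≤ b
      · exact absurd (by rw [← h]; exact (tsub_add_cancel_of_le hi).symm) hb
      · rw [mch_zero_of _ _ hi]; simp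
    · rfl
  · intro h
    rw [notMem_support_iff.mp h]; simp

lemma hd_add (i : σ →₀ ℕ) (F G : MvPolynomial σ R) : hd i (F + G) = hd i F + hd i G := by
  ext e; simp only [coeff_hd, coeff_add]; ring

lemma hd_zero' (i : σ →₀ ℕ) : hd i (0 : MvPolynomial σ R) = 0 := by
  ext e; simp [coeff_hd]

lemma hd_sum {ι : Type*} (i : σ →₀ ℕ) (s : Finset ι) (F : ι → MvPolynomial σ R) :
    hd i (∑ x ∈ s, F x) = ∑ x ∈ s, hd i (F x) := by
  ext e; simp only [coeff_hd, coeff_sum, Finset.mul_sum]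

lemma hd_id (F : MvPolynomial σ R) : hd 0 F = F := by
  ext e; simp [coeff_hd, mch]

lemma hd_map {S : Type*} [CommRing S] (f : R →+* S) (i : σ →₀ ℕ) (F : MvPolynomial σ R) :
    map f (hd i F) = hd i (map f F) := by
  ext e; simp [coeff_hd, coeff_map]

lemma hd_ord {w : σ → ℝ} {θ : ℝ} (i : σ →₀ ℕ) {F : MvPolynomial σ R} (hF : Ord w θ F) :
    Ord w (θ - Finsupp.weight w i) (hd i F) := by
  intro e he
  have : e + i ∈ F.support := by
    rw [mem_support_iff] at he ⊢
    intro h; apply he; rw [coeff_hd, h, mul_zero]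
  have := hF _ this
  rw [map_add] at this; linarith

lemma hd_l1 (N : RingSeminorm R) (h1 : N 1 ≤ 1) (i : σ →₀ ℕ) (F : MvPolynomial σ R) (s : ℕ)
    (hs : ∀ e ∈ F.support, e.degree ≤ s) : l1 N (hd i F) ≤ 2 ^ s * l1 N F := by
  rw [hd]
  refine (l1_sum N _ _).trans ?_
  rw [l1, Finset.mul_sum]
  refine Finset.sum_le_sum fun e he => ?_
  rw [l1_monomial]
  have hn : ∀ n : ℕ, N (n : R) ≤ n := by
    intro n
    induction n with
    | zero => simp
    | succ n ih =>
      push_cast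
      exact (map_add_le_add N _ _).trans (by linarith)
  refine (map_mul_le_mul N _ _).trans ?_
  refine mul_le_mul_of_nonneg_right ((hn _).trans ?_) (apply_nonneg N _)
  exact_mod_cast mch_le e i s (hs e he)

lemma pderiv_hd (h : σ) (i : σ →₀ ℕ) (F : MvPolynomial σ R) :
    pderiv h (hd i F) = C ((i h : R) + 1) * hd (i + Finsupp.single h 1) F := by
  classical
  ext e
  rw [coeff_C_mul, coeff_hd, coeff_pderiv, coeff_hd]
  have e1 : e + Finsupp.single h 1 + i = e + (i + Finsupp.single h 1) := by
    rw [add_assoc, add_comm (Finsupp.single h 1)]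
  rw [e1]
  set E := e + (i + Finsupp.single h 1) with hE
  have key : mch E i * (e h + 1) = (i h + 1) * mch E (i + Finsupp.single h 1) := by
    have hs1 : i.support ⊆ insert h (i.support) := Finset.subset_insert _ _
    have hs2 : (i + Finsupp.single h 1).support ⊆ insert h (i.support) := by
      intro x hx
      simp only [Finsupp.mem_support_iff, Finsupp.add_apply, Finset.mem_insert] at hx ⊢
      by_contra hc
      push Not at hc
      rw [Finsupp.single_eq_of_ne hc.1, hc.2] at hx
      simp at hx
    rw [mch_eq E _ _ hs1, mch_eq E _ _ hs2, ← Finset.mul_prod_erase _ _ (Finset.mem_insert_self h _),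
      ← Finset.mul_prod_erase _ (fun x => (E x).choose ((i + Finsupp.single h 1 : σ →₀ ℕ) x))
        (Finset.mem_insert_self h _)]
    have : ∏ x ∈ (insert h i.support).erase h, (E x).choose ((i + Finsupp.single h 1 : σ →₀ ℕ) x)
        = ∏ x ∈ (insert h i.support).erase h, (E x).choose (i x) := by
      refine Finset.prod_congr rfl fun x hx => ?_
      have : (i + Finsupp.single h 1 : σ →₀ ℕ) x = i x := by
        rw [Finsupp.add_apply, Finsupp.single_eq_of_ne (Finset.ne_of_mem_erase hx), add_zero]
      rw [this]
    rw [this]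
    have hEh : E h = e h + (i h + 1) := by simp [hE]
    have : (E h).choose (i h + 1) * (i h + 1) = (E h).choose (i h) * (e h + 1) := by
      rw [Nat.choose_succ_right_eq, hEh]; congr 1; omega
    simp only [Finsupp.add_apply, Finsupp.single_eq_same]
    generalize (∏ x ∈ (insert h i.support).erase h, (E x).choose (i x)) = q
    calc _ = ((E h).choose (i h) * (e h + 1)) * q := by ring
      _ = _ := by rw [← this]; ring
  have key' := congrArg (Nat.cast : ℕ → R) key
  push_cast at key'
  linear_combination (coeff E F) * key'

end

/-- translation -/
noncomputable def Tr {σ : Type*} (ξ : σ → ℚ) : MvPolynomial σ ℚ →ₐ[ℚ] MvPolynomial σ ℚ :=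
  aeval fun h => X h + C (ξ h)

section
variable {σ : Type*}

lemma Tr_inv (ξ : σ → ℚ) (F : MvPolynomial σ ℚ) : Tr (-ξ) (Tr ξ F) = F := by
  have : (Tr (-ξ)).comp (Tr ξ) = AlgHom.id ℚ _ := by
    apply MvPolynomial.algHom_ext; intro i; simp [Tr, ← C_eq_algebraMap, MvPolynomial.algHom_C]
  exact congrArg (fun f => f F) this

lemma Tr_inj (ξ : σ → ℚ) {F : MvPolynomial σ ℚ} (h : F ≠ 0) : Tr ξ F ≠ 0 := by
  intro h0; apply h; rw [← Tr_inv ξ F, h0, map_zero]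

lemma pderiv_Tr (ξ : σ → ℚ) (h : σ) (F : MvPolynomial σ ℚ) :
    pderiv h (Tr ξ F) = Tr ξ (pderiv h F) := by
  classical
  induction F using MvPolynomial.induction_on with
  | C a => simp [Tr, ← C_eq_algebraMap]
  | add p q hp hq => simp [hp, hq]
  | mul_X p i hp =>
    rw [map_mul, Derivation.leibniz, Derivation.leibniz, hp, map_add, smul_eq_mul, smul_eq_mul,
      smul_eq_mul, smul_eq_mul, map_mul, map_mul]
    congr 2
    simp only [Tr, aeval_X, map_add, pderiv_X, pderiv_C, add_zero]
    rcases eq_or_ne h i with rfl | hne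
    · simp
    · simp [Pi.single_apply, hne.symm]

lemma hd_Tr (ξ : σ → ℚ) (i : σ →₀ ℕ) (F : MvPolynomial σ ℚ) :
    hd i (Tr ξ F) = Tr ξ (hd i F) := by
  classical
  induction hn : i.degree generalizing i with
  | zero =>
    have : i = 0 := (Finsupp.degree_eq_zero_iff _).mp hn
    subst this; rw [hd_id, hd_id]
  | succ n ih =>
    have hne : i ≠ 0 := by rintro rfl; simp at hn
    obtain ⟨h, hh⟩ := Finsupp.ne_iff.mp hne
    simp at hh
    set j := i - Finsupp.single h 1 with hj
    have hij : i = j + Finsupp.single h 1 := by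
      rw [hj, tsub_add_cancel_of_le]
      rw [Finsupp.single_le_iff]; omega
    have hjn : j.degree = n := by
      rw [hij, map_add, Finsupp.degree_single] at hn; omega
    have a1 := pderiv_hd h j (Tr ξ F)
    have a2 := congrArg (Tr ξ) (pderiv_hd h j F)
    rw [ih j hjn, pderiv_Tr, a2, map_mul, ← hij] at a1
    have h3 : Tr ξ (C ((j h : ℚ) + 1)) = C ((j h : ℚ) + 1) := by simp [Tr, ← C_eq_algebraMap]
    rw [h3] at a1
    have h4 : (C ((j h : ℚ) + 1) : MvPolynomial σ ℚ) ≠ 0 := by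
      rw [Ne, C_eq_zero]; positivity
    exact (mul_left_cancel₀ h4 a1).symm

lemma const_ratio_aux (F g : MvPolynomial σ ℚ) (hg : coeff 0 g ≠ 0) (hF0 : coeff 0 F = 0)
    (h : ∀ x, g * pderiv x F = F * pderiv x g) : F = 0 := by
  classical
  by_contra hF
  have hne : F.support.Nonempty := by
    rw [Finset.nonempty_iff_ne_empty]; simpa [support_eq_empty] using hF
  obtain ⟨e, he, hmin⟩ := Finset.exists_min_image F.support (fun e => e.degree) hne
  have he' := mem_support_iff.mp he
  have e0 : e ≠ 0 := by rintro rfl; exact he' hF0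
  obtain ⟨x, hx⟩ := Finsupp.ne_iff.mp e0
  simp at hx
  obtain ⟨f, rfl⟩ : ∃ f, e = f + Finsupp.single x 1 :=
    ⟨e - Finsupp.single x 1, by
      rw [tsub_add_cancel_of_le]; rw [Finsupp.single_le_iff]; omega⟩
  have hlow : ∀ b : σ →₀ ℕ, b.degree < f.degree + 1 → coeff b F = 0 := by
    intro b hb
    by_contra hc
    have := hmin b (mem_support_iff.mpr hc)
    simp at this; omega
  have hh := congrArg (coeff f) (h x)
  rw [coeff_mul, coeff_mul, Finset.sum_eq_single (0, f)] at hh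
  · rw [Finset.sum_eq_zero] at hh
    · simp only [coeff_pderiv] at hh
      have : ((f x : ℚ) + 1) ≠ 0 := by positivity
      simp_all
    · rintro ⟨a, b⟩ hab
      rw [Finset.HasAntidiagonal.mem_antidiagonal] at hab
      have := congrArg Finsupp.degree hab
      rw [map_add] at this
      simp only at this ⊢
      rw [hlow a (by omega), zero_mul]
  · rintro ⟨a, b⟩ hab hne
    rw [Finset.HasAntidiagonal.mem_antidiagonal] at hab
    have h1 := congrArg Finsupp.degree hab
    rw [map_add] at h1
    simp only at h1 hab ⊢
    rw [coeff_pderiv]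
    have ha : a ≠ 0 := by
      rintro rfl; apply hne; simp at hab; simp [hab]
    have ha' : a.degree ≠ 0 := fun h => ha ((Finsupp.degree_eq_zero_iff _).mp h)
    rw [hlow (b + Finsupp.single x 1) (by simp; omega)]; simp
  · intro hc; simp at hc

lemma const_ratio (f g : MvPolynomial σ ℚ) (hg : g ≠ 0)
    (h : ∀ x, g * pderiv x f = f * pderiv x g) : ∃ l : ℚ, f = C l * g := by
  have : ∃ z, eval z g ≠ 0 := by
    by_contra hc; push Not at hc
    exact hg (MvPolynomial.funext fun z => by simpa using hc z)
  obtain ⟨z, hz⟩ := this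
  have hcz : ∀ F : MvPolynomial σ ℚ, coeff 0 (Tr z F) = eval z F := by
    intro F
    rw [← constantCoeff_eq]
    have : (constantCoeff.comp (Tr z : MvPolynomial σ ℚ →+* MvPolynomial σ ℚ)) = eval z := by
      apply MvPolynomial.ringHom_ext
      · intro r; simp [Tr, ← C_eq_algebraMap]
      · intro i; simp [Tr]
    exact congrArg (fun f => f F) this
  refine ⟨eval z f / eval z g, ?_⟩
  set l := eval z f / eval z g with hl
  have hC : Tr z (C l) = C l := by simp [Tr, ← C_eq_algebraMap]
  have key := const_ratio_aux (Tr z (f - C l * g)) (Tr z g) (by rw [hcz]; exact hz)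
    (by rw [hcz]; simp [hl]; field_simp; ring) (by
      intro x
      rw [pderiv_Tr, pderiv_Tr, ← map_mul, ← map_mul]
      congr 1
      rw [map_sub, Derivation.leibniz, pderiv_C, smul_zero, add_zero, smul_eq_mul]
      linear_combination h x)
  by_contra hc
  exact Tr_inj z (sub_ne_zero.mpr hc) key

theorem wronskian : ∀ (k : ℕ) (φ : Fin k → MvPolynomial σ ℚ), LinearIndependent ℚ φ →
    ∃ Δ : Fin k → (σ →₀ ℕ), (∀ i, (Δ i).degree ≤ i) ∧
      (Matrix.of fun i j => hd (Δ i) (φ j)).det ≠ 0 := by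
  classical
  intro k
  induction k with
  | zero => intro φ _; exact ⟨fun _ => 0, fun i => i.elim0, by simp⟩
  | succ k ih =>
    intro φ hφ
    obtain ⟨Δ, hΔ, hdet⟩ := ih (φ ∘ Fin.castSucc) (hφ.comp _ (Fin.castSucc_injective k))
    set B : Matrix (Fin k) (Fin k) (MvPolynomial σ ℚ) :=
      Matrix.of fun i j => hd (Δ i) ((φ ∘ Fin.castSucc) j) with hB
    let c : Fin (k+1) → MvPolynomial σ ℚ := fun j =>
      (-1) ^ (k + (j:ℕ)) * (Matrix.of fun (i : Fin k) (l : Fin k) => hd (Δ i) (φ (j.succAbove l))).det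
    by_contra hcon
    push Not at hcon
    have hD : ∀ D : σ →₀ ℕ, D.degree ≤ k → ∑ j, c j * hd D (φ j) = 0 := by
      intro D hDk
      have := hcon (Fin.snoc Δ D) (by
        intro i
        induction i using Fin.lastCases with
        | last => simpa using hDk
        | cast i => simpa using hΔ i)
      rw [Matrix.det_succ_row _ (Fin.last k)] at this
      rw [← this]
      refine Finset.sum_congr rfl fun j _ => ?_
      have e1 : (Matrix.of fun i j => hd ((Fin.snoc Δ D : Fin (k+1) → σ →₀ ℕ) i) (φ j)).submatrix
          (Fin.last k).succAbove j.succAbove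
          = Matrix.of fun (i : Fin k) (l : Fin k) => hd (Δ i) (φ (j.succAbove l)) := by
        ext1 i l; simp
      rw [e1]
      simp only [c, Matrix.of_apply, Fin.snoc_last, Fin.val_last]
      ring
    have hclast : c (Fin.last k) ≠ 0 := by
      simp only [c]
      refine mul_ne_zero (pow_ne_zero _ (by simp)) ?_
      simpa [hB] using hdet
    have hv : ∀ (x : σ) (j : Fin k), c (Fin.last k) * pderiv x (c j.castSucc)
        - c j.castSucc * pderiv x (c (Fin.last k)) = 0 := by
      intro x
      have hz : B.mulVec (fun j : Fin k => c (Fin.last k) * pderiv x (c j.castSucc)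
        - c j.castSucc * pderiv x (c (Fin.last k))) = 0 := by
        ext1 i
        have hi : (Δ i).degree + 1 ≤ k := by have := hΔ i; omega
        have d0 := hD (Δ i) (by omega)
        have d1 := hD (Δ i + Finsupp.single x 1) (by simpa using hi)
        have d2 := congrArg (pderiv x) d0
        simp only [map_sum, Derivation.leibniz, smul_eq_mul, pderiv_hd, map_zero] at d2
        rw [Finset.sum_add_distrib] at d2
        have d3 : ∑ j, c j * (C ((Δ i x : ℚ) + 1) * hd (Δ i + Finsupp.single x 1) (φ j)) = 0 := by
          have := congrArg (fun z => C ((Δ i x : ℚ) + 1) * z) d1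
          simp only [Finset.mul_sum, mul_zero] at this
          rw [← this]
          exact Finset.sum_congr rfl fun j _ => by ring
        rw [d3, zero_add] at d2
        have d4 : ∑ j : Fin (k+1), (c (Fin.last k) * pderiv x (c j)
          - c j * pderiv x (c (Fin.last k))) * hd (Δ i) (φ j) = 0 := by
          have : ∑ j : Fin (k+1), (c (Fin.last k) * pderiv x (c j)
            - c j * pderiv x (c (Fin.last k))) * hd (Δ i) (φ j) =
            c (Fin.last k) * ∑ j, hd (Δ i) (φ j) * pderiv x (c j)
            - pderiv x (c (Fin.last k)) * ∑ j, c j * hd (Δ i) (φ j) := by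
            rw [Finset.mul_sum, Finset.mul_sum, ← Finset.sum_sub_distrib]
            exact Finset.sum_congr rfl fun j _ => by ring
          rw [this, d0, d2]; simp
        rw [Fin.sum_univ_castSucc] at d4
        simp only [sub_self, zero_mul, add_zero] at d4
        simp only [Matrix.mulVec, dotProduct, hB, Matrix.of_apply, Function.comp, Pi.zero_apply]
        rw [← d4]
        exact Finset.sum_congr rfl fun j _ => by ring
      have := Matrix.eq_zero_of_mulVec_eq_zero hdet hz
      exact fun j => congrFun this j
    have hl : ∀ j : Fin (k+1), ∃ l : ℚ, c j = C l * c (Fin.last k) := by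
      intro j
      induction j using Fin.lastCases with
      | last => exact ⟨1, by simp⟩
      | cast j =>
        refine const_ratio _ _ hclast fun x => ?_
        exact sub_eq_zero.mp (hv x j)
    choose l hl using hl
    have h0 := hD 0 (by simp)
    simp only [hd_id] at h0
    have h1 : c (Fin.last k) * ∑ j, l j • φ j = 0 := by
      rw [← h0, Finset.mul_sum]
      refine Finset.sum_congr rfl fun j _ => ?_
      rw [hl j, smul_eq_C_mul]; ring
    have h2 := (mul_eq_zero.mp h1).resolve_left hclast
    have h3 := Fintype.linearIndependent_iff.mp hφ l h2 (Fin.last k)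
    apply hclast
    rw [hl (Fin.last k), h3]; simp
end
end ST

namespace ST
open MvPolynomial

/-- only variables from s -/
def On {σ R : Type*} [CommSemiring R] (s : Set σ) (F : MvPolynomial σ R) : Prop :=
  ∀ e ∈ F.support, ∀ h, h ∉ s → e h = 0

section
variable {σ R : Type*} [CommRing R]

lemma On.mono {s t : Set σ} (h : s ⊆ t) {F : MvPolynomial σ R} (hF : On s F) : On t F :=
  fun e he x hx => hF e he x fun hs => hx (h hs)

lemma On.zero (s : Set σ) : On s (0 : MvPolynomial σ R) := by intro e he; simp at he

lemma On.C (s : Set σ) (c : R) : On s (MvPolynomial.C c : MvPolynomial σ R) := by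
  classical
  intro e he
  have := (support_monomial_subset (s := 0) (a := c)) he
  simp at this; simp [this]

lemma On.X {s : Set σ} {x : σ} (hx : x ∈ s) : On s (MvPolynomial.X x : MvPolynomial σ R) := by
  classical
  intro e he y hy
  have := (support_monomial_subset (s := Finsupp.single x 1) (a := (1:R))) he
  simp at this; subst this
  rw [Finsupp.single_eq_of_ne]; rintro rfl; exact hy hx

lemma On.add {s : Set σ} {F G : MvPolynomial σ R} (hF : On s F) (hG : On s G) : On s (F + G) := by
  classical
  intro e he
  rcases Finset.mem_union.mp (support_add he) with h | h
  · exact hF e h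
  · exact hG e h

lemma On.mul {s : Set σ} {F G : MvPolynomial σ R} (hF : On s F) (hG : On s G) : On s (F * G) := by
  classical
  intro e he x hx
  obtain ⟨a, ha, b, hb, rfl⟩ := Finset.mem_add.mp (support_mul F G he)
  simp [hF a ha x hx, hG b hb x hx]

lemma On.sum {s : Set σ} {ι : Type*} (t : Finset ι) {F : ι → MvPolynomial σ R}
    (hF : ∀ i ∈ t, On s (F i)) : On s (∑ i ∈ t, F i) := by
  classical
  induction t using Finset.induction_on with
  | empty => simpa using On.zero s
  | insert a t ha ih =>
    rw [Finset.sum_insert ha]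
    exact (hF a (by simp)).add (ih fun i hi => hF i (by simp [hi]))

lemma On.prod {s : Set σ} {ι : Type*} (t : Finset ι) {F : ι → MvPolynomial σ R}
    (hF : ∀ i ∈ t, On s (F i)) : On s (∏ i ∈ t, F i) := by
  classical
  induction t using Finset.induction_on with
  | empty => simpa using On.C s (1:R)
  | insert a t ha ih =>
    rw [Finset.prod_insert ha]
    exact (hF a (by simp)).mul (ih fun i hi => hF i (by simp [hi]))

lemma On.pow {s : Set σ} {F : MvPolynomial σ R} (hF : On s F) (k : ℕ) : On s (F ^ k) := by
  rw [← Fin.prod_const k]; exact On.prod _ fun _ _ => hF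

lemma On.det {s : Set σ} {k : ℕ} {A : Matrix (Fin k) (Fin k) (MvPolynomial σ R)}
    (hF : ∀ i j, On s (A i j)) : On s A.det := by
  rw [Matrix.det_apply]
  refine On.sum _ fun t _ => ?_
  have := On.prod Finset.univ (F := fun i => A (t i) i) (fun i _ => hF _ _)
  rcases Int.units_eq_one_or (Equiv.Perm.sign t) with h | h <;> rw [h]
  · simpa using this
  · have h2 : On s (MvPolynomial.C (-1 : R) * ∏ i, A (t i) i) := (On.C s _).mul this
    simpa using h2

lemma On.hd {s : Set σ} (i : σ →₀ ℕ) {F : MvPolynomial σ R} (hF : On s F) : On s (hd i F) := by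
  intro e he x hx
  have : e + i ∈ F.support := by
    rw [mem_support_iff] at he ⊢
    intro h; apply he; rw [coeff_hd, h, mul_zero]
  have := hF _ this x hx
  rw [Finsupp.add_apply] at this; omega

lemma hd_eq_zero_of_on {s : Set σ} (i : σ →₀ ℕ) {F : MvPolynomial σ R} (hF : On s F) {x : σ}
    (hx : x ∉ s) (hi : i x ≠ 0) : ST.hd i F = 0 := by
  ext e
  rw [coeff_hd, coeff_zero]
  by_cases h : e + i ∈ F.support
  · have := hF _ h x hx
    rw [Finsupp.add_apply] at this; omega
  · rw [notMem_support_iff.mp h, mul_zero]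

lemma On.bind {τ : Type*} {s : Set τ} {f : σ → MvPolynomial τ R} {F : MvPolynomial σ R}
    (h : ∀ e ∈ F.support, ∀ x, e x ≠ 0 → On s (f x)) : On s (bind₁ f F) := by
  have h' : bind₁ f F = ∑ e ∈ F.support, MvPolynomial.C (F.coeff e) * ∏ i ∈ e.support, f i ^ e i := by
    conv_lhs => rw [F.as_sum, map_sum]
    refine Finset.sum_congr rfl fun e _ => ?_
    rw [bind₁_monomial]
  rw [h']
  exact On.sum _ fun e he => (On.C s _).mul
    (On.prod _ fun i hi => (h e he i (by simpa using hi)).pow _)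

lemma coeff_mul_disj {s : Set σ} {U V : MvPolynomial σ R} (hU : On s U) (hV : On sᶜ V)
    {e μ : σ →₀ ℕ} (he : ∀ h, h ∉ s → e h = 0) (hμ : ∀ h, h ∈ s → μ h = 0) :
    coeff (e + μ) (U * V) = coeff e U * coeff μ V := by
  classical
  rw [coeff_mul, Finset.sum_eq_single (e, μ)]
  · rintro ⟨a, b⟩ hab hne
    rw [Finset.HasAntidiagonal.mem_antidiagonal] at hab
    simp only at hab ⊢
    by_cases ha : a ∈ U.support
    · by_cases hb : b ∈ V.support
      · exfalso; apply hne
        have : ∀ x, a x = e x ∧ b x = μ x := by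
          intro x
          have := DFunLike.congr_fun hab x
          simp only [Finsupp.add_apply] at this
          by_cases hx : x ∈ s
          · have h1 := hμ x hx
            have h2 := hV b hb x (by simpa using hx)
            omega
          · have h1 := he x hx
            have h2 := hU a ha x hx
            omega
        rw [Prod.mk.injEq]
        exact ⟨Finsupp.ext fun x => (this x).1, Finsupp.ext fun x => (this x).2⟩
      · rw [notMem_support_iff.mp hb, mul_zero]
    · rw [notMem_support_iff.mp ha, zero_mul]
  · intro h; simp at h

lemma hd_mul_disj {s : Set σ} {U V : MvPolynomial σ R} (hU : On s U) (hV : On sᶜ V)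
    {i l : σ →₀ ℕ} (hi : ∀ h, h ∉ s → i h = 0) (hl : ∀ h, h ∈ s → l h = 0) :
    ST.hd (i + l) (U * V) = ST.hd i U * ST.hd l V := by
  classical
  ext e
  set a := e.filter (fun x => x ∈ s)
  set b := e.filter (fun x => x ∉ s)
  have hab : e = a + b := (Finsupp.filter_add_filter_not e _).symm
  have ha : ∀ h, h ∉ s → a h = 0 := fun h hh => Finsupp.filter_apply_neg _ _ hh
  have hb : ∀ h, h ∈ s → b h = 0 := fun h hh => Finsupp.filter_apply_neg _ _ (by simpa using hh)
  rw [hab, coeff_mul_disj (hU.hd i) (hV.hd l) ha hb, coeff_hd, coeff_hd, coeff_hd]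
  have e1 : a + b + (i + l) = (a + i) + (b + l) := by abel
  rw [e1, coeff_mul_disj hU hV (by intro h hh; simp [ha h hh, hi h hh])
    (by intro h hh; simp [hb h hh, hl h hh])]
  have e2 : mch ((a + i) + (b + l)) (i + l) = mch (a + i) i * mch (b + l) l := by
    have s1 : i.support ⊆ i.support ∪ l.support := Finset.subset_union_left
    have s2 : l.support ⊆ i.support ∪ l.support := Finset.subset_union_right
    rw [mch_eq _ _ _ s1, mch_eq _ _ _ s2, mch_eq _ _ _ Finsupp.support_add, ← Finset.prod_mul_distrib]
    refine Finset.prod_congr rfl fun x _ => ?_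
    by_cases hx : x ∈ s
    · simp [hl x hx, hb x hx]
    · simp [hi x hx, ha x hx]
  rw [e2]; push_cast; ring

open Classical in
/-- extraction of a coefficient w.r.t. variables off s -/
noncomputable def extr (s : Set σ) (μ : σ →₀ ℕ) (F : MvPolynomial σ R) : MvPolynomial σ R :=
  ∑ e ∈ F.support with e.filter (fun x => x ∉ s) = μ, monomial (e.filter (fun x => x ∈ s)) (F.coeff e)

lemma coeff_extr {s : Set σ} {μ : σ →₀ ℕ} (hμ : ∀ h, h ∈ s → μ h = 0) {e : σ →₀ ℕ}
    (he : ∀ h, h ∉ s → e h = 0) (F : MvPolynomial σ R) :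
    coeff e (extr s μ F) = coeff (e + μ) F := by
  classical
  rw [extr, coeff_sum]
  simp only [coeff_monomial]
  rw [Finset.sum_eq_single (e + μ)]
  · have : (e + μ).filter (fun x => x ∈ s) = e := by
      ext x
      by_cases hx : x ∈ s
      · rw [Finsupp.filter_apply_pos _ _ hx, Finsupp.add_apply, hμ x hx, add_zero]
      · rw [Finsupp.filter_apply_neg _ _ hx, he x hx]
    simp only [this, if_true]
  · intro b hb hne
    rw [if_neg]
    intro hbe
    apply hne
    simp only [Finset.mem_filter] at hb
    rw [← hbe, ← hb.2, Finsupp.filter_add_filter_not]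
  · intro h
    simp only [Finset.mem_filter, not_and_or] at h
    have : (e + μ).filter (fun x => x ∉ s) = μ := by
      ext x
      by_cases hx : x ∈ s
      · rw [Finsupp.filter_apply_neg _ _ (by simpa using hx), hμ x hx]
      · rw [Finsupp.filter_apply_pos (fun x => x ∉ s) _ hx, Finsupp.add_apply, he x hx, zero_add]
    have h' := h.resolve_right (not_not.mpr this)
    rw [notMem_support_iff.mp h']; simp

lemma extr_on (s : Set σ) (μ : σ →₀ ℕ) (F : MvPolynomial σ R) : On s (extr s μ F) := by
  classical
  refine On.sum _ fun e _ => ?_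
  intro a ha x hx
  have := support_monomial_subset ha
  simp at this; rw [this, Finsupp.filter_apply_neg _ _ hx]

lemma extr_supp {s : Set σ} {μ : σ →₀ ℕ} (hμ : ∀ h, h ∈ s → μ h = 0) {F : MvPolynomial σ R}
    {e : σ →₀ ℕ} (he : e ∈ (extr s μ F).support) : e + μ ∈ F.support := by
  rw [mem_support_iff, ← coeff_extr hμ (extr_on s μ F e he) F, ← mem_support_iff]; exact he

lemma l1_extr (N : RingSeminorm R) (s : Set σ) (μ : σ →₀ ℕ) (F : MvPolynomial σ R) :
    l1 N (extr s μ F) ≤ l1 N F := by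
  classical
  refine (l1_sum N _ _).trans ?_
  simp only [l1_monomial]
  exact Finset.sum_le_sum_of_subset_of_nonneg (Finset.filter_subset _ _)
    fun _ _ _ => apply_nonneg N _

lemma extr_mul {s : Set σ} {μ : σ →₀ ℕ} (hμ : ∀ h, h ∈ s → μ h = 0) {U V : MvPolynomial σ R}
    (hU : On s U) (hV : On sᶜ V) : extr s μ (U * V) = MvPolynomial.C (coeff μ V) * U := by
  ext e
  by_cases he : ∀ h, h ∉ s → e h = 0
  · rw [coeff_extr hμ he, coeff_mul_disj hU hV he hμ, coeff_C_mul]; ring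
  · rw [coeff_C_mul]
    rw [notMem_support_iff.mp fun h => he (extr_on s μ _ e h),
      notMem_support_iff.mp fun h => he (hU e h), mul_zero]

lemma extr_map {S : Type*} [CommRing S] (f : R →+* S) {s : Set σ} {μ : σ →₀ ℕ}
    (hμ : ∀ h, h ∈ s → μ h = 0) (F : MvPolynomial σ R) :
    map f (extr s μ F) = extr s μ (map f F) := by
  ext e
  rw [coeff_map]
  by_cases he : ∀ h, h ∉ s → e h = 0
  · rw [coeff_extr hμ he, coeff_extr hμ he, coeff_map]
  · rw [notMem_support_iff.mp fun h => he (extr_on s μ _ e h),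
      notMem_support_iff.mp fun h => he (extr_on s μ _ e h), map_zero]

end

lemma On.Tr {σ : Type*} {s : Set σ} (ξ : σ → ℚ) {F : MvPolynomial σ ℚ} (hF : On s F) :
    On s (Tr ξ F) := by
  change On s (bind₁ (fun h => MvPolynomial.X h + MvPolynomial.C (ξ h)) F)
  refine On.bind fun e he x hx => ?_
  refine (On.X ?_).add (On.C _ _)
  by_contra hc; exact hx (hF e he x hc)

/-- rank decomposition -/
lemma decomp_reduce {M : Type*} [CommRing M] [Algebra ℚ M] (A B : Submodule ℚ M) (P : M) (n : ℕ)
    (φ ψ : Fin (n+1) → M) (hφ : ∀ i, φ i ∈ A) (hψ : ∀ i, ψ i ∈ B) (hP : P = ∑ i, φ i * ψ i)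
    (hd : ¬ LinearIndependent ℚ φ) :
    ∃ φ' ψ' : Fin n → M, (∀ i, φ' i ∈ A) ∧ (∀ i, ψ' i ∈ B) ∧ P = ∑ i, φ' i * ψ' i := by
  rw [Fintype.not_linearIndependent_iff] at hd
  obtain ⟨g, hg, i0, hi0⟩ := hd
  refine ⟨fun i => φ (i0.succAbove i),
    fun i => ψ (i0.succAbove i) - (g (i0.succAbove i) / g i0) • ψ i0, fun i => hφ _,
    fun i => B.sub_mem (hψ _) (B.smul_mem _ (hψ _)), ?_⟩
  rw [Fin.sum_univ_succAbove _ i0] at hg hP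
  have h1 : φ i0 = - ∑ i, (g (i0.succAbove i) / g i0) • φ (i0.succAbove i) := by
    have := congrArg (fun z => (g i0)⁻¹ • z) hg
    simp only [smul_add, smul_smul, inv_mul_cancel₀ hi0, one_smul, smul_zero, Finset.smul_sum] at this
    rw [eq_neg_iff_add_eq_zero, ← this]
    congr 1
    exact Finset.sum_congr rfl fun i _ => by rw [div_eq_inv_mul]
  rw [hP, h1, neg_mul, Finset.sum_mul, neg_add_eq_sub, ← Finset.sum_sub_distrib]
  refine Finset.sum_congr rfl fun i _ => ?_
  rw [mul_sub, smul_mul_assoc, mul_smul_comm]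

lemma decomp {M : Type*} [CommRing M] [Algebra ℚ M] (A B : Submodule ℚ M) (P : M) : ∀ (n : ℕ)
    (φ ψ : Fin n → M), (∀ i, φ i ∈ A) → (∀ i, ψ i ∈ B) → P = ∑ i, φ i * ψ i →
    ∃ k ≤ n, ∃ φ' ψ' : Fin k → M, (∀ i, φ' i ∈ A) ∧ (∀ i, ψ' i ∈ B) ∧ P = ∑ i, φ' i * ψ' i ∧
      LinearIndependent ℚ φ' ∧ LinearIndependent ℚ ψ' := by
  intro n
  induction n with
  | zero =>
    intro φ ψ hφ hψ hP
    exact ⟨0, le_rfl, φ, ψ, hφ, hψ, hP, linearIndependent_empty_type, linearIndependent_empty_type⟩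
  | succ n ih =>
    intro φ ψ hφ hψ hP
    by_cases h1 : LinearIndependent ℚ φ
    · by_cases h2 : LinearIndependent ℚ ψ
      · exact ⟨n+1, le_rfl, φ, ψ, hφ, hψ, hP, h1, h2⟩
      · obtain ⟨φ', ψ', a, b, c⟩ := decomp_reduce B A P n ψ φ hψ hφ
          (by rw [hP]; exact Finset.sum_congr rfl fun i _ => mul_comm _ _) h2
        obtain ⟨k, hk, r⟩ := ih ψ' φ' b a
          (by rw [c]; exact Finset.sum_congr rfl fun i _ => mul_comm _ _)
        exact ⟨k, hk.trans (Nat.le_succ n), r⟩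
    · obtain ⟨φ', ψ', a, b, c⟩ := decomp_reduce A B P n φ ψ hφ hψ hP h1
      obtain ⟨k, hk, r⟩ := ih φ' ψ' a b c
      exact ⟨k, hk.trans (Nat.le_succ n), r⟩

/-- l1 norm for integers -/
noncomputable abbrev NZ : RingSeminorm ℤ := normRingSeminorm ℤ

lemma NZ_apply (x : ℤ) : NZ x = |(x:ℝ)| := Int.norm_eq_abs x

lemma NZ_one : NZ 1 ≤ 1 := by rw [NZ_apply]; simp

lemma one_le_l1 {σ : Type*} {P : MvPolynomial σ ℤ} (hP : P ≠ 0) : 1 ≤ l1 NZ P := by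
  obtain ⟨e, he⟩ := MvPolynomial.ne_zero_iff.mp hP
  refine le_trans ?_ (coeff_le_l1 NZ P e)
  rw [NZ_apply]
  exact_mod_cast Int.one_le_abs he

/-- one variable Gauss lemma -/
lemma gauss_uni (v : Polynomial ℤ) (hv : v ≠ 0) (ξ : ℚ) :
    ∃ j, ((v.map (Int.castRingHom ℚ)).comp (Polynomial.X + Polynomial.C ξ)).coeff j ≠ 0 ∧
      (ξ.den : ℤ) ^ j ∣ v.leadingCoeff := by
  have hv' : v.map (Int.castRingHom ℚ) ≠ 0 := by
    rwa [Ne, Polynomial.map_eq_zero_iff (RingHom.injective_int _)]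
  obtain ⟨g, hg, hnd⟩ := Polynomial.exists_eq_pow_rootMultiplicity_mul_and_not_dvd _ hv' ξ
  set j := Polynomial.rootMultiplicity ξ (v.map (Int.castRingHom ℚ))
  refine ⟨j, ?_, ?_⟩
  · rw [hg, Polynomial.mul_comp, Polynomial.pow_comp]
    have : (Polynomial.X - Polynomial.C ξ).comp (Polynomial.X + Polynomial.C ξ) = Polynomial.X := by
      simp
    rw [this, mul_comm, Polynomial.coeff_mul_X_pow', if_pos le_rfl, Nat.sub_self,
      Polynomial.coeff_zero_eq_eval_zero, Polynomial.eval_comp]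
    rw [Polynomial.dvd_iff_isRoot, Polynomial.IsRoot] at hnd
    simpa using hnd
  · set l : Polynomial ℤ := Polynomial.C (ξ.den : ℤ) * Polynomial.X - Polynomial.C ξ.num with hl
    have hden : (ξ.den : ℤ) ≠ 0 := by exact_mod_cast ξ.den_ne_zero
    have hl1 : l.leadingCoeff = ξ.den := by
      rw [hl, sub_eq_add_neg, ← Polynomial.C_neg]
      exact Polynomial.leadingCoeff_linear hden
    have hprim : l.IsPrimitive := by
      intro r hr
      rw [Polynomial.C_dvd_iff_dvd_coeff] at hr
      have h0 := hr 0
      have h1 := hr 1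
      simp [hl, Polynomial.coeff_X, Polynomial.coeff_C, -eq_intCast, -map_intCast, -map_natCast] at h0 h1
      have := Int.isCoprime_iff_gcd_eq_one.mpr (by simpa [Int.gcd] using ξ.reduced : Int.gcd ξ.num ξ.den = 1)
      exact this.isUnit_of_dvd' h0 h1
    have hprimj : (l ^ j).IsPrimitive := by
      induction j with
      | zero => simpa using Polynomial.isPrimitive_one
      | succ n ih => rw [pow_succ]; exact ih.mul hprim
    have hd : l ^ j ∣ v := by
      rw [Polynomial.IsPrimitive.Int.dvd_iff_map_cast_dvd_map_cast _ _ hprimj]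
      have hml : l.map (Int.castRingHom ℚ) = Polynomial.C (ξ.den : ℚ) * (Polynomial.X - Polynomial.C ξ) := by
        rw [hl, mul_sub, ← Polynomial.C_mul, Rat.den_mul_eq_num]; simp
      have h1 : (Polynomial.X - Polynomial.C ξ) ^ j ∣ v.map (Int.castRingHom ℚ) := ⟨g, hg⟩
      rw [Polynomial.map_pow, hml, mul_pow]
      have hu : IsUnit (Polynomial.C (ξ.den : ℚ) ^ j) :=
        (Polynomial.isUnit_C.mpr (by simp : (ξ.den:ℚ) ≠ 0).isUnit).pow j
      exact hu.mul_left_dvd.mpr h1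
    obtain ⟨c, hc⟩ := hd
    rw [hc, Polynomial.leadingCoeff_mul, Polynomial.leadingCoeff_pow, hl1]
    exact Dvd.intro _ rfl

lemma gauss_mv (m : ℕ) (F : MvPolynomial ℕ ℤ) (hF : F ≠ 0) (hon : On {m} F) (ξ : ℕ → ℚ) :
    ∃ j, coeff (Finsupp.single m j) (Tr ξ (map (Int.castRingHom ℚ) F)) ≠ 0 ∧
      ((ξ m).den : ℝ) ^ j ≤ l1 NZ F := by
  classical
  set v : Polynomial ℤ := ∑ e ∈ F.support, Polynomial.monomial (e m) (F.coeff e) with hv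
  have hFv : F = Polynomial.aeval (X m : MvPolynomial ℕ ℤ) v := by
    conv_lhs => rw [F.as_sum]
    rw [hv, map_sum]
    refine Finset.sum_congr rfl fun e he => ?_
    rw [Polynomial.aeval_monomial, ← C_eq_algebraMap]
    have : e = Finsupp.single m (e m) := by
      ext x
      rcases eq_or_ne x m with rfl | h
      · simp
      · rw [Finsupp.single_eq_of_ne h]; exact hon e he x h
    have e2 : monomial e (coeff e F) = monomial (Finsupp.single m (e m)) (coeff e F) := by
      rw [← this]
    rw [e2, monomial_eq]; simp
  have hcoef : ∀ {S : Type} [CommRing S] (u : Polynomial S) (j : ℕ),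
      coeff (Finsupp.single m j) (Polynomial.aeval (X m : MvPolynomial ℕ S) u) = u.coeff j := by
    intro S _ u j
    rw [Polynomial.aeval_eq_sum_range, coeff_sum]
    simp only [coeff_smul, coeff_X_pow, smul_eq_mul]
    by_cases hj : j ∈ Finset.range (u.natDegree + 1)
    · rw [Finset.sum_eq_single j]
      · simp
      · intro b _ hb; rw [if_neg]; simp; intro h
        exact hb (Finsupp.single_injective m h)
      · intro h; exact absurd hj h
    · rw [Finset.sum_eq_zero, Polynomial.coeff_eq_zero_of_natDegree_lt]
      · simp at hj; omega
      · intro b hb; rw [if_neg]; simp; intro h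
        have := Finsupp.single_injective m h
        subst this; exact hj hb
  have hv0 : v ≠ 0 := by rintro h; rw [h] at hFv; simp at hFv; exact hF hFv
  obtain ⟨j, h1, h2⟩ := gauss_uni v hv0 (ξ m)
  refine ⟨j, ?_, ?_⟩
  · have : Tr ξ (map (Int.castRingHom ℚ) F) = Polynomial.aeval (X m : MvPolynomial ℕ ℚ)
      ((v.map (Int.castRingHom ℚ)).comp (Polynomial.X + Polynomial.C (ξ m))) := by
      have e1 : map (Int.castRingHom ℚ) F = Polynomial.aeval (X m : MvPolynomial ℕ ℚ) (v.map (Int.castRingHom ℚ)) := by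
        conv_lhs => rw [hFv]
        simp only [Polynomial.aeval_def, Polynomial.hom_eval₂, Polynomial.eval₂_map, map_X]
        congr 1
        ext x; simp
      rw [e1, Polynomial.aeval_comp, ← Polynomial.aeval_algHom_apply]
      simp [Tr]
    rw [this, hcoef]; exact h1
  · refine le_trans ?_ (coeff_le_l1 NZ F (Finsupp.single m v.natDegree))
    rw [NZ_apply]
    have : coeff (Finsupp.single m v.natDegree) F = v.leadingCoeff := by
      conv_lhs => rw [hFv]
      exact hcoef v _
    rw [this]
    have h3 := Int.le_of_dvd (abs_pos.mpr (Polynomial.leadingCoeff_ne_zero.mpr hv0)) ((dvd_abs _ _).mpr h2)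
    exact_mod_cast h3
end ST

namespace ST
open MvPolynomial

lemma l1_det {σ : Type*} {k : ℕ} (A : Matrix (Fin k) (Fin k) (MvPolynomial σ ℤ)) (B : ℝ)
    (h : ∀ i j, l1 NZ (A i j) ≤ B) : l1 NZ A.det ≤ k.factorial * B ^ k := by
  rw [Matrix.det_apply]
  refine (l1_sum NZ _ _).trans ?_
  have : ∀ s ∈ (Finset.univ : Finset (Equiv.Perm (Fin k))),
      l1 NZ (Equiv.Perm.sign s • ∏ i, A (s i) i) ≤ B ^ k := by
    intro s _
    have h1 : l1 NZ (∏ i, A (s i) i) ≤ B ^ k := by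
      refine (l1_prod NZ NZ_one _ _).trans ?_
      refine (Finset.prod_le_prod (fun i _ => l1_nonneg NZ _) (fun i _ => h (s i) i)).trans ?_
      simp
    rcases Int.units_eq_one_or (Equiv.Perm.sign s) with h | h <;> rw [h]
    · simpa using h1
    · simpa [l1_neg] using h1
  refine (Finset.sum_le_card_nsmul _ _ _ this).trans ?_
  rw [Finset.card_univ, Fintype.card_perm, Fintype.card_fin, nsmul_eq_mul]

lemma sum_max_bound (a : ℝ) (ha : 0 < a) (ha1 : a ≤ 1) (r k : ℕ) (hr : 1 ≤ r) (hk : 1 ≤ k)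
    (hkr : k ≤ r + 1) : a ^ 2 * k / 8 ≤ ∑ l : Fin k, max 0 (a - (l:ℕ) / (r:ℝ)) := by
  rw [Fin.sum_univ_eq_sum_range (fun l => max 0 (a - (l:ℝ) / (r:ℝ)))]
  have hk' : (1:ℝ) ≤ k := by exact_mod_cast hk
  have hr' : (1:ℝ) ≤ r := by exact_mod_cast hr
  have hkr' : (k:ℝ) ≤ r + 1 := by exact_mod_cast hkr
  set t := ⌊a * k / 4⌋₊ + 1 with ht
  have hfl : (⌊a * k / 4⌋₊ : ℝ) ≤ a * k / 4 := Nat.floor_le (by positivity)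
  have htk : t ≤ k := by
    have : (⌊a * k / 4⌋₊ : ℝ) < k := by nlinarith
    have : ⌊a * k / 4⌋₊ < k := by exact_mod_cast this
    omega
  have h1 : ∑ l ∈ Finset.range t, max 0 (a - (l:ℝ) / (r:ℝ)) ≤
      ∑ l ∈ Finset.range k, max 0 (a - (l:ℝ) / (r:ℝ)) :=
    Finset.sum_le_sum_of_subset_of_nonneg (Finset.range_subset_range.mpr htk)
      (fun _ _ _ => le_max_left _ _)
  refine le_trans ?_ h1
  have h2 : ∀ l ∈ Finset.range t, a / 2 ≤ max 0 (a - (l:ℝ) / (r:ℝ)) := by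
    intro l hl
    refine le_max_of_le_right ?_
    have : l ≤ ⌊a * k / 4⌋₊ := by simp [ht] at hl; omega
    have : (l:ℝ) ≤ a * k / 4 := le_trans (by exact_mod_cast this) hfl
    have : (l:ℝ) / r ≤ a / 2 := by
      rw [div_le_iff₀ (by linarith)]; nlinarith
    linarith
  have h3 := Finset.card_nsmul_le_sum _ _ _ h2
  rw [Finset.card_range, nsmul_eq_mul] at h3
  refine le_trans ?_ h3
  have : a * k / 4 < (t:ℝ) := by rw [ht]; push_cast; exact Nat.lt_floor_add_one _
  nlinarith

/-- weights for Roth's lemma -/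
noncomputable def wt (m : ℕ) (r : ℕ → ℕ) (h : ℕ) : ℝ := if h < m then 1 / (r h : ℝ) else 0

lemma wt_nonneg (m : ℕ) (r : ℕ → ℕ) (h : ℕ) : 0 ≤ wt m r h := by
  rw [wt]; split_ifs <;> positivity

/-- canonical decomposition of P w.r.t. the last variable -/
lemma canon_decomp (m n : ℕ) (P : MvPolynomial ℕ ℚ)
    (hP : ∀ e ∈ P.support, e m ≤ n ∧ ∀ h, m + 1 ≤ h → e h = 0) :
    ∃ φ ψ : Fin (n+1) → MvPolynomial ℕ ℚ, (∀ i, On {h | h < m} (φ i)) ∧ (∀ i, On {m} (ψ i)) ∧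
      P = ∑ i, φ i * ψ i := by
  classical
  refine ⟨fun i => extr {h | h < m} (Finsupp.single m i) P, fun i => X m ^ (i:ℕ),
    fun i => extr_on _ _ _, fun i => (On.X (Set.mem_singleton m)).pow _, ?_⟩
  ext e
  rw [coeff_sum]
  have hsum : ∀ i : Fin (n+1), coeff e (extr {h | h < m} (Finsupp.single m (i:ℕ)) P * X m ^ (i:ℕ))
      = if (i:ℕ) = e m then coeff e P else 0 := by
    intro i
    have hX : (X m ^ (i:ℕ) : MvPolynomial ℕ ℚ) = monomial (Finsupp.single m (i:ℕ)) 1 := by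
      rw [X_pow_eq_monomial]
    rw [hX, coeff_mul_monomial', mul_one]
    have hμ : ∀ h, h ∈ {h | h < m} → (Finsupp.single m (i:ℕ)) h = 0 := by
      intro h hh; rw [Finsupp.single_eq_of_ne]; simp at hh; omega
    split_ifs with h1 h2 h2
    · by_cases he : ∀ h, m + 1 ≤ h → e h = 0
      · rw [coeff_extr hμ, tsub_add_cancel_of_le h1]
        intro h hh
        simp only [Set.mem_setOf_eq, not_lt] at hh
        rw [Finsupp.tsub_apply]
        rcases eq_or_lt_of_le hh with rfl | h3
        · simp; omega
        · rw [he h h3]; simp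
      · rw [notMem_support_iff.mp fun h => he (hP e h).2]
        push Not at he
        obtain ⟨h, hh, hne⟩ := he
        rw [← notMem_support_iff]
        intro hc
        have := extr_on _ _ _ _ hc h (by simp; omega)
        rw [Finsupp.tsub_apply, Finsupp.single_eq_of_ne (by omega)] at this
        omega
    · rw [← notMem_support_iff]
      intro hc
      have := extr_on _ _ _ _ hc m (by simp)
      rw [Finsupp.tsub_apply] at this
      rw [Finsupp.single_le_iff] at h1
      simp at this; omega
    · exfalso; apply h1; rw [Finsupp.single_le_iff]; omega
    · rfl
  simp only [hsum]
  by_cases he : e ∈ P.support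
  · have h1 := (hP e he).1
    rw [Finset.sum_eq_single ⟨e m, by omega⟩]
    · simp
    · intro b _ hb; rw [if_neg]; intro h; apply hb; ext; simpa using h
    · simp
  · rw [notMem_support_iff.mp he]; simp

lemma deg_det {k : ℕ} (A : Matrix (Fin k) (Fin k) (MvPolynomial ℕ ℤ)) (h r : ℕ)
    (hA : ∀ i j, ∀ e ∈ (A i j).support, e h ≤ r) : ∀ e ∈ A.det.support, e h ≤ k * r := by
  classical
  have hw : ∀ e : ℕ →₀ ℕ, Finsupp.weight (Pi.single h (-1:ℝ)) e = - (e h : ℝ) := by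
    intro e
    rw [Finsupp.weight_apply, Finsupp.sum, Finset.sum_eq_single h]
    · simp
    · intro b _ hb; simp [Pi.single_eq_of_ne hb]
    · intro hh; simp at hh; simp [hh]
  have : Ord (Pi.single h (-1:ℝ)) (∑ _j : Fin k, (-(r:ℝ))) A.det := by
    refine Ord.det (θ := fun _ => -(r:ℝ)) fun i j e he => ?_
    rw [hw]; simpa using hA i j e he
  intro e he
  have := this e he
  rw [hw] at this
  simp at this
  exact_mod_cast this

set_option maxHeartbeats 1600000 in
theorem roth_step (m : ℕ) (ε ω1 ω : ℝ) (hε : 0 < ε) (hε1 : ε ≤ 1) (hω0 : 0 < ω)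
    (hω1 : 3 * ω ≤ ω1) (hω2 : 3 * ω ≤ ε ^ 2 / 65) (hω11 : ω1 ≤ 1)
    (IH : ∀ (r : ℕ → ℕ) (K : ℝ) (ξ : ℕ → ℚ) (P : MvPolynomial ℕ ℤ), P ≠ 0 → (∀ h < m, 1 ≤ r h) →
      (∀ h, h + 1 < m → (r (h+1) : ℝ) ≤ ω1 * r h) →
      (∀ e ∈ P.support, (∀ h < m, e h ≤ r h) ∧ ∀ h, m ≤ h → e h = 0) →
      (∀ h < m, K ≤ r h * Real.log (ξ h).den) → l1 NZ P ≤ Real.exp (ω1 * K) →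
      ∑ h ∈ Finset.range m, (r h : ℝ) ≤ ω1 * K →
      ∃ e ∈ (Tr ξ (map (Int.castRingHom ℚ) P)).support, Finsupp.weight (wt m r) e ≤ ε ^ 2 / 65)
    (r : ℕ → ℕ) (K : ℝ) (ξ : ℕ → ℚ) (P : MvPolynomial ℕ ℤ) (hP : P ≠ 0)
    (hr : ∀ h < m + 1, 1 ≤ r h) (hrr : ∀ h, h + 1 < m + 1 → (r (h+1) : ℝ) ≤ ω * r h)
    (hsupp : ∀ e ∈ P.support, (∀ h < m + 1, e h ≤ r h) ∧ ∀ h, m + 1 ≤ h → e h = 0)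
    (hK : ∀ h < m + 1, K ≤ r h * Real.log (ξ h).den) (hl : l1 NZ P ≤ Real.exp (ω * K))
    (hs : ∑ h ∈ Finset.range (m+1), (r h : ℝ) ≤ ω * K) :
    ∃ e ∈ (Tr ξ (map (Int.castRingHom ℚ) P)).support, Finsupp.weight (wt (m+1) r) e ≤ ε := by
  classical
  set ι := Int.castRingHom ℚ with hι
  have hιinj : Function.Injective ι := RingHom.injective_int _
  set PQ := map ι P with hPQ
  have hPQsupp : ∀ e ∈ PQ.support, e ∈ P.support := fun e he => support_map_subset _ _ he
  obtain ⟨φ0, ψ0, hφ0, hψ0, hdec0⟩ := canon_decomp m (r m) PQ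
    (fun e he => ⟨(hsupp e (hPQsupp e he)).1 m (by omega), (hsupp e (hPQsupp e he)).2⟩)
  let A : Submodule ℚ (MvPolynomial ℕ ℚ) :=
    { carrier := {F | On {h | h < m} F}, add_mem' := fun a b => a.add b, zero_mem' := On.zero _,
      smul_mem' := fun c F hF => by
        change On _ (c • F); rw [smul_eq_C_mul]; exact (On.C _ c).mul hF }
  let B : Submodule ℚ (MvPolynomial ℕ ℚ) :=
    { carrier := {F | On {m} F}, add_mem' := fun a b => a.add b, zero_mem' := On.zero _,
      smul_mem' := fun c F hF => by
        change On _ (c • F); rw [smul_eq_C_mul]; exact (On.C _ c).mul hF }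
  obtain ⟨k, hk, φ, ψ, hφ, hψ, hdec, hφi, hψi⟩ := decomp A B PQ _ φ0 ψ0 hφ0 hψ0 hdec0
  have hφ' : ∀ i, On {h | h < m} (φ i) := hφ
  have hψ' : ∀ i, On {m} (ψ i) := hψ
  have hsub : ({m} : Set ℕ) ⊆ {h | h < m}ᶜ := by
    intro x hx
    simp only [Set.mem_singleton_iff] at hx
    subst hx; simp
  have hk1 : 1 ≤ k := by
    rcases Nat.eq_zero_or_pos k with h | h
    · subst h
      exfalso; apply hP
      rw [hPQ] at hdec
      simp only [Finset.univ_eq_empty, Finset.sum_empty] at hdec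
      exact map_injective _ hιinj (by rw [hdec, map_zero])
    · exact h
  obtain ⟨Δ, hΔ, hU⟩ := wronskian k φ hφi
  obtain ⟨Λ, hΛ, hV⟩ := wronskian k ψ hψi
  set UM := Matrix.of fun i j => hd (Δ i) (φ j) with hUM
  set VM := Matrix.of fun i j => hd (Λ i) (ψ j) with hVM
  -- supports of Δ, Λ
  have hΔon : ∀ i h, h ∉ {h | h < m} → Δ i h = 0 := by
    intro i h hh
    by_contra hc
    exact hU (Matrix.det_eq_zero_of_row_eq_zero i fun j => hd_eq_zero_of_on _ (hφ' j) hh hc)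
  have hΛon : ∀ i h, h ∉ ({m} : Set ℕ) → Λ i h = 0 := by
    intro i h hh
    by_contra hc
    exact hV (Matrix.det_eq_zero_of_row_eq_zero i fun j => hd_eq_zero_of_on _ (hψ' j) hh hc)
  have hΛon' : ∀ i h, h ∈ {h | h < m} → Λ i h = 0 := by
    intro i h hh; apply hΛon; simp at hh ⊢; omega
  set WM : Matrix (Fin k) (Fin k) (MvPolynomial ℕ ℤ) := Matrix.of fun i l => hd (Δ i + Λ l) P with hWM
  set W := WM.det with hW
  have hmapW : map ι W = UM.det * VM.det := by
    rw [hW, RingHom.map_det, ← Matrix.det_transpose VM, ← Matrix.det_mul]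
    congr 1
    ext1 i l
    simp only [RingHom.mapMatrix_apply, Matrix.map_apply, hWM, Matrix.of_apply, Matrix.mul_apply,
      Matrix.transpose_apply, hUM, hVM]
    rw [hd_map, ← hPQ, hdec, hd_sum]
    refine Finset.sum_congr rfl fun j _ => ?_
    exact hd_mul_disj (hφ' j) ((hψ' j).mono hsub) (hΔon i) (hΛon' l)
  have hUon : On {h | h < m} UM.det := On.det fun i j => (hφ' j).hd _
  have hVon : On {m} VM.det := On.det fun i j => (hψ' j).hd _
  have hVon' := hVon.mono hsub
  -- sizes
  set s := ∑ h ∈ Finset.range (m+1), r h with hsdef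
  have hsR : (s:ℝ) ≤ ω * K := by rw [hsdef]; push_cast; exact hs
  have hs1 : r m ≤ s := Finset.single_le_sum (f := r) (fun _ _ => Nat.zero_le _) (by simp)
  have hrm : 1 ≤ r m := hr m (by omega)
  have hKpos : 0 < K := by
    have : (1:ℝ) ≤ s := by exact_mod_cast hrm.trans hs1
    by_contra hc
    push Not at hc
    nlinarith
  have hdeg : ∀ e ∈ P.support, e.degree ≤ s := by
    intro e he
    rw [Finsupp.degree_apply]
    calc ∑ i ∈ e.support, e i ≤ ∑ i ∈ Finset.range (m+1), e i := by
          refine Finset.sum_le_sum_of_subset fun x hx => ?_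
          simp only [Finsupp.mem_support_iff] at hx
          by_contra hc; simp at hc; exact hx ((hsupp e he).2 x hc)
      _ ≤ s := Finset.sum_le_sum fun i hi => (hsupp e he).1 i (by simpa using hi)
  have hl1W : l1 NZ W ≤ Real.exp (3 * ω * (k * K)) := by
    have hb : ∀ i j, l1 NZ (WM i j) ≤ 2 ^ s * Real.exp (ω * K) := fun i j =>
      (hd_l1 NZ NZ_one _ _ s hdeg).trans (by gcongr)
    refine (l1_det WM _ hb).trans ?_
    have h1 : (k.factorial : ℝ) ≤ Real.exp (ω * K) ^ k := by
      have h2 : k.factorial ≤ (2 ^ s) ^ k := by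
        refine (Nat.factorial_le_pow k).trans (Nat.pow_le_pow_left ?_ _)
        have : r m + 1 ≤ 2 ^ (r m) := Nat.lt_two_pow_self
        exact hk.trans (this.trans (Nat.pow_le_pow_right (by norm_num) hs1))
      calc (k.factorial : ℝ) ≤ ((2:ℝ) ^ s) ^ k := by exact_mod_cast h2
        _ ≤ (Real.exp 1 ^ s) ^ k := by gcongr; have := Real.add_one_le_exp 1; linarith
        _ ≤ _ := by
          gcongr; rw [← Real.exp_nat_mul]; exact Real.exp_le_exp.mpr (by linarith)
    have h3 : (2:ℝ) ^ s ≤ Real.exp (ω * K) := by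
      calc (2:ℝ) ^ s ≤ Real.exp 1 ^ s := by gcongr; have := Real.add_one_le_exp 1; linarith
        _ ≤ _ := by rw [← Real.exp_nat_mul]; exact Real.exp_le_exp.mpr (by linarith)
    calc (k.factorial : ℝ) * (2 ^ s * Real.exp (ω * K)) ^ k
        ≤ Real.exp (ω * K) ^ k * (Real.exp (ω * K) * Real.exp (ω * K)) ^ k := by gcongr
      _ = Real.exp (3 * ω * (k * K)) := by
        rw [← Real.exp_add, ← Real.exp_nat_mul, ← Real.exp_nat_mul, ← Real.exp_add]; congr 1; ring
  have hWdeg : ∀ h < m + 1, ∀ e ∈ W.support, e h ≤ k * r h := by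
    intro h hh
    refine deg_det WM h (r h) fun i j e he => ?_
    have : e + (Δ i + Λ j) ∈ P.support := by
      rw [mem_support_iff] at he ⊢
      intro h0; apply he; rw [hWM, Matrix.of_apply, coeff_hd, h0, mul_zero]
    have := (hsupp _ this).1 h hh
    simp only [Finsupp.add_apply] at this
    omega
  -- pick monomials
  obtain ⟨μV, hμV⟩ := MvPolynomial.ne_zero_iff.mp hV
  obtain ⟨μU, hμU⟩ := MvPolynomial.ne_zero_iff.mp hU
  have hμV0 : ∀ h, h ∈ {h | h < m} → μV h = 0 := by
    intro h hh; exact hVon' μV (mem_support_iff.mpr hμV) h (by simpa using hh)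
  have hμU0 : ∀ h, h ∈ ({h | h < m}ᶜ : Set ℕ) → μU h = 0 :=
    fun h hh => hUon μU (mem_support_iff.mpr hμU) h hh
  set U' := extr {h | h < m} μV W with hU'
  set V' := extr ({h | h < m}ᶜ) μU W with hV'
  have hmU : map ι U' = C (coeff μV VM.det) * UM.det := by
    rw [hU', extr_map _ hμV0, hmapW, extr_mul hμV0 hUon hVon']
  have hmV : map ι V' = C (coeff μU UM.det) * VM.det := by
    rw [hV', extr_map _ hμU0, hmapW, mul_comm UM.det, extr_mul hμU0 hVon' (by rwa [compl_compl])]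
  have hU'0 : U' ≠ 0 := by
    rintro h; rw [h, map_zero] at hmU
    exact mul_ne_zero (by rwa [Ne, C_eq_zero]) hU hmU.symm
  have hV'0 : V' ≠ 0 := by
    rintro h; rw [h, map_zero] at hmV
    exact mul_ne_zero (by rwa [Ne, C_eq_zero]) hV hmV.symm
  have hV'on : On {m} V' := by
    intro e he h hh
    have : e ∈ (map ι V').support := by
      rw [mem_support_iff] at he ⊢; rw [coeff_map]
      exact fun h0 => he (hιinj (by rw [h0, map_zero]))
    exact (hmV ▸ (On.C _ _).mul hVon) e this h hh
  have hkR : (1:ℝ) ≤ k := by exact_mod_cast hk1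
  -- apply IH
  obtain ⟨e1, he1, hw1⟩ := IH (fun h => k * r h) (k * K) ξ U' hU'0
    (fun h hh => Nat.mul_pos hk1 (hr h (by omega)))
    (fun h hh => by
      have := hrr h (by omega)
      push_cast
      have h5 : ω * r h ≤ ω1 * r h := by gcongr; linarith
      nlinarith)
    (fun e he => ⟨fun h hh => by
        have := hWdeg h (by omega) _ (extr_supp hμV0 he)
        rw [Finsupp.add_apply] at this; omega,
      fun h hh => extr_on _ _ _ e he h (by simpa using hh)⟩)
    (fun h hh => by
      have := hK h (by omega); push_cast; rw [mul_assoc]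
      exact mul_le_mul_of_nonneg_left this (by linarith))
    ((l1_extr NZ _ _ _).trans (hl1W.trans (Real.exp_le_exp.mpr (by gcongr))))
    (by
      push_cast
      rw [← Finset.mul_sum]
      have h6 : ∑ h ∈ Finset.range m, (r h : ℝ) ≤ ω * K :=
        (Finset.sum_le_sum_of_subset_of_nonneg (Finset.range_subset_range.mpr (Nat.le_succ m))
          (fun _ _ _ => Nat.cast_nonneg _)).trans hs
      have h7 : ω * K ≤ ω1 * K := by gcongr; linarith
      nlinarith)
  obtain ⟨j, hj1, hj2⟩ := gauss_mv m V' hV'0 hV'on ξ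
  have hj3 : (j:ℝ) ≤ r m * (k * (ε^2/65)) := by
    have h1 : ((ξ m).den : ℝ) ^ j ≤ Real.exp (3 * ω * (k * K)) :=
      hj2.trans ((l1_extr NZ _ _ _).trans hl1W)
    have hden : (0:ℝ) < (ξ m).den := by exact_mod_cast (ξ m).den_pos
    have h2 := Real.log_le_log (by positivity) h1
    rw [Real.log_pow, Real.log_exp] at h2
    have h3 := hK m (by omega)
    have h4 : (j:ℝ) * K ≤ r m * (k * (3 * ω)) * K := by
      calc (j:ℝ) * K ≤ j * (r m * Real.log (ξ m).den) := by gcongr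
        _ = r m * (j * Real.log (ξ m).den) := by ring
        _ ≤ r m * (3 * ω * (k * K)) := by gcongr
        _ = _ := by ring
    have h5 := le_of_mul_le_mul_right h4 hKpos
    refine h5.trans (by gcongr)
  -- Tr facts
  have hTC : ∀ c, Tr ξ (C c) = C c := by intro c; simp [Tr]
  have hTU : coeff e1 (Tr ξ UM.det) ≠ 0 := by
    rw [hmU, map_mul, hTC, mem_support_iff, coeff_C_mul] at he1
    exact right_ne_zero_of_mul he1
  have hTV : coeff (Finsupp.single m j) (Tr ξ VM.det) ≠ 0 := by
    rw [hmV, map_mul, hTC, coeff_C_mul] at hj1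
    exact right_ne_zero_of_mul hj1
  have he1on : ∀ h, h ∉ {h | h < m} → e1 h = 0 := (hUon.Tr ξ) e1 (mem_support_iff.mpr hTU)
  have hTW : coeff (e1 + Finsupp.single m j) (Tr ξ (map ι W)) ≠ 0 := by
    rw [hmapW, map_mul, coeff_mul_disj (hUon.Tr ξ) (hVon'.Tr ξ) he1on]
    · exact mul_ne_zero hTU hTV
    · intro h hh; rw [Finsupp.single_eq_of_ne]; simp at hh; omega
  have hrmR : (1:ℝ) ≤ r m := by exact_mod_cast hrm
  have hwt : Finsupp.weight (wt (m+1) r) (e1 + Finsupp.single m j) ≤ 2 * k * (ε^2/65) := by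
    rw [map_add]
    have a1 : Finsupp.weight (wt (m+1) r) e1 = k * Finsupp.weight (wt m (fun h => k * r h)) e1 := by
      rw [Finsupp.weight_apply, Finsupp.weight_apply, Finsupp.sum, Finsupp.sum, Finset.mul_sum]
      refine Finset.sum_congr rfl fun h hh => ?_
      have hm : h < m := by
        by_contra hc
        simp at hh; exact hh (he1on h (by simpa using hc))
      rw [wt, wt, if_pos (by omega), if_pos hm]
      have : (1:ℝ) ≤ r h := by exact_mod_cast hr h (by omega)
      push_cast
      simp only [nsmul_eq_mul]
      field_simp
    have a2 : Finsupp.weight (wt (m+1) r) (Finsupp.single m j) = j / r m := by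
      rw [Finsupp.weight_single, wt, if_pos (by omega)]; simp [div_eq_mul_inv]
    rw [a1, a2]
    have : (j:ℝ) / r m ≤ k * (ε^2/65) := by
      rw [div_le_iff₀ (by linarith)]; linarith
    have : (k:ℝ) * Finsupp.weight (wt m (fun h => k * r h)) e1 ≤ k * (ε^2/65) := by gcongr
    linarith
  -- order of vanishing
  by_contra hcon
  push Not at hcon
  have hOrd : Ord (wt (m+1) r) ε (Tr ξ PQ) := fun e he => (hcon e he).le
  set a := ε - ω with ha
  have hωε : ω ≤ ε / 2 := by nlinarith
  have hwΔ : ∀ i, Finsupp.weight (wt (m+1) r) (Δ i) ≤ ω := by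
    intro i
    have hrh : ∀ d h, h + d = m → h < m → (r m : ℝ) ≤ ω * r h := by
      intro d
      induction d with
      | zero => intro h h1 h2; omega
      | succ d ih =>
        intro h h1 h2
        have a1 := hrr h (by omega)
        rcases Nat.lt_or_ge (h+1) m with h3 | h3
        · have a2 := ih (h+1) (by omega) h3
          have : (0:ℝ) ≤ r (h+1) := Nat.cast_nonneg _
          nlinarith
        · have : h + 1 = m := by omega
          rw [← this]; exact a1
    have hb : ∀ h ∈ (Δ i).support, (Δ i h) • wt (m+1) r h ≤ (Δ i h : ℝ) * (ω / r m) := by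
      intro h hh
      have hm : h < m := by
        by_contra hc
        simp at hh; exact hh (hΔon i h (by simpa using hc))
      rw [nsmul_eq_mul, wt, if_pos (by omega)]
      refine mul_le_mul_of_nonneg_left ?_ (Nat.cast_nonneg _)
      have h1 : (1:ℝ) ≤ r h := by exact_mod_cast hr h (by omega)
      have h2 := hrh (m - h) h (by omega) hm
      rw [div_le_div_iff₀ (by linarith) (by linarith)]; linarith
    rw [Finsupp.weight_apply]
    refine (Finset.sum_le_sum hb).trans ?_
    rw [← Finset.sum_mul]
    have h3 : (∑ h ∈ (Δ i).support, (Δ i h : ℝ)) ≤ r m := by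
      have : (Δ i).degree ≤ r m := by have := hΔ i; have := i.2; omega
      rw [Finsupp.degree_apply] at this
      exact_mod_cast this
    calc _ ≤ (r m : ℝ) * (ω / r m) := by gcongr
      _ = ω := by field_simp
  have hwΛ : ∀ l : Fin k, Finsupp.weight (wt (m+1) r) (Λ l) ≤ (l:ℕ) / (r m : ℝ) := by
    intro l
    have : Λ l = Finsupp.single m (Λ l m) := by
      ext x
      rcases eq_or_ne x m with rfl | h
      · simp
      · rw [Finsupp.single_eq_of_ne h]; exact hΛon l x h
    have h2 : Λ l m ≤ l := (Finsupp.le_degree m (Λ l)).trans (hΛ l)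
    rw [this, Finsupp.weight_single, wt, if_pos (by omega), nsmul_eq_mul, mul_one_div]
    gcongr
  have hOrdW : Ord (wt (m+1) r) (∑ l : Fin k, max 0 (a - (l:ℕ) / (r m:ℝ))) (Tr ξ (map ι W)) := by
    have : Tr ξ (map ι W) = (Matrix.of fun i l => hd (Δ i + Λ l) (Tr ξ PQ)).det := by
      rw [hW, RingHom.map_det, AlgHom.map_det]
      congr 1
      ext1 i l
      simp only [RingHom.mapMatrix_apply, AlgHom.mapMatrix_apply, Matrix.map_apply, hWM, Matrix.of_apply]
      rw [hd_map, hd_Tr]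
    rw [this]
    refine Ord.det (θ := fun l : Fin k => max 0 (a - (l:ℕ) / (r m:ℝ))) fun i l => ?_
    rw [Matrix.of_apply]
    rcases le_total (a - (l:ℕ) / (r m:ℝ)) 0 with h | h
    · rw [max_eq_left h]; exact Ord.of_nonpos (wt_nonneg _ _) le_rfl _
    · rw [max_eq_right h]
      refine Ord.mono ?_ (hd_ord _ hOrd)
      rw [map_add]
      have := hwΔ i
      have := hwΛ l
      linarith
  have hfin := hOrdW _ (mem_support_iff.mpr hTW)
  have hb := sum_max_bound a (by linarith) (by linarith) (r m) k hrm hk1 hk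
  have : a ^ 2 * k / 8 ≤ 2 * k * (ε^2/65) := hb.trans (hfin.trans hwt)
  have ha2 : ε ^ 2 / 4 ≤ a ^ 2 := by nlinarith
  nlinarith [mul_pos hε hε]

theorem roth : ∀ (m : ℕ) (ε : ℝ), 0 < ε → ε ≤ 1 → ∃ ω : ℝ, 0 < ω ∧ ω ≤ 1 ∧
    ∀ (r : ℕ → ℕ) (K : ℝ) (ξ : ℕ → ℚ) (P : MvPolynomial ℕ ℤ), P ≠ 0 → (∀ h < m, 1 ≤ r h) →
      (∀ h, h + 1 < m → (r (h+1) : ℝ) ≤ ω * r h) →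
      (∀ e ∈ P.support, (∀ h < m, e h ≤ r h) ∧ ∀ h, m ≤ h → e h = 0) →
      (∀ h < m, K ≤ r h * Real.log (ξ h).den) → l1 NZ P ≤ Real.exp (ω * K) →
      ∑ h ∈ Finset.range m, (r h : ℝ) ≤ ω * K →
      ∃ e ∈ (Tr ξ (map (Int.castRingHom ℚ) P)).support, Finsupp.weight (wt m r) e ≤ ε := by
  intro m
  induction m with
  | zero =>
    intro ε hε _
    refine ⟨1, one_pos, le_rfl, ?_⟩
    intro r K ξ P hP _ _ _ _ _ _
    have h0 : map (Int.castRingHom ℚ) P ≠ 0 := by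
      intro h; exact hP (map_injective _ (RingHom.injective_int _) (by rw [h, map_zero]))
    obtain ⟨e, he⟩ := MvPolynomial.ne_zero_iff.mp (Tr_inj ξ h0)
    refine ⟨e, mem_support_iff.mpr he, ?_⟩
    rw [Finsupp.weight_apply, Finsupp.sum, Finset.sum_eq_zero]
    · exact hε.le
    · intro x _; simp [wt]
  | succ m ih =>
    intro ε hε hε1
    obtain ⟨ω1, hω1, hω11, IH⟩ := ih (ε^2/65) (by positivity) (by nlinarith)
    have h65 : 0 < ε^2/65 := by positivity
    refine ⟨min (ω1/3) (ε^2/65/3), by positivity, (min_le_left _ _).trans (by linarith), ?_⟩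
    intro r K ξ P hP hr hrr hsupp hK hl hs
    have b1 := min_le_left (ω1/3) (ε^2/65/3)
    have b2 := min_le_right (ω1/3) (ε^2/65/3)
    exact roth_step m ε ω1 (min (ω1/3) (ε^2/65/3)) hε hε1 (by positivity) (by linarith) (by linarith) hω11 IH r K ξ P hP hr hrr
      hsupp hK hl hs
end ST

namespace ST
open MvPolynomial

section siegel
attribute [local instance] Matrix.seminormedAddCommGroup in
lemma siegel' {α β : Type*} [Fintype α] [Fintype β] (A : Matrix α β ℤ) (B : ℝ)
    (hB : 1 ≤ B) (h2 : 2 * Fintype.card α ≤ Fintype.card β) (hβ : 0 < Fintype.card β)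
    (hA : ∀ i j, |(A i j : ℝ)| ≤ B) :
    ∃ t : β → ℤ, t ≠ 0 ∧ A.mulVec t = 0 ∧ ∀ i, |(t i : ℝ)| ≤ Fintype.card β * B := by
  classical
  have hβ' : (1:ℝ) ≤ Fintype.card β := by exact_mod_cast hβ
  rcases Nat.eq_zero_or_pos (Fintype.card α) with h0 | h0
  · refine ⟨fun _ => 1, ?_, ?_, ?_⟩
    · obtain ⟨b⟩ := Fintype.card_pos_iff.mp hβ
      intro h; have := congrFun h b; simp at this
    · ext i; exact (Fintype.card_eq_zero_iff.mp h0).elim i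
    · intro i; simp; nlinarith
  · obtain ⟨t, ht, hAt, hn⟩ := Int.Matrix.exists_ne_zero_int_vec_norm_le A (by omega) h0
    refine ⟨t, ht, hAt, fun i => ?_⟩
    have h1 : ‖t i‖ ≤ ‖t‖ := norm_le_pi_norm t i
    rw [Int.norm_eq_abs] at h1
    refine h1.trans (hn.trans ?_)
    have hAn : ‖A‖ ≤ B := by
      rw [Matrix.norm_le_iff (by linarith)]
      intro i j; rw [Int.norm_eq_abs]; exact hA i j
    have hb : (1:ℝ) ≤ Fintype.card β * max 1 ‖A‖ := by
      have : (1:ℝ) ≤ max 1 ‖A‖ := le_max_left _ _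
      nlinarith
    have hexp : ((Fintype.card α : ℝ) / (Fintype.card β - Fintype.card α)) ≤ 1 := by
      have : 2 * (Fintype.card α : ℝ) ≤ Fintype.card β := by exact_mod_cast h2
      have : (1:ℝ) ≤ Fintype.card α := by exact_mod_cast h0
      rw [div_le_one (by linarith)]; linarith
    refine (Real.rpow_le_rpow_of_exponent_le hb hexp).trans ?_
    rw [Real.rpow_one]
    gcongr
    exact max_le hB hAn
end siegel

/-- box of exponents -/
def Box {m n : ℕ} (r : Fin m → ℕ) : Finset (Fin m → Fin n → ℕ) :=
  Fintype.piFinset fun h => Finset.piAntidiag Finset.univ (r h)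

lemma mem_Box {m n : ℕ} {r : Fin m → ℕ} {J : Fin m → Fin n → ℕ} :
    J ∈ Box r ↔ ∀ h, ∑ i, J h i = r h := by
  simp [Box, Fintype.mem_piFinset, Finset.mem_piAntidiag]

lemma sum_antidiag_symm {n : ℕ} (r : ℕ) (i j : Fin n) :
    ∑ x ∈ Finset.piAntidiag Finset.univ r, (x i : ℝ) = ∑ x ∈ Finset.piAntidiag Finset.univ r, (x j : ℝ) := by
  refine Finset.sum_nbij' (fun x => x ∘ Equiv.swap i j) (fun x => x ∘ Equiv.swap i j) ?_ ?_ ?_ ?_ ?_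
  · intro x hx
    simp only [Finset.mem_piAntidiag, Finset.mem_univ, implies_true, and_true] at hx ⊢
    rw [← hx]; exact Equiv.sum_comp (Equiv.swap i j) x
  · intro x hx
    simp only [Finset.mem_piAntidiag, Finset.mem_univ, implies_true, and_true] at hx ⊢
    rw [← hx]; exact Equiv.sum_comp (Equiv.swap i j) x
  · intro x _; ext l; simp
  · intro x _; ext l; simp
  · intro x _; simp

lemma chernoff_one {n : ℕ} (r : ℕ) (hr : 1 ≤ r) (g : Fin n → ℝ) (hg : ∑ i, g i = 0) (l G : ℝ)
    (hl : 0 ≤ l) (hG : ∑ i, |g i| ≤ G) (hlG : l * G ≤ 1) :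
    ∑ x ∈ Finset.piAntidiag (Finset.univ : Finset (Fin n)) r, Real.exp (l * ((∑ i, g i * x i) / r)) ≤
      (Finset.piAntidiag (Finset.univ : Finset (Fin n)) r).card * Real.exp (l^2 * G^2) := by
  set S := Finset.piAntidiag (Finset.univ : Finset (Fin n)) r
  have hr' : (1:ℝ) ≤ r := by exact_mod_cast hr
  have hG0 : 0 ≤ G := le_trans (Finset.sum_nonneg fun _ _ => abs_nonneg _) hG
  have hx : ∀ x ∈ S, Real.exp (l * ((∑ i, g i * x i) / r)) ≤ 1 + l * ((∑ i, g i * x i) / r) + l^2 * G^2 := by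
    intro x hx
    have hsum : ∑ i, x i = r := by simpa [S, Finset.mem_piAntidiag] using hx
    have hle : ∀ i, (x i : ℝ) ≤ r := by
      intro i; rw [← hsum]; exact_mod_cast Finset.single_le_sum (f := x) (fun _ _ => Nat.zero_le _) (Finset.mem_univ i)
    have hb : |(∑ i, g i * x i) / (r:ℝ)| ≤ G := by
      rw [abs_div, abs_of_pos (by linarith : (0:ℝ) < r), div_le_iff₀ (by linarith)]
      calc |∑ i, g i * x i| ≤ ∑ i, |g i * x i| := Finset.abs_sum_le_sum_abs _ _
        _ ≤ ∑ i, |g i| * r := by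
          refine Finset.sum_le_sum fun i _ => ?_
          rw [abs_mul, abs_of_nonneg (Nat.cast_nonneg _ : (0:ℝ) ≤ x i)]
          exact mul_le_mul_of_nonneg_left (hle i) (abs_nonneg _)
        _ = (∑ i, |g i|) * r := by rw [Finset.sum_mul]
        _ ≤ G * r := by gcongr
    set y := (∑ i, g i * x i) / (r:ℝ)
    have h1 : |l * y| ≤ l * G := by rw [abs_mul, abs_of_nonneg hl]; gcongr
    have h2 := Real.abs_exp_sub_one_sub_id_le (h1.trans hlG)
    have h3 := (abs_le.mp h2).2
    have h4 : (l * y)^2 ≤ (l * G)^2 := by rw [← sq_abs (l*y)]; gcongr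
    nlinarith
  refine (Finset.sum_le_sum hx).trans ?_
  rw [Finset.sum_add_distrib, Finset.sum_add_distrib, ← Finset.mul_sum, ← Finset.sum_div]
  have hz : ∑ x ∈ S, ∑ i, g i * (x i : ℝ) = 0 := by
    rw [Finset.sum_comm]
    rcases Nat.eq_zero_or_pos n with h0 | h0
    · subst h0; simp
    · have : ∀ i, ∑ x ∈ S, g i * (x i : ℝ) = g i * ∑ x ∈ S, (x ⟨0, h0⟩ : ℝ) := by
        intro i; rw [← Finset.mul_sum, sum_antidiag_symm r i ⟨0, h0⟩]
      simp only [this]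
      rw [← Finset.sum_mul, hg, zero_mul]
  rw [hz]
  simp only [Finset.sum_const, nsmul_eq_mul, mul_one, zero_div, mul_zero, add_zero]
  have := Real.add_one_le_exp (l^2 * G^2)
  have h0 : (0:ℝ) ≤ S.card := Nat.cast_nonneg _
  nlinarith

lemma chernoff {m n : ℕ} (r : Fin m → ℕ) (hr : ∀ h, 1 ≤ r h) (g : Fin n → ℝ) (hg : ∑ i, g i = 0)
    (l G ε : ℝ) (hl : 0 ≤ l) (hG : ∑ i, |g i| ≤ G) (hlG : l * G ≤ 1) :
    (((Box r).filter fun J => ε * m < ∑ h, (∑ i, g i * J h i) / (r h : ℝ)).card : ℝ) *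
      Real.exp (l * (ε * m)) ≤ (Box (n := n) r).card * Real.exp (m * (l^2 * G^2)) := by
  classical
  calc _ ≤ ∑ J ∈ (Box r).filter (fun J => ε * m < ∑ h, (∑ i, g i * J h i) / (r h : ℝ)),
        Real.exp (l * ∑ h, (∑ i, g i * J h i) / (r h : ℝ)) := by
        rw [← nsmul_eq_mul]
        refine Finset.card_nsmul_le_sum _ _ _ fun J hJ => ?_
        rw [Finset.mem_filter] at hJ
        exact Real.exp_le_exp.mpr (mul_le_mul_of_nonneg_left hJ.2.le hl)
    _ ≤ ∑ J ∈ Box r, Real.exp (l * ∑ h, (∑ i, g i * J h i) / (r h : ℝ)) :=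
        Finset.sum_le_sum_of_subset_of_nonneg (Finset.filter_subset _ _) fun _ _ _ => (Real.exp_pos _).le
    _ = ∏ h, ∑ x ∈ Finset.piAntidiag (Finset.univ : Finset (Fin n)) (r h),
          Real.exp (l * ((∑ i, g i * x i) / r h)) := by
        rw [Finset.prod_univ_sum, Box]
        refine Finset.sum_congr rfl fun J _ => ?_
        rw [Finset.mul_sum, Real.exp_sum]
    _ ≤ ∏ h, ((Finset.piAntidiag (Finset.univ : Finset (Fin n)) (r h)).card * Real.exp (l^2 * G^2)) :=
        Finset.prod_le_prod (fun _ _ => Finset.sum_nonneg fun _ _ => (Real.exp_pos _).le)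
          fun h _ => chernoff_one (r h) (hr h) g hg l G hl hG hlG
    _ = _ := by
        rw [Finset.prod_mul_distrib, Box, Fintype.card_piFinset]
        simp [← Real.exp_nat_mul]

lemma card_Box_le {m n : ℕ} (r : Fin m → ℕ) :
    (Box (n := n) r).card ≤ (2 ^ n) ^ (∑ h, r h) := by
  rw [Box, Fintype.card_piFinset, ← Finset.prod_pow_eq_pow_sum]
  refine Finset.prod_le_prod' fun h _ => ?_
  have : Finset.piAntidiag (Finset.univ : Finset (Fin n)) (r h) ⊆
      Fintype.piFinset fun _ => Finset.range (r h + 1) := by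
    intro x hx
    have hsum : ∑ i, x i = r h := by simpa [Finset.mem_piAntidiag] using hx
    rw [Fintype.mem_piFinset]
    intro i
    have := Finset.single_le_sum (f := x) (fun _ _ => Nat.zero_le _) (Finset.mem_univ i)
    simp; omega
  refine (Finset.card_le_card this).trans ?_
  rw [Fintype.card_piFinset]
  simp
  rw [← pow_mul, mul_comm, pow_mul]
  exact Nat.pow_le_pow_left Nat.lt_two_pow_self _

lemma Box_nonempty {m n : ℕ} (hn : 0 < n) (r : Fin m → ℕ) : 0 < (Box (n := n) r).card := by
  classical
  rw [Finset.card_pos]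
  refine ⟨fun h => Pi.single ⟨0, hn⟩ (r h), ?_⟩
  rw [mem_Box]; intro h; simp

lemma exists_m (d : ℕ) (n : ℕ) (hn : 0 < n) (g : Fin n → ℝ) (hg : ∑ i, g i = 0) (ε : ℝ) (hε : 0 < ε) :
    ∃ m : ℕ, 0 < m ∧ ∀ r : Fin m → ℕ, (∀ h, 1 ≤ r h) →
      2 * (((Box r).filter fun J => ε * m < ∑ h, (∑ i, g i * J h i) / (r h : ℝ)).card * d ^ 2) ≤
        (Box (n := n) r).card := by
  set G := ∑ i, |g i|
  have hG0 : 0 ≤ G := Finset.sum_nonneg fun _ _ => abs_nonneg _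
  set l := min (1 / (G+1)) (ε / (2 * (G+1)^2)) with hl
  have hl0 : 0 < l := by positivity
  have h1 : l * G ≤ 1 := by
    have : l ≤ 1 / (G+1) := min_le_left _ _
    rw [le_div_iff₀ (by positivity)] at this; nlinarith
  have h2 : l * G^2 ≤ ε / 2 := by
    have : l ≤ ε / (2 * (G+1)^2) := min_le_right _ _
    rw [le_div_iff₀ (by positivity)] at this; nlinarith
  set δ := l * (ε / 2)
  have hδ : 0 < δ := by positivity
  obtain ⟨m, hm⟩ := exists_nat_gt ((2 * (d:ℝ)^2) / δ)
  rw [div_lt_iff₀ hδ] at hm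
  refine ⟨m, ?_, ?_⟩
  · rcases Nat.eq_zero_or_pos m with h | h
    · subst h; simp at hm; nlinarith [sq_nonneg (d:ℝ)]
    · exact h
  intro r hr
  have key := chernoff r hr g hg l G ε hl0.le le_rfl h1
  set bad := ((Box r).filter fun J => ε * m < ∑ h, (∑ i, g i * J h i) / (r h : ℝ)).card
  set bx := (Box (n := n) r).card
  have h3 : (bad : ℝ) * Real.exp (m * δ) ≤ bx := by
    have e1 : Real.exp (l * (ε * m)) = Real.exp (m * δ) * Real.exp (m * δ) := by
      rw [← Real.exp_add]; congr 1; simp only [δ]; ring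
    have e2 : Real.exp (m * (l^2 * G^2)) ≤ Real.exp (m * δ) := by
      apply Real.exp_le_exp.mpr
      have : l^2 * G^2 ≤ δ := by simp only [δ]; nlinarith
      gcongr
    rw [e1] at key
    have h4 : (bad:ℝ) * Real.exp (m * δ) * Real.exp (m * δ) ≤ bx * Real.exp (m * δ) := by
      calc _ = (bad:ℝ) * (Real.exp (m * δ) * Real.exp (m * δ)) := by ring
        _ ≤ _ := key
        _ ≤ _ := by gcongr
    exact le_of_mul_le_mul_right h4 (Real.exp_pos _)
  have h5 : 2 * (d:ℝ)^2 ≤ Real.exp (m * δ) := by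
    have := Real.add_one_le_exp (m * δ); linarith
  have h6 : 2 * ((bad:ℝ) * (d:ℝ)^2) ≤ bx := by
    have : (0:ℝ) ≤ bad := Nat.cast_nonneg _
    nlinarith
  exact_mod_cast h6
end ST

namespace ST
open MvPolynomial

/-- l1 norm for reals -/
noncomputable abbrev NR : RingSeminorm ℝ := normRingSeminorm ℝ

lemma NR_apply (x : ℝ) : NR x = |x| := rfl

lemma NR_one : NR 1 ≤ 1 := by rw [NR_apply]; simp

lemma Ord.pow {σ R : Type*} [CommRing R] {w : σ → ℝ} {θ : ℝ} {F : MvPolynomial σ R} (hF : Ord w θ F)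
    (k : ℕ) : Ord w (k * θ) (F ^ k) := by
  have := Ord.prod (Finset.univ : Finset (Fin k)) (F := fun _ => F) (θ := fun _ => θ) (fun _ _ => hF)
  simpa using this

lemma Ord.bind {σ τ R : Type*} [CommRing R] {w : τ → ℝ} {w' : σ → ℝ} {θ : ℝ}
    {f : σ → MvPolynomial τ R} (hf : ∀ p, Ord w (w' p) (f p)) {F : MvPolynomial σ R}
    (hF : Ord w' θ F) : Ord w θ (bind₁ f F) := by
  have h' : bind₁ f F = ∑ e ∈ F.support, MvPolynomial.C (F.coeff e) * ∏ i ∈ e.support, f i ^ e i := by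
    conv_lhs => rw [F.as_sum, map_sum]
    refine Finset.sum_congr rfl fun e _ => ?_
    rw [bind₁_monomial]
  rw [h']
  refine Ord.sum _ fun e he => ?_
  have h1 := (Ord.C (w := w) (F.coeff e)).mul
    (Ord.prod e.support (F := fun i => f i ^ e i) (θ := fun i => e i * w' i) fun i _ => (hf i).pow _)
  refine h1.mono ?_
  have := hF e he
  rw [Finsupp.weight_apply, Finsupp.sum] at this
  simpa using this

lemma Ord.X {σ R : Type*} [CommRing R] (w : σ → ℝ) (x : σ) :
    Ord w (w x) (MvPolynomial.X x : MvPolynomial σ R) := by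
  classical
  intro e he
  have := (support_monomial_subset (s := Finsupp.single x 1) (a := (1:R))) he
  simp at this; subst this; rw [Finsupp.weight_single]; simp

/-- linear substitution in each block -/
noncomputable def lf {m n : ℕ} {S : Type*} [CommRing S] (A : Matrix (Fin n) (Fin n) S)
    (p : Fin m × Fin n) : MvPolynomial (Fin m × Fin n) S := ∑ j, C (A p.2 j) * X (p.1, j)

/-- multihomogeneous -/
def MH {m n : ℕ} {S : Type*} [CommRing S] (r : Fin m → ℕ) (F : MvPolynomial (Fin m × Fin n) S) : Prop :=
  ∀ e ∈ F.support, ∀ h, ∑ i, e (h, i) = r h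

/-- row indicator weight -/
noncomputable def rowW {m n : ℕ} (t : ℝ) (h : Fin m) (p : Fin m × Fin n) : ℝ := if p.1 = h then t else 0

lemma weight_eq_sum {σ : Type*} [Fintype σ] (w : σ → ℝ) (e : σ →₀ ℕ) :
    Finsupp.weight w e = ∑ p, (e p : ℝ) * w p := by
  rw [Finsupp.weight_apply, Finsupp.sum_fintype _ _ (by simp)]; simp

lemma weight_rowW {m n : ℕ} (t : ℝ) (h : Fin m) (e : Fin m × Fin n →₀ ℕ) :
    Finsupp.weight (rowW t h) e = t * ∑ i, (e (h, i) : ℝ) := by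
  rw [weight_eq_sum, Fintype.sum_prod_type, Finset.sum_eq_single h]
  · simp [rowW, Finset.mul_sum, mul_comm]
  · intro b _ hb; simp [rowW, hb]
  · simp

lemma MH_iff {m n : ℕ} {S : Type*} [CommRing S] (r : Fin m → ℕ) (F : MvPolynomial (Fin m × Fin n) S) :
    MH r F ↔ ∀ h, Ord (rowW 1 h) (r h) F ∧ Ord (rowW (-1) h) (-(r h:ℝ)) F := by
  constructor
  · intro H h
    constructor
    · intro e he; rw [weight_rowW, ← H e he h]; push_cast; simp
    · intro e he; rw [weight_rowW, ← H e he h]; push_cast; simp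
  · intro H e he h
    have h1 := (H h).1 e he
    have h2 := (H h).2 e he
    rw [weight_rowW] at h1 h2
    have : (∑ i, (e (h, i):ℝ)) = r h := by linarith
    exact_mod_cast this

lemma MH.bind {m n : ℕ} {S : Type*} [CommRing S] {r : Fin m → ℕ} {F : MvPolynomial (Fin m × Fin n) S}
    (hF : MH r F) (f : Fin m × Fin n → MvPolynomial (Fin m × Fin n) S)
    (hf : ∀ p, ∀ e ∈ (f p).support, ∀ h, ∑ i, e (h, i) = if p.1 = h then 1 else 0) :
    MH r (bind₁ f F) := by
  rw [MH_iff] at hF ⊢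
  intro h
  constructor
  · refine Ord.bind ?_ (hF h).1
    intro p e he; rw [weight_rowW, rowW]
    have : (∑ i, (e (h, i):ℝ)) = if p.1 = h then 1 else 0 := by exact_mod_cast hf p e he h
    rw [this]; split_ifs <;> simp
  · refine Ord.bind ?_ (hF h).2
    intro p e he; rw [weight_rowW, rowW]
    have : (∑ i, (e (h, i):ℝ)) = if p.1 = h then 1 else 0 := by exact_mod_cast hf p e he h
    rw [this]; split_ifs <;> simp

lemma row_X {m n : ℕ} (h0 : Fin m) (j : Fin n) (h : Fin m) :
    ∑ i, (Finsupp.single (h0, j) 1 : Fin m × Fin n →₀ ℕ) (h, i) = if h0 = h then 1 else 0 := by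
  classical
  simp only [Finsupp.single_apply, Prod.mk.injEq]
  split_ifs with hh
  · simp [hh]
  · simp [hh]

lemma lin_row {m n : ℕ} {S : Type*} [CommRing S] (h0 : Fin m) (a : Fin n → S) :
    ∀ e ∈ (∑ j, C (a j) * X (h0, j) : MvPolynomial (Fin m × Fin n) S).support,
      ∀ h, ∑ i, e (h, i) = if h0 = h then 1 else 0 := by
  classical
  intro e he h
  have := support_sum he
  simp only [Finset.mem_biUnion, Finset.mem_univ, true_and] at this
  obtain ⟨j, hj⟩ := this
  have : C (a j) * X (h0, j) = (monomial (Finsupp.single (h0, j) 1) (a j) : MvPolynomial (Fin m × Fin n) S) := by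
    rw [C_mul_X_eq_monomial]
  rw [this] at hj
  have := support_monomial_subset hj
  simp at this
  rw [this]; exact row_X h0 j h

lemma MH.lf {m n : ℕ} {S : Type*} [CommRing S] {r : Fin m → ℕ} {F : MvPolynomial (Fin m × Fin n) S}
    (hF : MH r F) (A : Matrix (Fin n) (Fin n) S) : MH r (bind₁ (lf A) F) :=
  hF.bind _ fun p => lin_row p.1 (A p.2)

lemma prod_pow_le_of_MH {m n : ℕ} {r : Fin m → ℕ} (e : Fin m × Fin n →₀ ℕ)
    (he : ∀ h, ∑ i, e (h, i) = r h) (b : Fin m × Fin n → ℝ) (B : ℝ) (hb0 : ∀ p, 0 ≤ b p)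
    (hb : ∀ p, b p ≤ B) : ∏ p ∈ e.support, b p ^ e p ≤ B ^ (∑ h, r h) := by
  calc _ ≤ ∏ p ∈ e.support, B ^ e p :=
        Finset.prod_le_prod (fun p _ => pow_nonneg (hb0 p) _)
          fun p _ => pow_le_pow_left₀ (hb0 p) (hb p) _
    _ = B ^ (∑ p ∈ e.support, e p) := by rw [Finset.prod_pow_eq_pow_sum]
    _ = _ := by
      congr 1
      rw [Finset.sum_subset (Finset.subset_univ e.support) (by intro x _ hx; simpa using hx),
        Fintype.sum_prod_type]
      exact Finset.sum_congr rfl fun h _ => he h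

lemma l1_lf {m n : ℕ} {S : Type*} [CommRing S] (N : RingSeminorm S) (h1 : N 1 ≤ 1)
    (A : Matrix (Fin n) (Fin n) S) (p : Fin m × Fin n) :
    l1 N (lf A p) ≤ 1 + ∑ i, ∑ j, N (A i j) := by
  have : l1 N (lf A p) ≤ ∑ j, N (A p.2 j) := by
    refine (l1_sum N _ _).trans (Finset.sum_le_sum fun j _ => ?_)
    refine (l1_mul N _ _).trans ?_
    rw [l1_C, l1_X]
    have := apply_nonneg N (A p.2 j)
    nlinarith
  have h2 : ∑ j, N (A p.2 j) ≤ ∑ i, ∑ j, N (A i j) := Finset.single_le_sum (f := fun i => ∑ j, N (A i j))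
    (fun i _ => Finset.sum_nonneg fun j _ => apply_nonneg N _) (Finset.mem_univ p.2)
  linarith

/-- exponents from functions -/
noncomputable def toF {m n : ℕ} (J : Fin m → Fin n → ℕ) : Fin m × Fin n →₀ ℕ :=
  Finsupp.equivFunOnFinite.symm fun p => J p.1 p.2

lemma toF_apply {m n : ℕ} (J : Fin m → Fin n → ℕ) (h : Fin m) (i : Fin n) : toF J (h, i) = J h i := rfl

lemma toF_inj {m n : ℕ} : Function.Injective (toF (m := m) (n := n)) := by
  intro J J' h
  ext x y
  rw [← toF_apply J, h, toF_apply]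

lemma map_bind_lf {R : Type*} [CommRing R] {m n : ℕ} (ev : R →+* ℝ) (Linv : Matrix (Fin n) (Fin n) R)
    (P : MvPolynomial (Fin m × Fin n) ℤ) :
    map ev (bind₁ (lf Linv) (map (Int.castRingHom R) P)) =
      bind₁ (lf (Linv.map ev)) (map (Int.castRingHom ℝ) P) := by
  have hr : ev.comp (Int.castRingHom R) = Int.castRingHom ℝ := RingHom.ext_int _ _
  have hf : (fun p => map ev (lf (m := m) Linv p)) = lf (Linv.map ev) := by
    ext1 p
    simp [lf]
  rw [map_bind₁, MvPolynomial.map_map, hr, hf]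

theorem aux_poly {R : Type*} [CommRing R] (ev : R →+* ℝ) (N : RingSeminorm R) (hN1 : N 1 ≤ 1)
    (D : ℕ) (cd : R →+ (Fin D → ℤ)) (hcdN : ∀ x k, |(cd x k : ℝ)| ≤ N x)
    (hcd : ∀ x, cd x = 0 → ev x = 0) (n : ℕ) (hn : 0 < n) (Linv : Matrix (Fin n) (Fin n) R)
    (c : Fin n → ℝ) (ε : ℝ) (hε : 0 < ε) :
    ∃ B : ℝ, 1 ≤ B ∧ ∃ m : ℕ, 0 < m ∧ ∀ r : Fin m → ℕ, (∀ h, 1 ≤ r h) →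
      ∃ P : MvPolynomial (Fin m × Fin n) ℤ, P ≠ 0 ∧ MH r P ∧ l1 NZ P ≤ B ^ (∑ h, r h) ∧
        MH r (bind₁ (lf (Linv.map ev)) (map (Int.castRingHom ℝ) P)) ∧
        l1 NR (bind₁ (lf (Linv.map ev)) (map (Int.castRingHom ℝ) P)) ≤ B ^ (∑ h, r h) ∧
        ∀ e ∈ (bind₁ (lf (Linv.map ev)) (map (Int.castRingHom ℝ) P)).support,
          ∑ h, (∑ i, c i * e (h, i)) / (r h : ℝ) ≤ m * ((∑ i, c i) / n + ε) := by
  classical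
  have hnR : (n:ℝ) ≠ 0 := by positivity
  set g : Fin n → ℝ := fun i => c i - (∑ i, c i) / n with hg
  have hg0 : ∑ i, g i = 0 := by
    simp only [hg, Finset.sum_sub_distrib, Finset.sum_const, Finset.card_univ, Fintype.card_fin,
      nsmul_eq_mul]
    field_simp; ring
  obtain ⟨m, hm, hbad⟩ := exists_m D n hn g hg0 ε hε
  set B1 : ℝ := 1 + ∑ i, ∑ j, N (Linv i j) with hB1
  set B2 : ℝ := 1 + ∑ i, ∑ j, NR (Linv.map ev i j) with hB2
  have hB11 : 1 ≤ B1 := by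
    rw [hB1]
    have : 0 ≤ ∑ i, ∑ j, N (Linv i j) :=
      Finset.sum_nonneg fun i _ => Finset.sum_nonneg fun j _ => apply_nonneg N _
    linarith
  have hB21 : 1 ≤ B2 := by
    rw [hB2]
    have : 0 ≤ ∑ i, ∑ j, NR (Linv.map ev i j) :=
      Finset.sum_nonneg fun i _ => Finset.sum_nonneg fun j _ => apply_nonneg NR _
    linarith
  set B0 : ℝ := 2 ^ n * (2 ^ n * B1) with hB0
  have hB01 : 1 ≤ B0 := by
    have : (1:ℝ) ≤ 2 ^ n := one_le_pow₀ (by norm_num)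
    exact one_le_mul_of_one_le_of_one_le this (one_le_mul_of_one_le_of_one_le this hB11)
  refine ⟨B2 * B0, by nlinarith, m, hm, ?_⟩
  intro r hr
  set s := ∑ h, r h with hs
  have hbad := hbad r hr
  set bad := (Box r).filter (fun J : Fin m → Fin n → ℕ => ε * m < ∑ h, (∑ i, g i * J h i) / (r h : ℝ)) with hbadd
  let M : (Fin m → Fin n → ℕ) → MvPolynomial (Fin m × Fin n) R := fun J => bind₁ (lf Linv) (monomial (toF J) 1)
  have hM : ∀ J ∈ Box r, l1 N (M J) ≤ B1 ^ s := by
    intro J hJ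
    rw [mem_Box] at hJ
    refine (l1_bind N hN1 _ _ (B1 ^ s) ?_).trans ?_
    · intro e he
      have : e = toF J := by simpa using support_monomial_subset he
      subst this
      exact prod_pow_le_of_MH _ hJ _ _ (fun p => l1_nonneg N _) fun p => l1_lf N hN1 Linv p
    · rw [l1_monomial]
      have : (1:ℝ) ≤ B1 ^ s := one_le_pow₀ hB11
      nlinarith
  let A : Matrix ({x // x ∈ bad} × Fin D) {x // x ∈ Box (n := n) r} ℤ := fun p J => cd (coeff (toF p.1.1) (M J.1)) p.2
  have hA : ∀ i j, |(A i j : ℝ)| ≤ B1 ^ s := fun i j =>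
    (hcdN _ _).trans ((coeff_le_l1 N _ _).trans (hM j.1 j.2))
  have hcardα : 2 * Fintype.card ({x // x ∈ bad} × Fin D) ≤ Fintype.card {x // x ∈ Box (n := n) r} := by
    rw [Fintype.card_prod, Fintype.card_coe, Fintype.card_coe, Fintype.card_fin]
    refine le_trans ?_ hbad
    have : D ≤ D ^ 2 := Nat.le_self_pow (by norm_num) D
    gcongr
  obtain ⟨t, ht0, hAt, htb⟩ := siegel' A (B1 ^ s) (one_le_pow₀ hB11) hcardα
    (by rw [Fintype.card_coe]; exact Box_nonempty hn r) hA
  rw [Fintype.card_coe] at htb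
  set P : MvPolynomial (Fin m × Fin n) ℤ := ∑ J : {x // x ∈ Box (n := n) r}, monomial (toF J.1) (t J) with hP
  have hPc : ∀ J : {x // x ∈ Box (n := n) r}, coeff (toF J.1) P = t J := by
    intro J
    rw [hP, coeff_sum, Finset.sum_eq_single J]
    · simp
    · intro b _ hb
      rw [coeff_monomial, if_neg]
      intro h; exact hb (Subtype.ext (toF_inj h))
    · simp
  have hP0 : P ≠ 0 := by
    obtain ⟨J, hJ⟩ := Function.ne_iff.mp ht0
    intro h; apply hJ; rw [← hPc J, h]; simp
  have hPMH : MH r P := by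
    intro e he h
    have := support_sum he
    simp only [Finset.mem_biUnion, Finset.mem_univ, true_and] at this
    obtain ⟨J, hJ⟩ := this
    have : e = toF J.1 := by simpa using support_monomial_subset hJ
    subst this
    exact mem_Box.mp J.2 h
  have hbox : ((Box (n := n) r).card : ℝ) ≤ (2 ^ n) ^ s := by exact_mod_cast card_Box_le r
  have hl1P : l1 NZ P ≤ B0 ^ s := by
    refine (l1_sum NZ _ _).trans ?_
    simp only [l1_monomial]
    have : ∀ J ∈ (Finset.univ : Finset {x // x ∈ Box (n := n) r}), NZ (t J) ≤ (Box (n := n) r).card * B1 ^ s := by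
      intro J _; rw [NZ_apply]; exact htb J
    refine (Finset.sum_le_card_nsmul _ _ _ this).trans ?_
    rw [Finset.card_univ, Fintype.card_coe, nsmul_eq_mul, hB0, mul_pow, mul_pow]
    gcongr
  have hmapMH : MH r (map (Int.castRingHom ℝ) P) := fun e he => hPMH e (support_map_subset _ _ he)
  refine ⟨P, hP0, hPMH, ?_, hmapMH.lf _, ?_, ?_⟩
  · refine hl1P.trans ?_
    gcongr
    nlinarith
  · refine (l1_bind NR NR_one _ _ (B2 ^ s) ?_).trans ?_
    · intro e he
      exact prod_pow_le_of_MH _ (hmapMH e he) _ _ (fun p => l1_nonneg NR _) fun p => l1_lf NR NR_one _ p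
    · rw [mul_pow]
      have : l1 NR (map (Int.castRingHom ℝ) P) ≤ l1 NZ P := by
        rw [l1_eq_sum NR (support_map_subset _ _)]
        refine Finset.sum_le_sum fun e _ => ?_
        rw [coeff_map, NR_apply, NZ_apply]; simp
      gcongr
      exact this.trans hl1P
  · intro e he
    have heM := hmapMH.lf (Linv.map ev) e he
    by_contra hc
    push Not at hc
    -- e is bad
    set J : Fin m → Fin n → ℕ := fun h i => e (h, i) with hJ
    have heJ : e = toF J := by ext ⟨h, i⟩; rfl
    have hJbox : J ∈ Box r := mem_Box.mpr heM
    have hJbad : J ∈ bad := by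
      rw [hbadd, Finset.mem_filter]
      refine ⟨hJbox, ?_⟩
      have : ∑ h, (∑ i, g i * (J h i:ℝ)) / (r h : ℝ) = ∑ h, (∑ i, c i * (e (h, i):ℝ)) / (r h : ℝ) - m * ((∑ i, c i) / n) := by
        have h1 : ∀ h : Fin m, (∑ i, g i * (J h i:ℝ)) / (r h : ℝ) = (∑ i, c i * (e (h, i):ℝ)) / (r h : ℝ) - (∑ i, c i) / n := by
          intro h
          have hrh : (r h : ℝ) ≠ 0 := by have := hr h; positivity
          have h2 : ∑ i, g i * (J h i:ℝ) = ∑ i, c i * (e (h, i):ℝ) - (∑ i, c i) / n * r h := by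
            rw [← heM h]; push_cast
            rw [Finset.mul_sum, ← Finset.sum_sub_distrib]
            exact Finset.sum_congr rfl fun i _ => by simp only [hg, hJ]; ring
          rw [h2, sub_div, mul_div_assoc, div_self hrh, mul_one]
        simp only [h1, Finset.sum_sub_distrib, Finset.sum_const, Finset.card_univ, Fintype.card_fin, nsmul_eq_mul]
      rw [this]
      nlinarith
    -- coefficient vanishes
    have hzero : coeff e (bind₁ (lf Linv) (map (Int.castRingHom R) P)) = ∑ J' : {x // x ∈ Box (n := n) r}, (t J' : R) * coeff e (M J'.1) := by
      rw [hP, map_sum, map_sum, coeff_sum]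
      refine Finset.sum_congr rfl fun J' _ => ?_
      have : map (Int.castRingHom R) (monomial (toF J'.1) (t J')) = C (t J' : R) * monomial (toF J'.1) 1 := by
        rw [map_monomial, C_mul_monomial]; simp
      rw [this, map_mul, bind₁_C_right, coeff_C_mul]
    have hcd0 : cd (coeff e (bind₁ (lf Linv) (map (Int.castRingHom R) P))) = 0 := by
      rw [hzero, map_sum]
      ext k
      have := congrFun hAt (⟨J, hJbad⟩, k)
      simp only [Matrix.mulVec, dotProduct, Pi.zero_apply, A] at this
      rw [Finset.sum_apply, Pi.zero_apply, ← this]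
      refine Finset.sum_congr rfl fun J' _ => ?_
      rw [← zsmul_eq_mul, map_zsmul, Pi.smul_apply, smul_eq_mul, heJ, mul_comm]
    have hev := hcd _ hcd0
    rw [mem_support_iff] at he
    apply he
    rw [← hev]
    rw [← map_bind_lf, coeff_map]
end ST

namespace ST
open MvPolynomial

/-- block dependent linear substitution -/
noncomputable def lfh {m n : ℕ} {S : Type*} [CommRing S] (A : Fin m → Matrix (Fin n) (Fin n) S)
    (p : Fin m × Fin n) : MvPolynomial (Fin m × Fin n) S := ∑ j, C (A p.1 p.2 j) * X (p.1, j)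

lemma lf_eq_lfh {m n : ℕ} {S : Type*} [CommRing S] (A : Matrix (Fin n) (Fin n) S) :
    lf (m := m) A = lfh (fun _ => A) := rfl

lemma lfh_comp {m n : ℕ} {S : Type*} [CommRing S] (A B : Fin m → Matrix (Fin n) (Fin n) S)
    (p : Fin m × Fin n) : bind₁ (lfh A) (lfh B p) = lfh (fun h => B h * A h) p := by
  simp only [lfh, map_sum, map_mul, bind₁_C_right, bind₁_X_right, Matrix.mul_apply, Finset.mul_sum,
    Finset.sum_mul]
  rw [Finset.sum_comm]
  exact Finset.sum_congr rfl fun j _ => Finset.sum_congr rfl fun i _ => by ring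

lemma lfh_bind {m n : ℕ} {S : Type*} [CommRing S] (A B : Fin m → Matrix (Fin n) (Fin n) S)
    (F : MvPolynomial (Fin m × Fin n) S) :
    bind₁ (lfh A) (bind₁ (lfh B) F) = bind₁ (lfh fun h => B h * A h) F := by
  rw [bind₁_bind₁]
  congr 2
  funext p; exact lfh_comp A B p

lemma lfh_one {m n : ℕ} {S : Type*} [CommRing S] (F : MvPolynomial (Fin m × Fin n) S) :
    bind₁ (lfh fun _ => (1 : Matrix (Fin n) (Fin n) S)) F = F := by
  have : (lfh fun _ => (1 : Matrix (Fin n) (Fin n) S)) = (X : Fin m × Fin n → MvPolynomial (Fin m × Fin n) S) := by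
    funext p
    simp only [lfh, Matrix.one_apply]
    rw [Finset.sum_eq_single p.2] <;> simp
    intro b hb h; exact absurd h.symm hb
  rw [this, bind₁_X_left]; rfl

lemma map_lfh {m n : ℕ} {S S' : Type*} [CommRing S] [CommRing S'] (f : S →+* S')
    (A : Fin m → Matrix (Fin n) (Fin n) S) (F : MvPolynomial (Fin m × Fin n) S) :
    map f (bind₁ (lfh A) F) = bind₁ (lfh fun h => (A h).map f) (map f F) := by
  rw [map_bind₁]
  congr 2
  funext p
  simp [lfh]

lemma bind_eq_sum {σ τ R : Type*} [CommRing R] (f : σ → MvPolynomial τ R) (F : MvPolynomial σ R) :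
    bind₁ f F = ∑ e ∈ F.support, MvPolynomial.C (F.coeff e) * ∏ i ∈ e.support, f i ^ e i := by
  conv_lhs => rw [F.as_sum, map_sum]
  refine Finset.sum_congr rfl fun e _ => ?_
  rw [bind₁_monomial]

lemma coeff_scale {σ R : Type*} [Fintype σ] [CommRing R] (s : σ → R) (F : MvPolynomial σ R) (e : σ →₀ ℕ) :
    coeff e (bind₁ (fun p => C (s p) * X p) F) = coeff e F * ∏ p, s p ^ e p := by
  classical
  have : ∀ e : σ →₀ ℕ, ∀ a : R, bind₁ (fun p => C (s p) * X p) (monomial e a) =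
      monomial e (a * ∏ p, s p ^ e p) := by
    intro e a
    rw [bind₁_monomial, Finset.prod_subset (Finset.subset_univ e.support)
      (by intro x _ hx; simp at hx; simp [hx])]
    simp only [mul_pow, Finset.prod_mul_distrib]
    rw [monomial_eq, map_mul, map_prod, Finsupp.prod_fintype _ _ (by simp)]
    simp only [map_pow]; ring
  conv_lhs => rw [F.as_sum, map_sum]
  simp only [this, coeff_sum, coeff_monomial]
  by_cases he : e ∈ F.support
  · rw [Finset.sum_eq_single_of_mem e he]
    · simp
    · intro b _ hb; simp [hb]
  · rw [Finset.sum_eq_zero]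
    · rw [notMem_support_iff.mp he]; simp
    · intro b hb; rw [if_neg]; rintro rfl; exact he hb

lemma vanish_bound {m n : ℕ} (P : MvPolynomial (Fin m × Fin n) ℤ)
    (L Li : Matrix (Fin n) (Fin n) ℝ) (hL : Li * L = 1) (T : Fin m → Matrix (Fin n) (Fin n) ℤ)
    (B1 V : ℝ) (hB1 : l1 NR (bind₁ (lf Li) (map (Int.castRingHom ℝ) P)) ≤ B1) (hV : 0 ≤ V)
    (S U : Fin m × Fin n → ℝ)
    (hS : ∀ p, 0 ≤ S p)
    (hU : ∀ p, ∑ j, |(L * (T p.1).map (Int.castRingHom ℝ)) p.2 j| * S (p.1, j) ≤ U p)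
    (hUV : ∀ e ∈ (bind₁ (lf Li) (map (Int.castRingHom ℝ) P)).support, ∏ p ∈ e.support, U p ^ e p ≤ V)
    (e : Fin m × Fin n →₀ ℕ) :
    |((coeff e (bind₁ (lfh T) P) : ℤ) : ℝ)| * ∏ p, S p ^ e p ≤ V * B1 := by
  set PL := bind₁ (lf Li) (map (Int.castRingHom ℝ) P) with hPL
  have h1 : map (Int.castRingHom ℝ) P = bind₁ (lf L) PL := by
    rw [hPL, lf_eq_lfh, lf_eq_lfh, lfh_bind, hL, lfh_one]
  have h2 : map (Int.castRingHom ℝ) (bind₁ (lfh T) P) =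
      bind₁ (lfh fun h => L * (T h).map (Int.castRingHom ℝ)) PL := by
    rw [map_lfh, h1, lf_eq_lfh, lfh_bind]
  have h3 : bind₁ (fun p => C (S p) * X p) (map (Int.castRingHom ℝ) (bind₁ (lfh T) P)) =
      bind₁ (fun p => ∑ j, C ((L * (T p.1).map (Int.castRingHom ℝ)) p.2 j * S (p.1, j)) * X (p.1, j)) PL := by
    rw [h2, bind₁_bind₁]
    congr 2
    funext p
    simp only [lfh, map_sum, map_mul, bind₁_C_right, bind₁_X_right]
    exact Finset.sum_congr rfl fun j _ => by ring
  have h4 := coeff_scale S (map (Int.castRingHom ℝ) (bind₁ (lfh T) P)) e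
  rw [coeff_map] at h4
  have h5 : l1 NR (bind₁ (fun p => C (S p) * X p) (map (Int.castRingHom ℝ) (bind₁ (lfh T) P))) ≤ V * l1 NR PL := by
    rw [h3]
    refine l1_bind NR NR_one _ _ V fun e he => le_trans ?_ (hUV e he)
    refine Finset.prod_le_prod (fun p _ => pow_nonneg (l1_nonneg NR _) _) fun p _ => ?_
    refine pow_le_pow_left₀ (l1_nonneg NR _) ((le_trans (l1_sum NR _ _) ?_).trans (hU p)) _
    refine Finset.sum_le_sum fun j _ => ?_
    refine (l1_mul NR _ _).trans ?_
    rw [l1_C, l1_X, NR_apply, abs_mul, abs_of_nonneg (hS _), NR_apply, abs_one, mul_one]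
  have h6 := coeff_le_l1 NR (bind₁ (fun p => C (S p) * X p) (map (Int.castRingHom ℝ) (bind₁ (lfh T) P))) e
  rw [h4, NR_apply, abs_mul, Finset.abs_prod] at h6
  simp only [abs_pow, abs_of_nonneg (hS _)] at h6
  refine le_trans ?_ (h6.trans (h5.trans (by gcongr)))
  simp

end ST

namespace ST
open MvPolynomial

/-- weight on the `i0` column -/
noncomputable def w0 {m n : ℕ} (i0 : Fin n) (r : Fin m → ℕ) (p : Fin m × Fin n) : ℝ :=
  if p.2 = i0 then 1 / (r p.1 : ℝ) else 0

lemma w0_nonneg {m n : ℕ} (i0 : Fin n) (r : Fin m → ℕ) (p) : 0 ≤ w0 (n := n) i0 r p := by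
  rw [w0]; split_ifs <;> positivity

lemma Ord.map {σ R S : Type*} [CommRing R] [CommRing S] (f : R →+* S) {w : σ → ℝ} {θ : ℝ}
    {F : MvPolynomial σ R} (hF : Ord w θ F) : Ord w θ (MvPolynomial.map f F) :=
  fun e he => hF e (support_map_subset _ _ he)

lemma ord_transfer {m n : ℕ} (i0 : Fin n) (r : Fin m → ℕ) (P : MvPolynomial (Fin m × Fin n) ℚ)
    (T Φ : Fin m → Matrix (Fin n) (Fin n) ℚ) (x : Fin m → Fin n → ℚ) (hx : ∀ h, x h i0 ≠ 0)
    (hT : ∀ h, Matrix.vecMul (x h) (T h) = Pi.single i0 (x h i0)) (hΦ : ∀ h, Matrix.vecMul (x h) (Φ h) = Pi.single i0 (x h i0))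
    (hdet : ∀ h, IsUnit (T h).det) (τ : ℝ) (hF : Ord (w0 i0 r) τ (bind₁ (lfh T) P)) :
    Ord (w0 i0 r) τ (bind₁ (lfh Φ) P) := by
  set Γ : Fin m → Matrix (Fin n) (Fin n) ℚ := fun h => (T h)⁻¹ * Φ h with hΓ
  have h1 : ∀ h, T h * Γ h = Φ h := fun h => by
    rw [hΓ, ← Matrix.mul_assoc, Matrix.mul_nonsing_inv _ (hdet h), Matrix.one_mul]
  have h2 : bind₁ (lfh Φ) P = bind₁ (lfh Γ) (bind₁ (lfh T) P) := by
    rw [lfh_bind]; simp only [h1]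
  rw [h2]
  refine Ord.bind (w' := w0 i0 r) ?_ hF
  rintro ⟨h, i⟩
  by_cases hi : i = i0
  · subst hi
    have hrow : ∀ j, Γ h i j = Pi.single (M := fun _ => ℚ) i 1 j := by
      have e1 : Matrix.vecMul (x h) (T h * Γ h) = Pi.single i (x h i) := by rw [h1, hΦ]
      rw [← Matrix.vecMul_vecMul, hT] at e1
      intro j
      have := congrFun e1 j
      rw [Matrix.single_vecMul] at this
      simp only [Pi.smul_apply, smul_eq_mul, Matrix.row] at this
      by_cases hj : j = i
      · subst hj
        rw [Pi.single_eq_same] at this ⊢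
        exact mul_left_cancel₀ (hx h) (by rw [this, mul_one])
      · simp [hj] at this; rcases this with h | h
        · exact absurd h (hx _)
        · simpa [hj] using h
    have : lfh Γ (h, i) = X (h, i) := by
      simp only [lfh, hrow]
      rw [Finset.sum_eq_single i]
      · simp
      · intro b _ hb; simp [hb]
      · simp
    rw [this]
    exact Ord.X _ _
  · refine Ord.of_nonpos (w0_nonneg i0 r) ?_ _
    rw [w0]; simp [hi]

/-- comparing two substitutions -/
lemma bind_congr_ord {σ τ R : Type*} [CommRing R] {w : τ → ℝ} {w' : σ → ℝ} {θ : ℝ}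
    {f g : σ → MvPolynomial τ R} (hf : ∀ p, Ord w (w' p) (f p)) (hg : ∀ p, Ord w (w' p) (g p))
    (hfg : ∀ p, Ord w (w' p + 1) (f p - g p)) {F : MvPolynomial σ R} (hF : Ord w' θ F) :
    Ord w (θ + 1) (bind₁ f F - bind₁ g F) := by
  classical
  have hpow : ∀ p (k : ℕ), Ord w (k * w' p + 1) (f p ^ k - g p ^ k) := by
    intro p k
    induction k with
    | zero => simpa using Ord.zero _
    | succ k ih =>
      have : f p ^ (k+1) - g p ^ (k+1) = (f p ^ k - g p ^ k) * f p + g p ^ k * (f p - g p) := by ring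
      rw [this]
      refine ((ih.mul (hf p)).mono ?_).add ((((hg p).pow k).mul (hfg p)).mono ?_) <;> push_cast <;> linarith
  have hprod : ∀ (s : Finset σ) (e : σ → ℕ), Ord w ((∑ i ∈ s, e i * w' i) + 1)
      (∏ i ∈ s, f i ^ e i - ∏ i ∈ s, g i ^ e i) := by
    intro s e
    induction s using Finset.induction_on with
    | empty => simpa using Ord.zero _
    | insert a s ha ih =>
      rw [Finset.prod_insert ha, Finset.prod_insert ha, Finset.sum_insert ha]
      have : f a ^ e a * ∏ i ∈ s, f i ^ e i - g a ^ e a * ∏ i ∈ s, g i ^ e i =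
        (f a ^ e a - g a ^ e a) * ∏ i ∈ s, f i ^ e i + g a ^ e a * (∏ i ∈ s, f i ^ e i - ∏ i ∈ s, g i ^ e i) := by ring
      rw [this]
      refine (((hpow a (e a)).mul (Ord.prod s (F := fun i => f i ^ e i) (θ := fun i => e i * w' i)
        fun i _ => (hf i).pow _)).mono ?_).add ((((hg a).pow (e a)).mul ih).mono ?_) <;> linarith
  rw [bind_eq_sum, bind_eq_sum, ← Finset.sum_sub_distrib]
  refine Ord.sum _ fun e he => ?_
  rw [← mul_sub]
  refine ((Ord.C _).mul (hprod e.support e)).mono ?_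
  have := hF e he
  rw [Finsupp.weight_apply, Finsupp.sum] at this
  simp only [nsmul_eq_mul] at this
  linarith

lemma extr_add {σ R : Type*} [CommRing R] {s : Set σ} {μ : σ →₀ ℕ} (hμ : ∀ h, h ∈ s → μ h = 0)
    (F G : MvPolynomial σ R) : extr s μ (F + G) = extr s μ F + extr s μ G := by
  ext e
  by_cases he : ∀ h, h ∉ s → e h = 0
  · rw [coeff_add, coeff_extr hμ he, coeff_extr hμ he, coeff_extr hμ he, coeff_add]
  · have hz : ∀ F : MvPolynomial σ R, coeff e (extr s μ F) = 0 := fun F =>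
      notMem_support_iff.mp fun h => he (extr_on s μ _ e h)
    rw [coeff_add, hz, hz, hz, add_zero]

/-- a substitution preserving `s`-variables and fixing the others commutes with extraction -/
lemma extr_bind {σ R : Type*} [CommRing R] {s : Set σ} {μ : σ →₀ ℕ} (hμ : ∀ h, h ∈ s → μ h = 0)
    (f : σ → MvPolynomial σ R) (hf : ∀ p ∈ s, On s (f p)) (hf' : ∀ p ∉ s, f p = X p)
    (F : MvPolynomial σ R) : extr s μ (bind₁ f F) = bind₁ f (extr s μ F) := by
  classical
  induction F using MvPolynomial.induction_on' with
  | add p q hp hq => rw [map_add, extr_add hμ, extr_add hμ, map_add, hp, hq]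
  | monomial u a =>
    have hd : (monomial u a : MvPolynomial σ R) = monomial (u.filter (fun x => x ∈ s)) a *
        monomial (u.filter (fun x => x ∉ s)) 1 := by
      rw [monomial_mul, mul_one, Finsupp.filter_add_filter_not]
    have hmon : ∀ (s : Set σ) (u : σ →₀ ℕ) (a : R), (∀ x, x ∉ s → u x = 0) → On s (monomial u a) := by
      intro s u a hu e he
      have := support_monomial_subset he
      simp at this; subst this; exact hu
    have hA : On s (monomial (u.filter (fun x => x ∈ s)) a) := hmon _ _ _ fun x hx => by simp [hx]
    have hB : On sᶜ (monomial (u.filter (fun x => x ∉ s)) (1:R)) := hmon _ _ _ fun x hx => by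
      simp at hx; simp [hx]
    have hfB : bind₁ f (monomial (u.filter (fun x => x ∉ s)) (1:R)) = monomial (u.filter (fun x => x ∉ s)) 1 := by
      rw [bind₁_monomial, monomial_eq, Finsupp.prod]
      congr 1
      refine Finset.prod_congr rfl fun i hi => ?_
      rw [hf' i]
      simp only [Finsupp.mem_support_iff] at hi
      intro h; apply hi; rw [Finsupp.filter_apply_neg]; simpa using h
    have hfA : On s (bind₁ f (monomial (u.filter (fun x => x ∈ s)) a)) := by
      refine On.bind fun e he x hx => hf x ?_
      by_contra hc; exact hx (hA e he x hc)
    rw [hd, map_mul, hfB, extr_mul hμ hfA hB, extr_mul hμ hA hB, map_mul, bind₁_C_right]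

end ST

namespace ST
open MvPolynomial

/-- the projection along `x` -/
noncomputable def PhiM {n : ℕ} (i0 : Fin n) (x : Fin n → ℚ) : Matrix (Fin n) (Fin n) ℚ :=
  fun l l' => if l = l' then 1 else if l = i0 then -(x l' / x i0) else 0

/-- two variable projection -/
noncomputable def PhiM2 {n : ℕ} (i0 j0 : Fin n) (t : ℚ) : Matrix (Fin n) (Fin n) ℚ :=
  fun l l' => if l = l' then 1 else if l = i0 ∧ l' = j0 then t else 0

/-- dehomogenisation -/
noncomputable def dh {m n : ℕ} {S : Type*} [CommRing S] (i0 : Fin n) (p : Fin m × Fin n) : MvPolynomial ℕ S :=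
  if p.2 = i0 then X (p.1 : ℕ) else 1

/-- exponent after dehomogenisation -/
noncomputable def zx {m n : ℕ} (i0 : Fin n) (e : Fin m × Fin n →₀ ℕ) : ℕ →₀ ℕ :=
  ∑ h : Fin m, Finsupp.single (h : ℕ) (e (h, i0))

lemma zx_lt {m n : ℕ} (i0 : Fin n) (e : Fin m × Fin n →₀ ℕ) (h : Fin m) : zx i0 e h = e (h, i0) := by
  classical
  rw [zx, Finsupp.finset_sum_apply, Finset.sum_eq_single h]
  · simp
  · intro b _ hb; rw [Finsupp.single_eq_of_ne]; intro h; exact hb (Fin.ext h.symm)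
  · simp

lemma zx_ge {m n : ℕ} (i0 : Fin n) (e : Fin m × Fin n →₀ ℕ) (h : ℕ) (hh : m ≤ h) : zx i0 e h = 0 := by
  classical
  rw [zx, Finsupp.finset_sum_apply, Finset.sum_eq_zero]
  intro b _
  rw [Finsupp.single_eq_of_ne]; have := b.2; omega

lemma dh_prod {m n : ℕ} {S : Type*} [CommRing S] (i0 : Fin n) (e : Fin m × Fin n →₀ ℕ) :
    ∏ p ∈ e.support, (dh i0 p : MvPolynomial ℕ S) ^ e p = monomial (zx i0 e) 1 := by
  classical
  rw [Finset.prod_subset (Finset.subset_univ e.support) (by intro x _ hx; simp at hx; simp [hx]),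
    Fintype.prod_prod_type]
  have : ∀ h : Fin m, ∏ i, (dh i0 (h, i) : MvPolynomial ℕ S) ^ e (h, i) = monomial (Finsupp.single (h:ℕ) (e (h, i0))) 1 := by
    intro h
    rw [Finset.prod_eq_single i0]
    · simp [dh, X_pow_eq_monomial]
    · intro b _ hb; simp [dh, hb]
    · simp
  simp only [this]
  rw [zx, monomial_sum_one]

theorem extraction {m n : ℕ} (i0 j0 : Fin n) (hij : i0 ≠ j0) (r : ℕ → ℕ)
    (P : MvPolynomial (Fin m × Fin n) ℤ) (hP : P ≠ 0) (hMH : MH (fun h : Fin m => r h) P)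
    (x : Fin m → Fin n → ℚ) (ξ : ℕ → ℚ) (hξ : ∀ h : Fin m, ξ h = -(x h j0 / x h i0)) (τ : ℝ)
    (hO : Ord (w0 i0 fun h : Fin m => r h) τ
      (bind₁ (lfh fun h => PhiM i0 (x h)) (map (Int.castRingHom ℚ) P))) :
    ∃ G : MvPolynomial ℕ ℤ, G ≠ 0 ∧ l1 NZ G ≤ l1 NZ P ∧
      (∀ e ∈ G.support, (∀ h < m, e h ≤ r h) ∧ ∀ h, m ≤ h → e h = 0) ∧
      Ord (wt m r) τ (Tr ξ (map (Int.castRingHom ℚ) G)) := by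
  classical
  set s : Set (Fin m × Fin n) := {p | p.2 = i0 ∨ p.2 = j0} with hs
  set wr : Fin m × Fin n → ℝ := fun p => if p.2 = i0 ∨ p.2 = j0 then 0 else 1 with hwr
  have hwr0 : ∀ p, 0 ≤ wr p := fun p => by simp only [hwr]; split_ifs <;> norm_num
  obtain ⟨e0, he0, hmin⟩ := Finset.exists_min_image P.support (fun e => Finsupp.weight wr e)
    (by rwa [Finset.nonempty_iff_ne_empty, Ne, support_eq_empty])
  set μ := e0.filter (fun p => p ∉ s) with hμd
  have hμ : ∀ h, h ∈ s → μ h = 0 := fun h hh => by rw [hμd, Finsupp.filter_apply_neg]; simpa using hh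
  set es := e0.filter (fun p => p ∈ s) with hes
  have hes' : ∀ h, h ∉ s → es h = 0 := fun h hh => by rw [hes, Finsupp.filter_apply_neg _ _ hh]
  have hsplit : es + μ = e0 := Finsupp.filter_add_filter_not _ _
  -- weights of things on s
  have hws : ∀ e : Fin m × Fin n →₀ ℕ, (∀ h, h ∉ s → e h = 0) → Finsupp.weight wr e = 0 := by
    intro e he
    rw [weight_eq_sum]
    refine Finset.sum_eq_zero fun p _ => ?_
    by_cases hp : p ∈ s
    · have : p.2 = i0 ∨ p.2 = j0 := hp
      simp [hwr, this]
    · simp [he p hp]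
  have hwμ : Finsupp.weight (w0 i0 fun h : Fin m => r h) μ = 0 := by
    rw [weight_eq_sum]
    refine Finset.sum_eq_zero fun p _ => ?_
    by_cases hp : p ∈ s
    · simp [hμ p hp]
    · have : ¬ (p.2 = i0 ∨ p.2 = j0) := hp
      push Not at this
      simp [w0, this.1]
  set E := extr s μ P with hE
  have hEes : coeff es E ≠ 0 := by
    rw [hE, coeff_extr hμ hes', hsplit]; exact mem_support_iff.mp he0
  set Pq := map (Int.castRingHom ℚ) P with hPq
  have hPqO : Ord wr (Finsupp.weight wr e0) Pq := fun e he => hmin e (support_map_subset _ _ he)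
  set f2 : Fin m × Fin n → MvPolynomial (Fin m × Fin n) ℚ := lfh fun h => PhiM2 i0 j0 (ξ h) with hf2
  have hlX : ∀ (A : Fin m → Matrix (Fin n) (Fin n) ℚ) (h : Fin m) (i : Fin n),
      (∀ j, A h i j = if i = j then 1 else 0) → lfh A (h, i) = X (h, i) := by
    intro A h i hA
    simp only [lfh, hA]
    rw [Finset.sum_eq_single i]
    · simp
    · intro b _ hb; simp [hb.symm]
    · simp
  have hΦX : ∀ h i, i ≠ i0 → lfh (fun h => PhiM i0 (x h)) (h, i) = X (h, i) := by
    intro h i hi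
    refine hlX _ _ _ fun j => ?_
    simp [PhiM, hi]
  have hf2X : ∀ h i, i ≠ i0 → f2 (h, i) = X (h, i) := by
    intro h i hi
    refine hlX _ _ _ fun j => ?_
    simp [PhiM2, hi]
  have hOf : ∀ f : Fin m × Fin n → MvPolynomial (Fin m × Fin n) ℚ, (∀ h i, i ≠ i0 → f (h, i) = X (h, i)) →
      ∀ p, Ord wr (wr p) (f p) := by
    rintro f hf ⟨h, i⟩
    by_cases hi : i = i0
    · refine Ord.of_nonpos hwr0 ?_ _
      simp [hwr, hi]
    · rw [hf h i hi]; exact Ord.X _ _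
  have hdiff : ∀ p, Ord wr (wr p + 1) (lfh (fun h => PhiM i0 (x h)) p - f2 p) := by
    rintro ⟨h, i⟩
    by_cases hi : i = i0
    · have hw : wr (h, i) = 0 := by simp [hwr, hi]
      rw [hw, hf2, lfh, lfh, ← Finset.sum_sub_distrib]
      refine Ord.sum _ fun j _ => ?_
      rw [← sub_mul, ← map_sub]
      by_cases hj : j = i0 ∨ j = j0
      · have : PhiM i0 (x h) i j - PhiM2 i0 j0 (ξ h) i j = 0 := by
          rw [hi]
          rcases hj with rfl | rfl
          · simp [PhiM, PhiM2]
          · simp [PhiM, PhiM2, hij, hξ]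
        simp only [this]
        simpa using Ord.zero _
      · refine ((Ord.C _).mul (Ord.X _ _)).mono ?_
        simp [hwr, hj]
    · rw [hΦX h i hi, hf2X h i hi, sub_self]; exact Ord.zero _
  have hD := bind_congr_ord (hOf _ hΦX) (hOf _ hf2X) hdiff hPqO
  -- the extracted polynomial has large order
  have hEO : Ord (w0 i0 fun h : Fin m => r h) τ (bind₁ f2 (extr s μ Pq)) := by
    have hcomm : extr s μ (bind₁ f2 Pq) = bind₁ f2 (extr s μ Pq) := by
      refine extr_bind hμ f2 ?_ ?_ Pq
      · rintro ⟨h, i⟩ hp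
        rw [hf2, lfh]
        refine On.sum _ fun j _ => ?_
        by_cases hj : (h, j) ∈ s
        · exact (On.C _ _).mul (On.X hj)
        · have hj' : ¬ (j = i0 ∨ j = j0) := hj
          have hp' : i = i0 ∨ i = j0 := hp
          have hij' : i ≠ j := by rintro rfl; exact hj' hp'
          push Not at hj'
          have : PhiM2 i0 j0 (ξ h) i j = 0 := by simp [PhiM2, hij', hj'.2]
          simp only [this]
          simpa using On.zero _
      · rintro ⟨h, i⟩ hp
        apply hf2X
        rintro rfl; exact hp (Or.inl rfl)
    rw [← hcomm]
    intro e he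
    have he1 := extr_on s μ _ e he
    have he2 := extr_supp hμ he
    have hwe : Finsupp.weight wr (e + μ) = Finsupp.weight wr e0 := by
      rw [← hsplit, map_add, map_add, hws e he1, hws es hes']
    have hz : coeff (e + μ) (bind₁ (lfh (fun h => PhiM i0 (x h))) Pq - bind₁ f2 Pq) = 0 := by
      by_contra hc
      have := hD _ (mem_support_iff.mpr hc)
      linarith
    rw [coeff_sub, sub_eq_zero] at hz
    have := hO (e + μ) (by rw [mem_support_iff, hz]; exact mem_support_iff.mp he2)
    rwa [map_add, hwμ, add_zero] at this
  have hEon : On s E := extr_on s μ P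
  have hErow : ∀ e ∈ E.support, ∀ h : Fin m, e (h, i0) + e (h, j0) + ∑ i, μ (h, i) = r h := by
    intro e he h
    have h1 := hMH _ (extr_supp hμ he) h
    simp only [Finsupp.add_apply, Finset.sum_add_distrib] at h1
    have h2 : ∑ i, e (h, i) = e (h, i0) + e (h, j0) := by
      rw [← Finset.sum_pair (f := fun i => e (h, i)) hij]
      symm
      refine Finset.sum_subset (Finset.subset_univ _) fun i _ hi => hEon e he _ ?_
      simpa [hs] using hi
    omega
  have hinj : ∀ e ∈ E.support, zx i0 e = zx i0 es → e = es := by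
    intro e he hz
    ext ⟨h, i⟩
    have h1 : e (h, i0) = es (h, i0) := by rw [← zx_lt, hz, zx_lt]
    have h2 := hErow e he h
    have h3 := hErow es (mem_support_iff.mpr hEes) h
    by_cases hi : i = i0
    · rw [hi, h1]
    · by_cases hj : i = j0
      · rw [hj]; omega
      · have : (h, i) ∉ s := by simp [hs, hi, hj]
        rw [hEon e he _ this, hes' _ this]
  have hGsum : bind₁ (dh i0) E = ∑ e ∈ E.support, monomial (zx i0 e) (coeff e E) := by
    rw [bind_eq_sum]
    refine Finset.sum_congr rfl fun e _ => ?_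
    rw [dh_prod, C_mul_monomial, mul_one]
  refine ⟨bind₁ (dh i0) E, ?_, ?_, ?_, ?_⟩
  · intro h0
    apply hEes
    have : coeff (zx i0 es) (bind₁ (dh i0) E) = coeff es E := by
      rw [hGsum, coeff_sum, Finset.sum_eq_single_of_mem es (mem_support_iff.mpr hEes)]
      · simp
      · intro b hb hne
        rw [coeff_monomial, if_neg]
        intro h; exact hne (hinj b hb h)
    rw [← this, h0, coeff_zero]
  · refine ((l1_bind NZ NZ_one _ _ 1 ?_).trans (by rw [one_mul])).trans (l1_extr NZ s μ P)
    intro e _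
    refine Finset.prod_le_one (fun p _ => pow_nonneg (l1_nonneg NZ _) _) fun p _ => ?_
    refine pow_le_one₀ (l1_nonneg NZ _) ?_
    rw [dh]
    split_ifs
    · rw [l1_X]; exact NZ_one
    · rw [l1_one]; exact NZ_one
  · intro e he
    rw [hGsum] at he
    have := support_sum he
    simp only [Finset.mem_biUnion] at this
    obtain ⟨e', he', hh⟩ := this
    have : e = zx i0 e' := by simpa using support_monomial_subset hh
    subst this
    refine ⟨fun h hm => ?_, fun h hm => zx_ge i0 e' h hm⟩
    have h1 := zx_lt i0 e' ⟨h, hm⟩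
    have h2 := hErow e' he' ⟨h, hm⟩
    simp only at h1 h2
    omega
  · have hT : Tr ξ (map (Int.castRingHom ℚ) (bind₁ (dh i0) E)) = bind₁ (dh i0) (bind₁ f2 (extr s μ Pq)) := by
      have h1 : map (Int.castRingHom ℚ) (bind₁ (dh (m := m) i0) E) = bind₁ (dh i0) (extr s μ Pq) := by
        rw [map_bind₁, hE, extr_map _ hμ]
        congr 2
        funext p
        rw [dh, dh]; split_ifs <;> simp
      rw [h1]
      have h2 : ((Tr ξ).comp (bind₁ (dh (m := m) i0))) = (bind₁ (dh (m := m) i0)).comp (bind₁ f2) := by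
        refine MvPolynomial.algHom_ext fun p => ?_
        obtain ⟨h, i⟩ := p
        rw [AlgHom.comp_apply, AlgHom.comp_apply, bind₁_X_right, bind₁_X_right]
        by_cases hi : i = i0
        · have : f2 (h, i) = X (h, i0) + C (ξ h) * X (h, j0) := by
            rw [hf2, lfh, hi, ← Finset.add_sum_erase _ _ (Finset.mem_univ i0), Finset.sum_eq_single j0]
            · simp [PhiM2, hij]
            · intro b hb hbj
              have : i0 ≠ b := (Finset.ne_of_mem_erase hb).symm
              simp [PhiM2, this, hbj]
            · intro hc; simp [hij.symm] at hc
          rw [this]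
          simp [dh, hi, hij.symm, Tr]
        · rw [hf2X h i hi]
          simp [dh, hi]
      exact DFunLike.congr_fun h2 _
    rw [hT]
    refine Ord.bind ?_ hEO
    rintro ⟨h, i⟩
    by_cases hi : i = i0
    · have : w0 i0 (fun h : Fin m => r h) (h, i) = wt m r h := by simp [w0, wt, hi]
      rw [this, dh, if_pos hi]
      exact Ord.X _ _
    · refine Ord.of_nonpos (wt_nonneg m r) ?_ _
      simp [w0, hi]

end ST

namespace ST
open MvPolynomial

lemma PhiM_vecMul {n : ℕ} (i0 : Fin n) (x : Fin n → ℚ) (hx : x i0 ≠ 0) :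
    Matrix.vecMul x (PhiM i0 x) = Pi.single i0 (x i0) := by
  funext l'
  rw [Matrix.vecMul, dotProduct]
  by_cases hl : l' = i0
  · subst hl
    rw [Finset.sum_eq_single l']
    · simp [PhiM]
    · intro b _ hb; simp [PhiM, hb]
    · simp
  · rw [Pi.single_eq_of_ne hl, ← Finset.add_sum_erase _ _ (Finset.mem_univ i0), Finset.sum_eq_single l']
    · simp [PhiM, Ne.symm hl]; field_simp; ring
    · intro b hb hbl
      have : b ≠ i0 := Finset.ne_of_mem_erase hb
      simp [PhiM, hbl, this]
    · intro hc; simp [hl] at hc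

/-- the matrix with columns `e_{i0}` and the vectors `b` -/
def Tm {k : ℕ} {S : Type*} [CommRing S] (i0 : Fin (k+1)) (b : Fin k → Fin (k+1) → S) : Matrix (Fin (k+1)) (Fin (k+1)) S :=
  fun l => i0.insertNth (α := fun _ => S) (if l = i0 then 1 else 0) (fun t => b t l)

lemma Tm_same {k : ℕ} {S : Type*} [CommRing S] (i0 : Fin (k+1)) (b : Fin k → Fin (k+1) → S) (l) :
    Tm i0 b l i0 = if l = i0 then 1 else 0 := by simp [Tm]

lemma Tm_succ {k : ℕ} {S : Type*} [CommRing S] (i0 : Fin (k+1)) (b : Fin k → Fin (k+1) → S) (l) (t : Fin k) :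
    Tm i0 b l (i0.succAbove t) = b t l := by simp [Tm]

lemma Tm_vecMul {k : ℕ} (i0 : Fin (k+1)) (b : Fin k → Fin (k+1) → ℚ) (x : Fin (k+1) → ℚ)
    (hb : ∀ t, ∑ l, x l * b t l = 0) : Matrix.vecMul x (Tm i0 b) = Pi.single i0 (x i0) := by
  funext j
  rw [Matrix.vecMul, dotProduct]
  rcases Fin.eq_self_or_eq_succAbove i0 j with rfl | ⟨t, rfl⟩
  · simp [Tm_same]
  · simp only [Tm_succ]; rw [hb t]; simp

lemma Tm_det {k : ℕ} (i0 : Fin (k+1)) (b : Fin k → Fin (k+1) → ℚ) (x : Fin (k+1) → ℚ) (hx : x i0 ≠ 0)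
    (hb : ∀ t, ∑ l, x l * b t l = 0) (hli : ∀ v : Fin k → ℚ, (∀ l, ∑ t, v t * b t l = 0) → v = 0) :
    IsUnit (Tm i0 b).det := by
  rw [isUnit_iff_ne_zero]
  intro hd
  obtain ⟨v, hv0, hv⟩ := Matrix.exists_mulVec_eq_zero_iff.mpr hd
  have h1 : dotProduct (Matrix.vecMul x (Tm i0 b)) v = 0 := by
    rw [← Matrix.dotProduct_mulVec, hv]; simp
  rw [Tm_vecMul i0 b x hb] at h1
  have h2 : v i0 = 0 := by
    rw [single_dotProduct] at h1
    exact (mul_eq_zero.mp h1).resolve_left hx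
  have h3 : (fun t => v (i0.succAbove t)) = 0 := by
    apply hli
    intro l
    have := congrFun hv l
    rw [Matrix.mulVec, dotProduct, Fin.sum_univ_succAbove _ i0, h2, mul_zero, zero_add] at this
    simp only [Tm_succ, Pi.zero_apply] at this
    rw [← this]; exact Finset.sum_congr rfl fun t _ => mul_comm _ _
  apply hv0
  funext j
  rcases Fin.eq_self_or_eq_succAbove i0 j with rfl | ⟨t, rfl⟩
  · exact h2
  · exact congrFun h3 t

lemma mach_core {m k : ℕ} (i0 : Fin (k+1)) (r : Fin m → ℕ) (hr : ∀ h, 1 ≤ r h)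
    (P : MvPolynomial (Fin m × Fin (k+1)) ℤ)
    (L Li : Matrix (Fin (k+1)) (Fin (k+1)) ℝ) (hL : Li * L = 1) (c : Fin (k+1) → ℝ)
    (B R E CL g1 g2 δ : ℝ) (hB : 1 ≤ B) (hR : 0 < R) (hE : 0 ≤ E) (hEc : ∀ i, -E ≤ c i) (hCL : 1 ≤ CL)
    (hLC : ∀ i j, |L i j| ≤ CL) (hδ : E * δ ≤ g1 - g2)
    (hl1 : l1 NR (bind₁ (lf Li) (map (Int.castRingHom ℝ) P)) ≤ B ^ (∑ h, r h))
    (hPL : MH r (bind₁ (lf Li) (map (Int.castRingHom ℝ) P)))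
    (hPe : ∀ e ∈ (bind₁ (lf Li) (map (Int.castRingHom ℝ) P)).support,
      ∑ h, (∑ i, c i * e (h, i)) / (r h : ℝ) ≤ m * (-g1))
    (hsmall : (B * ((k+1:ℕ) * CL)) ^ (∑ h, r h) < Real.exp (R * m * g2))
    (x : Fin m → Fin (k+1) → ℤ) (hx : ∀ h, x h i0 ≠ 0) (b : Fin m → Fin k → Fin (k+1) → ℤ)
    (hli : ∀ h, ∀ v : Fin k → ℚ, (∀ l, ∑ t, v t * b h t l = 0) → v = 0)
    (hxb : ∀ h t, ∑ l, x h l * b h t l = 0)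
    (hbs : ∀ h t i, |∑ l, L i l * b h t l| ≤ Real.exp (c i * (R / r h))) :
    Ord (w0 i0 r) (m * δ) (bind₁ (lfh fun h => PhiM i0 (fun l => (x h l : ℚ))) (map (Int.castRingHom ℚ) P)) := by
  classical
  set T : Fin m → Matrix (Fin (k+1)) (Fin (k+1)) ℤ := fun h => Tm i0 (b h) with hT
  set s := ∑ h, r h with hs
  set S : Fin m × Fin (k+1) → ℝ := fun p => if p.2 = i0 then Real.exp (-E * (R / r p.1)) else 1 with hS
  set U : Fin m × Fin (k+1) → ℝ := fun p => ((k+1:ℕ) * CL) * Real.exp (c p.2 * (R / r p.1)) with hU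
  set V : ℝ := ((k+1:ℕ) * CL) ^ s * Real.exp (R * (m * (-g1))) with hV
  have hRr : ∀ h, 0 < R / r h := fun h => by
    have : (0:ℝ) < r h := by exact_mod_cast hr h
    positivity
  have hbound : ∀ e, |((coeff e (bind₁ (lfh T) P) : ℤ) : ℝ)| * ∏ p, S p ^ e p ≤ V * B ^ s := by
    refine vanish_bound P L Li hL T (B ^ s) V hl1 (by positivity) S U ?_ ?_ ?_
    · intro p; simp only [hS]; split_ifs <;> positivity
    · rintro ⟨h, i⟩
      have : ∀ j ∈ (Finset.univ : Finset (Fin (k+1))), |(L * (T h).map (Int.castRingHom ℝ)) i j| * S (h, j) ≤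
          CL * Real.exp (c i * (R / r h)) := by
        intro j _
        rcases Fin.eq_self_or_eq_succAbove i0 j with rfl | ⟨t, rfl⟩
        · have h1 : (L * (T h).map (Int.castRingHom ℝ)) i j = L i j := by
            rw [Matrix.mul_apply, Finset.sum_eq_single j]
            · simp [hT, Tm_same]
            · intro b _ hb; simp [hT, Tm_same, hb]
            · simp
          rw [h1]
          simp only [hS, if_true]
          gcongr
          · exact hLC i j
          · exact hEc i
        · have h1 : (L * (T h).map (Int.castRingHom ℝ)) i (i0.succAbove t) = ∑ l, L i l * b h t l := by
            rw [Matrix.mul_apply]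
            simp [hT, Tm_succ]
          rw [h1]
          simp only [hS, Fin.succAbove_ne, if_false, mul_one]
          refine (hbs h t i).trans ?_
          have := Real.exp_pos (c i * (R / r h))
          nlinarith
      refine (Finset.sum_le_card_nsmul _ _ _ this).trans ?_
      simp only [hU, Finset.card_univ, Fintype.card_fin, nsmul_eq_mul]
      rw [mul_assoc]
    · intro e he
      have h1 : ∏ p ∈ e.support, U p ^ e p = (∏ p ∈ e.support, ((k+1:ℕ) * CL) ^ e p) *
          ∏ p ∈ e.support, Real.exp (c p.2 * (R / r p.1)) ^ e p := by
        rw [← Finset.prod_mul_distrib]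
        exact Finset.prod_congr rfl fun p _ => by simp only [hU, mul_pow]
      rw [h1, hV]
      refine mul_le_mul ?_ ?_ (by positivity) (by positivity)
      · exact prod_pow_le_of_MH e (hPL e he) (fun _ => ((k+1:ℕ) * CL)) _ (fun _ => by positivity) fun _ => le_rfl
      · rw [Finset.prod_subset (Finset.subset_univ e.support) (by intro x _ hx; simp at hx; simp [hx])]
        simp only [← Real.exp_nat_mul]
        rw [← Real.exp_sum, Real.exp_le_exp, Fintype.sum_prod_type]
        have := mul_le_mul_of_nonneg_left (hPe e he) hR.le
        refine le_trans (le_of_eq ?_) this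
        rw [Finset.mul_sum]
        refine Finset.sum_congr rfl fun h _ => ?_
        rw [Finset.sum_div, Finset.mul_sum]
        exact Finset.sum_congr rfl fun i _ => by simp only; ring
  have hord : Ord (w0 i0 r) (m * δ) (bind₁ (lfh T) P) := by
    intro e he
    by_contra hc
    push Not at hc
    rw [mem_support_iff] at he
    have h1 : (1:ℝ) ≤ |((coeff e (bind₁ (lfh T) P) : ℤ) : ℝ)| := by exact_mod_cast Int.one_le_abs he
    have h2 : ∏ p, S p ^ e p = Real.exp (-E * R * Finsupp.weight (w0 i0 r) e) := by
      rw [weight_eq_sum, Finset.mul_sum, Real.exp_sum]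
      refine Finset.prod_congr rfl fun p _ => ?_
      simp only [hS, w0]
      split_ifs
      · rw [← Real.exp_nat_mul]; congr 1; ring
      · simp
    have h3 := hbound e
    rw [h2] at h3
    have h4 : Real.exp (-E * R * (m * δ)) ≤ Real.exp (-E * R * Finsupp.weight (w0 i0 r) e) := by
      rw [Real.exp_le_exp]
      have : 0 ≤ E * R := by positivity
      nlinarith
    have h5 : Real.exp (-E * R * (m * δ)) ≤ V * B ^ s := by
      refine h4.trans (le_trans ?_ h3)
      have := Real.exp_pos (-E * R * Finsupp.weight (w0 i0 r) e)
      nlinarith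
    have h6 : V * B ^ s < Real.exp (R * m * g2) * Real.exp (R * (m * (-g1))) := by
      have : V * B ^ s = (B * ((k+1:ℕ) * CL)) ^ s * Real.exp (R * (m * (-g1))) := by
        rw [hV, mul_pow B]; ring
      rw [this]
      have := Real.exp_pos (R * (m * (-g1)))
      gcongr
    rw [← Real.exp_add] at h6
    have h7 := Real.exp_lt_exp.mp (h5.trans_lt h6)
    have h8 := mul_le_mul_of_nonneg_left hδ (show 0 ≤ R * m by positivity)
    nlinarith
  have hord' := hord.map (Int.castRingHom ℚ)
  rw [map_lfh] at hord'
  have hTq : ∀ h, (T h).map (Int.castRingHom ℚ) = Tm i0 (fun t l => (b h t l : ℚ)) := by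
    intro h; ext l j
    rcases Fin.eq_self_or_eq_succAbove i0 j with rfl | ⟨t, rfl⟩
    · simp [hT, Tm_same]
    · simp [hT, Tm_succ]
  simp only [hTq] at hord'
  have hxb' : ∀ h t, ∑ l, (x h l : ℚ) * (b h t l : ℚ) = 0 := fun h t => by exact_mod_cast hxb h t
  have hx' : ∀ h, (x h i0 : ℚ) ≠ 0 := fun h => by exact_mod_cast hx h
  exact ord_transfer i0 r _ _ _ (fun h l => (x h l : ℚ)) hx' (fun h => Tm_vecMul i0 _ _ (hxb' h))
    (fun h => PhiM_vecMul i0 _ (hx' h)) (fun h => Tm_det i0 _ _ (hx' h) (hxb' h) (hli h)) _ hord'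

end ST

namespace ST
open MvPolynomial

/-- the configuration that the machine excludes -/
def Config {k : ℕ} (L : Matrix (Fin (k+1)) (Fin (k+1)) ℝ) (c : Fin (k+1) → ℝ) (A : ℝ) (i0 j0 : Fin (k+1)) (Q : ℝ) : Prop :=
  ∃ (x : Fin (k+1) → ℤ) (b : Fin k → Fin (k+1) → ℤ),
    (∀ v : Fin k → ℚ, (∀ l, ∑ t, v t * b t l = 0) → v = 0) ∧ (∀ t, ∑ l, x l * b t l = 0) ∧
    (∀ t i, |∑ l, L i l * b t l| ≤ Q ^ (c i)) ∧ Q ^ A ≤ (((x j0 : ℚ) / (x i0)).den : ℝ)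

lemma real_param {ℓ R η c : ℝ} (hℓ : 0 < ℓ) (hη : 0 < η) (hR : ℓ * (1 + 2 * |c| / η) ≤ R) :
    c * ℓ ≤ (c + η) * (R / ⌈R / ℓ⌉₊) ∧ 1 ≤ ⌈R / ℓ⌉₊ ∧ (⌈R / ℓ⌉₊ : ℝ) ≤ 2 * (R / ℓ) := by
  have h0 : 0 ≤ 2 * |c| / η := by positivity
  have hRℓ : ℓ ≤ R := by nlinarith
  have hR0 : 0 < R := by linarith
  have h1 : 1 ≤ R / ℓ := by rwa [le_div_iff₀ hℓ, one_mul]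
  have h2 : R / ℓ ≤ ⌈R / ℓ⌉₊ := Nat.le_ceil _
  have h3 : (⌈R / ℓ⌉₊ : ℝ) < R / ℓ + 1 := Nat.ceil_lt_add_one (by positivity)
  set r : ℝ := ((⌈R / ℓ⌉₊ : ℕ) : ℝ) with hr
  have hr0 : 0 < r := by linarith
  refine ⟨?_, ?_, by linarith⟩
  · have e1 : R ≤ r * ℓ := by rwa [div_le_iff₀ hℓ] at h2
    have e2 : r * ℓ ≤ R + ℓ := by
      have : r * ℓ ≤ (R / ℓ + 1) * ℓ := by gcongr
      rwa [add_mul, div_mul_cancel₀ _ hℓ.ne', one_mul] at this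
    rw [mul_div_assoc', le_div_iff₀ hr0]
    have e3 : 2 * |c| * ℓ ≤ η * R := by
      have : ℓ * (2 * |c| / η) ≤ R := by nlinarith
      have := mul_le_mul_of_nonneg_left this hη.le
      have e : η * (ℓ * (2 * |c| / η)) = 2 * |c| * ℓ := by field_simp
      linarith
    have e4 : c * (r * ℓ - R) ≤ |c| * (r * ℓ - R) := by
      have := le_abs_self c
      nlinarith
    have e5 : |c| * (r * ℓ - R) ≤ |c| * ℓ := by
      have := abs_nonneg c
      apply mul_le_mul_of_nonneg_left _ this; linarith
    have := mul_nonneg (abs_nonneg c) hℓ.le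
    nlinarith
  · have : (1:ℝ) ≤ r := by linarith
    rw [hr] at this
    exact_mod_cast this

set_option maxHeartbeats 1000000 in
theorem machine {R : Type*} [CommRing R] (ev : R →+* ℝ) (N : RingSeminorm R) (hN1 : N 1 ≤ 1)
    (D : ℕ) (cd : R →+ (Fin D → ℤ)) (hcdN : ∀ x k, |(cd x k : ℝ)| ≤ N x)
    (hcd : ∀ x, cd x = 0 → ev x = 0) {k : ℕ} (L : Matrix (Fin (k+1)) (Fin (k+1)) ℝ)
    (Linv : Matrix (Fin (k+1)) (Fin (k+1)) R) (hL : L * Linv.map ev = 1)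
    (c : Fin (k+1) → ℝ) (hc : ∑ i, c i < 0) (A : ℝ) (hA : 0 < A) (i0 j0 : Fin (k+1)) (hij : i0 ≠ j0) :
    ∀ᶠ Q : ℝ in atTop, ¬ Config L c A i0 j0 Q := by
  rw [← not_frequently]
  intro hfreq
  have hL' : Linv.map ev * L = 1 := mul_eq_one_comm.mp hL
  have hn0 : (0:ℝ) < (k+1:ℕ) := by positivity
  set σ : ℝ := -(∑ i, c i) / (k+1:ℕ) with hσ
  have hσ0 : 0 < σ := div_pos (by linarith) hn0
  set η : ℝ := σ / 2 with hη
  have hη0 : 0 < η := by positivity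
  set c' : Fin (k+1) → ℝ := fun i => c i + η with hc'
  have hsum : (∑ i, c' i) / (k+1:ℕ) = -σ / 2 := by
    simp only [hc', Finset.sum_add_distrib, Finset.sum_const, Finset.card_univ, Fintype.card_fin, nsmul_eq_mul]
    rw [hη, hσ]; field_simp; ring
  obtain ⟨B, hB, m, hm, haux⟩ := aux_poly ev N hN1 D cd hcdN hcd (k+1) (by omega) Linv c' (σ/8) (by positivity)
  set E : ℝ := 1 + ∑ i, |c' i| with hE
  have hE0 : 0 < E := by positivity
  have hEc : ∀ i, -E ≤ c' i := fun i => by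
    have := Finset.single_le_sum (f := fun i => |c' i|) (fun i _ => abs_nonneg _) (Finset.mem_univ i)
    have h2 := neg_abs_le (c' i)
    linarith
  set δ : ℝ := σ / (4 * E) with hδ
  have hδ0 : 0 < δ := by positivity
  have hm0 : (0:ℝ) < m := by exact_mod_cast hm
  obtain ⟨ω, hω0, hω1, hroth⟩ := roth m (min 1 (m * δ / 2)) (by positivity) (min_le_left _ _)
  set CL : ℝ := 1 + ∑ i, ∑ j, |L i j| with hCLd
  have hCL1 : 1 ≤ CL := by
    have : 0 ≤ ∑ i, ∑ j, |L i j| := by positivity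
    linarith
  have hLC : ∀ i j, |L i j| ≤ CL := fun i j => by
    have h1 := Finset.single_le_sum (f := fun j => |L i j|) (fun i _ => abs_nonneg _) (Finset.mem_univ j)
    have h2 := Finset.single_le_sum (f := fun i => ∑ j, |L i j|) (fun i _ => by positivity) (Finset.mem_univ i)
    linarith
  set BB : ℝ := B * ((k+1:ℕ) * CL) with hBB
  have hBB1 : 1 ≤ BB := by
    have : (1:ℝ) ≤ (k+1:ℕ) := by exact_mod_cast Nat.succ_le_succ (Nat.zero_le k)
    exact one_le_mul_of_one_le_of_one_le hB (one_le_mul_of_one_le_of_one_le this hCL1)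
  have hlBB : 0 ≤ Real.log BB := Real.log_nonneg hBB1
  have hlB : 0 ≤ Real.log B := Real.log_nonneg hB
  set T0 : ℝ := 1 + 16 * Real.log BB / σ + 2 * m * (1 + Real.log B) / (ω * A) with hT0
  have ht1 : 0 ≤ 16 * Real.log BB / σ := by positivity
  have ht2 : 0 ≤ 2 * m * (1 + Real.log B) / (ω * A) := by positivity
  have hT01 : 1 ≤ T0 := by linarith
  -- sequence
  have hex : ∀ t : ℝ, ∃ Q, 0 < Q ∧ t ≤ Real.log Q ∧ Config L c A i0 j0 Q := by
    intro t
    obtain ⟨Q, hQ, hcfg⟩ := frequently_atTop.mp hfreq (Real.exp t)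
    have hQ0 : 0 < Q := (Real.exp_pos t).trans_le hQ
    exact ⟨Q, hQ0, (Real.le_log_iff_exp_le hQ0).mpr hQ, hcfg⟩
  choose q hq0 hqt hqc using hex
  let Qs : ℕ → ℝ := fun h => Nat.rec (q T0) (fun _ Q => q (max T0 (2 / ω * Real.log Q))) h
  have hQ0 : ∀ h, 0 < Qs h := fun h => by cases h <;> exact hq0 _
  have hQT : ∀ h, T0 ≤ Real.log (Qs h) := fun h => by
    cases h with
    | zero => exact hqt _
    | succ h => exact (le_max_left _ _).trans (hqt _)
  have hQS : ∀ h, 2 / ω * Real.log (Qs h) ≤ Real.log (Qs (h+1)) := fun h => (le_max_right _ _).trans (hqt _)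
  have hQc : ∀ h, Config L c A i0 j0 (Qs h) := fun h => by cases h <;> exact hqc _
  set ℓ : ℕ → ℝ := fun h => Real.log (Qs h) with hℓ
  have hℓ1 : ∀ h, 1 ≤ ℓ h := fun h => hT01.trans (hQT h)
  have hℓ0 : ∀ h, 0 < ℓ h := fun h => by linarith [hℓ1 h]
  choose x b hli hxb hbs hden using hQc
  set Cm : ℝ := ∑ i, |c i| with hCm
  have hCmi : ∀ i, |c i| ≤ Cm := fun i => Finset.single_le_sum (f := fun i => |c i|) (fun i _ => abs_nonneg _) (Finset.mem_univ i)
  have hCm0 : 0 ≤ Cm := by positivity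
  set RR : ℝ := ∑ h ∈ Finset.range m, ℓ h * (1 + 2 * Cm / η) with hRR
  have hRRh : ∀ h < m, ∀ i, ℓ h * (1 + 2 * |c i| / η) ≤ RR := by
    intro h hh i
    have h1 : ℓ h * (1 + 2 * Cm / η) ≤ RR := Finset.single_le_sum (f := fun h => ℓ h * (1 + 2 * Cm / η))
      (fun h _ => by have := hℓ0 h; positivity) (Finset.mem_range.mpr hh)
    refine le_trans ?_ h1
    have := hℓ0 h
    have := hCmi i
    gcongr
  have hRR0 : 0 < RR := by
    have h1 := hRRh 0 hm 0
    have h2 := hℓ0 0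
    have : 0 < ℓ 0 * (1 + 2 * |c 0| / η) := by positivity
    linarith
  set r : ℕ → ℕ := fun h => ⌈RR / ℓ h⌉₊ with hr
  have hpar := fun h (hh : h < m) i => real_param (hℓ0 h) hη0 (hRRh h hh i)
  have hr1 : ∀ h < m, 1 ≤ r h := fun h hh => (hpar h hh 0).2.1
  have hr2 : ∀ h < m, (r h : ℝ) ≤ 2 * (RR / ℓ h) := fun h hh => (hpar h hh 0).2.2
  have hsumr : ∑ h ∈ Finset.range m, (r h : ℝ) ≤ 2 * m * RR / T0 := by
    have : ∀ h ∈ Finset.range m, (r h : ℝ) ≤ 2 * RR / T0 := by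
      intro h hh
      refine (hr2 h (Finset.mem_range.mp hh)).trans ?_
      rw [mul_div_assoc]
      have := hQT h
      gcongr
    refine (Finset.sum_le_card_nsmul _ _ _ this).trans (le_of_eq ?_)
    simp only [Finset.card_range, nsmul_eq_mul]; ring
  have hsumF : ((∑ h : Fin m, r h : ℕ) : ℝ) = ∑ h ∈ Finset.range m, (r h : ℝ) := by
    rw [Finset.sum_range]; push_cast; rfl
  obtain ⟨P, hP0, hPMH, hPl1, hPLMH, hPLl1, hPLe⟩ := haux (fun h : Fin m => r h) (fun h => hr1 h h.2)
  -- small powers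
  have hpow : ∀ y : ℝ, 1 ≤ y → y ^ (∑ h : Fin m, r h) ≤ Real.exp (2 * m * RR / T0 * Real.log y) := by
    intro y hy
    rw [← Real.exp_log (show 0 < y ^ (∑ h : Fin m, r h) by positivity), Real.log_pow, Real.exp_le_exp, hsumF]
    have := Real.log_nonneg hy
    gcongr
  have hden1 : ∀ h, 1 < (((x h j0 : ℚ) / (x h i0)).den : ℝ) := by
    intro h
    refine lt_of_lt_of_le ?_ (hden h)
    refine Real.one_lt_rpow ?_ hA
    have := hℓ0 h
    exact (Real.log_pos_iff (hQ0 h).le).mp this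
  have hx0 : ∀ h, x h i0 ≠ 0 := by
    intro h h0
    have := hden1 h
    rw [h0] at this
    simp at this
  have hord := mach_core i0 (fun h : Fin m => r h) (fun h => hr1 h h.2) P L (Linv.map ev) hL' c' B RR E CL
    (3 * σ / 8) (σ / 8) δ hB hRR0 hE0.le hEc hCL1 hLC (by rw [hδ]; field_simp; norm_num) hPLl1 hPLMH
    (by
      intro e he
      refine (hPLe e he).trans (le_of_eq ?_)
      rw [hsum]; ring)
    (by
      refine (hpow _ hBB1).trans_lt ?_
      rw [Real.exp_lt_exp]
      have : 16 * Real.log BB < σ * T0 := by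
        have e : σ * (16 * Real.log BB / σ) = 16 * Real.log BB := by field_simp
        rw [hT0, mul_add, mul_add, e]; have := mul_nonneg hσ0.le ht2; linarith
      rw [div_mul_eq_mul_div, div_lt_iff₀ (by linarith)]
      have h2 : 0 < RR * m := by positivity
      have := mul_lt_mul_of_pos_left this h2
      linarith)
    (fun h => x h) (fun h => hx0 h) (fun h => b h) (fun h => hli h) (fun h => hxb h)
    (by
      intro h t i
      refine (hbs h t i).trans ?_
      rw [Real.rpow_def_of_pos (hQ0 h), Real.exp_le_exp, mul_comm]
      exact (hpar h h.2 i).1)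
  set ξ : ℕ → ℚ := fun h => -((x h j0 : ℚ) / x h i0) with hξ
  obtain ⟨G, hG0, hGl1, hGe, hGO⟩ := extraction i0 j0 hij r P hP0 hPMH (fun h l => (x h l : ℚ)) ξ
    (fun h => rfl) (m * δ) hord
  have hωA : 0 < ω * A := by positivity
  have hTA : 2 * m * (1 + Real.log B) ≤ ω * A * T0 := by
    have e : ω * A * (2 * m * (1 + Real.log B) / (ω * A)) = 2 * m * (1 + Real.log B) := by field_simp
    rw [hT0, mul_add (ω * A), e]; have := mul_nonneg hωA.le (show 0 ≤ 1 + 16 * Real.log BB / σ by linarith); linarith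
  obtain ⟨e, he, hew⟩ := hroth r (A * RR) ξ G hG0 hr1
    (by
      intro h hh
      refine (hr2 (h+1) hh).trans ?_
      have h1 : RR / ℓ h ≤ r h := Nat.le_ceil _
      refine le_trans ?_ (mul_le_mul_of_nonneg_left h1 hω0.le)
      have h2 := hQS h
      rw [mul_div_assoc', mul_div_assoc', div_le_div_iff₀ (hℓ0 (h+1)) (hℓ0 h)]
      have h3 : 2 * ℓ h ≤ ω * ℓ (h+1) := by
        have := mul_le_mul_of_nonneg_left h2 hω0.le
        have e : ω * (2 / ω * Real.log (Qs h)) = 2 * ℓ h := by field_simp; rfl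
        rw [e] at this; exact this
      have := mul_le_mul_of_nonneg_left h3 hRR0.le
      linarith)
    hGe
    (by
      intro h hh
      have h1 : RR / ℓ h ≤ r h := Nat.le_ceil _
      have h2 : (ξ h).den = ((x h j0 : ℚ) / x h i0).den := by simp [hξ]
      rw [h2]
      have h3 : A * ℓ h ≤ Real.log (((x h j0 : ℚ) / x h i0).den : ℝ) := by
        rw [Real.le_log_iff_exp_le (by linarith [hden1 h])]
        refine le_trans (le_of_eq ?_) (hden h)
        rw [Real.rpow_def_of_pos (hQ0 h), mul_comm]
      have h4 : RR ≤ r h * ℓ h := by rwa [div_le_iff₀ (hℓ0 h)] at h1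
      have h5 : (0:ℝ) ≤ r h := by positivity
      have h6 := mul_le_mul_of_nonneg_left h3 h5
      have h7 := mul_le_mul_of_nonneg_left h4 hA.le
      linarith)
    (by
      refine hGl1.trans (hPl1.trans ((hpow _ hB).trans ?_))
      rw [Real.exp_le_exp, div_mul_eq_mul_div, div_le_iff₀ (by linarith)]
      have h2 : 2 * m * Real.log B ≤ ω * A * T0 := by
        have : 0 ≤ 2 * (m:ℝ) := by positivity
        linarith
      have := mul_le_mul_of_nonneg_left h2 hRR0.le
      linarith)
    (by
      refine hsumr.trans ?_
      rw [div_le_iff₀ (by linarith)]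
      have h2 : 2 * m ≤ ω * A * T0 := by
        have : 0 ≤ 2 * (m:ℝ) * Real.log B := by positivity
        linarith
      have := mul_le_mul_of_nonneg_left h2 hRR0.le
      linarith)
  have h1 := hGO e he
  have h2 := hew.trans (min_le_right _ _)
  have : 0 < m * δ := by positivity
  linarith

end ST

namespace ST

/-- matrices norm -/
noncomputable def NM (ι : Type) [Fintype ι] [DecidableEq ι] : RingSeminorm (Matrix ι ι ℤ) :=
  letI := Matrix.linftyOpNormedRing (n := ι) (α := ℤ)
  normRingSeminorm (Matrix ι ι ℤ)

lemma NM_entry (ι : Type) [Fintype ι] [DecidableEq ι] (A : Matrix ι ι ℤ) (i j : ι) : |(A i j : ℝ)| ≤ NM ι A := by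
  letI := Matrix.linftyOpNormedRing (n := ι) (α := ℤ)
  change _ ≤ ‖A‖
  rw [Matrix.linfty_opNorm_def]
  have h1 : ‖A i j‖₊ ≤ ∑ j, ‖A i j‖₊ := Finset.single_le_sum (f := fun j => ‖A i j‖₊) (fun _ _ => zero_le) (Finset.mem_univ j)
  have h2 := Finset.le_sup (f := fun i => ∑ j, ‖A i j‖₊) (Finset.mem_univ i)
  have h3 : ‖A i j‖₊ ≤ Finset.univ.sup (fun i => ∑ j, ‖A i j‖₊) := h1.trans h2
  have h4 : |(A i j : ℝ)| = ((‖A i j‖₊ : NNReal) : ℝ) := by simp [Int.norm_eq_abs]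
  rw [h4]
  exact_mod_cast h3

lemma NM_one (ι : Type) [Fintype ι] [DecidableEq ι] : NM ι 1 ≤ 1 := by
  letI := Matrix.linftyOpNormedRing (n := ι) (α := ℤ)
  change ‖(1 : Matrix ι ι ℤ)‖ ≤ 1
  rw [Matrix.linfty_opNorm_def]
  have : Finset.univ.sup (fun i => ∑ j, ‖(1 : Matrix ι ι ℤ) i j‖₊) ≤ 1 := by
    refine Finset.sup_le fun i _ => ?_
    rw [Finset.sum_eq_single i]
    · simp
    · intro b _ hb; simp [Matrix.one_apply, hb.symm]
    · simp
  exact_mod_cast this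

theorem alg_pack (α : ℝ) (halg : IsAlgebraic ℚ α) :
    ∃ (R : Type) (_ : CommRing R) (ev : R →+* ℝ) (N : RingSeminorm R), N 1 ≤ 1 ∧
      ∃ (D : ℕ) (cd : R →+ (Fin D → ℤ)), (∀ x k, |(cd x k : ℝ)| ≤ N x) ∧ (∀ x, cd x = 0 → ev x = 0) ∧
      (∃ Dn : ℕ, 0 < Dn ∧ ∃ θ : R, ev θ = Dn * α) ∧
      ∃ (C : ℝ) (d : ℕ), 0 < C ∧ ∀ x, ev x ≠ 0 → 1 ≤ |ev x| * C * (1 + N x) ^ d := by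
  classical
  have halg' : IsAlgebraic ℤ α := (IsFractionRing.isAlgebraic_iff ℤ ℚ ℝ).mpr halg
  obtain ⟨Dn0, hDn0, hIntg⟩ := halg'.exists_integral_multiple
  have hDn0' : 0 < Dn0.natAbs := Int.natAbs_pos.mpr hDn0
  have hIntg' : IsIntegral ℤ ((Dn0.natAbs : ℝ) * α) := by
    rcases Int.natAbs_eq Dn0 with h | h
    · have : (Dn0.natAbs : ℝ) * α = Dn0 • α := by
        rw [zsmul_eq_mul]; congr 1
        have h' : (Dn0.natAbs : ℤ) = Dn0 := h.symm
        have h2 := congrArg (fun z : ℤ => (z : ℝ)) h'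
        simpa only [Int.cast_natCast] using h2
      rw [this]; exact hIntg
    · have : (Dn0.natAbs : ℝ) * α = -(Dn0 • α) := by
        rw [zsmul_eq_mul, ← neg_mul]; congr 1
        have : (Dn0.natAbs : ℤ) = - Dn0 := by omega
        have h2 := congrArg (fun z : ℤ => (z : ℝ)) this
        simpa only [Int.cast_natCast, Int.cast_neg] using h2
      rw [this]; exact hIntg.neg
  set θ : ℝ := (Dn0.natAbs : ℝ) * α with hθ
  let R := Algebra.adjoin ℤ {θ}
  haveI : Module.Finite ℤ R := Module.Finite.iff_fg.mpr hIntg'.fg_adjoin_singleton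
  haveI : Module.Free ℤ R := inferInstance
  let ι := Module.Free.ChooseBasisIndex ℤ R
  let e := Fintype.equivFin ι
  let b : Module.Basis (Fin (Fintype.card ι)) ℤ R := (Module.Free.chooseBasis ℤ R).reindex e
  set d := Fintype.card ι with hd
  let φ : R →ₐ[ℤ] Matrix (Fin d) (Fin d) ℤ := Algebra.leftMulMatrix b
  have hφinj : Function.Injective φ := Algebra.leftMulMatrix_injective b
  let N : RingSeminorm R :=
    { toFun := fun x => NM (Fin d) (φ x)
      map_zero' := by simp
      add_le' := fun x y => by rw [map_add]; exact map_add_le_add _ _ _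
      neg' := fun x => by rw [map_neg]; exact map_neg_eq_map _ _
      mul_le' := fun x y => by rw [map_mul]; exact map_mul_le_mul _ _ _ }
  have hN : ∀ x, N x = NM (Fin d) (φ x) := fun _ => rfl
  let ev : R →+* ℝ := R.val.toRingHom
  have hev : ∀ x : R, ev x = (x : ℝ) := fun _ => rfl
  let cd : R →+ (Fin (d * d) → ℤ) :=
    { toFun := fun x k => φ x (finProdFinEquiv.symm k).1 (finProdFinEquiv.symm k).2
      map_zero' := by funext k; simp
      map_add' := fun x y => by funext k; simp }
  refine ⟨R, inferInstance, ev, N, ?_, d * d, cd, ?_, ?_, ⟨Dn0.natAbs, hDn0', ⟨θ, Algebra.self_mem_adjoin_singleton ℤ θ⟩, rfl⟩, ?_⟩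
  · rw [hN, map_one]; exact NM_one _
  · intro x k; rw [hN]; exact NM_entry (Fin d) (φ x) (finProdFinEquiv.symm k).1 (finProdFinEquiv.symm k).2
  · intro x hx
    have : φ x = 0 := by
      ext i j
      have this : φ x (finProdFinEquiv.symm (finProdFinEquiv (i,j))).1 (finProdFinEquiv.symm (finProdFinEquiv (i,j))).2 = 0 := congrFun hx _
      rwa [Equiv.symm_apply_apply] at this
    have : x = 0 := hφinj (by rw [this, map_zero])
    rw [this, map_zero]
  · set v : Fin d → ℝ := fun i => ev (b i) with hv
    have hvφ : ∀ x : R, Matrix.vecMul v ((φ x).map (Int.castRingHom ℝ)) = ev x • v := by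
      intro x
      funext j
      have h1 : x * b j = ∑ i, φ x i j • b i := by
        rw [← b.sum_repr (x * b j)]
        refine Finset.sum_congr rfl fun i _ => ?_
        rw [Algebra.leftMulMatrix_eq_repr_mul]
      have h2 := congrArg ev h1
      rw [map_mul, map_sum] at h2
      simp only [Matrix.vecMul, dotProduct, Matrix.map_apply, Pi.smul_apply, smul_eq_mul, hv]
      rw [h2]
      refine Finset.sum_congr rfl fun i _ => ?_
      rw [map_zsmul, zsmul_eq_mul, mul_comm]; rfl
    have hdn : ∃ i, v i ≠ 0 := by
      by_contra hc
      push Not at hc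
      have h1 := congrArg ev (b.sum_repr (1 : R))
      rw [map_sum] at h1
      have : ∑ x, ev ((b.repr 1) x • b x) = 0 := Finset.sum_eq_zero fun i _ => by
        rw [map_zsmul]; have := hc i; simp only [hv] at this; rw [this, smul_zero]
      rw [this, map_one] at h1
      norm_num at h1
    obtain ⟨i0, hi0⟩ := hdn
    set s : ℝ := ∑ j, |v j| with hs
    refine ⟨(1 + s) * (d.factorial) / |v i0|, d, by positivity, ?_⟩
    intro x hx
    have hx0 : x ≠ 0 := by rintro rfl; simp at hx
    set A := φ x with hA
    have hdet : A.det ≠ 0 := by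
      intro h0
      obtain ⟨w, hw0, hw⟩ := Matrix.exists_mulVec_eq_zero_iff.mpr h0
      -- w gives y with x * y = 0
      have : x * (∑ j, w j • b j) = 0 := by
        rw [Finset.mul_sum]
        have : ∀ j, x * (w j • b j) = ∑ i, (A i j * w j) • b i := by
          intro j
          rw [mul_smul_comm, ← b.sum_repr (x * b j), Finset.smul_sum]
          refine Finset.sum_congr rfl fun i _ => ?_
          rw [hA, Algebra.leftMulMatrix_eq_repr_mul, smul_smul, mul_comm]
        simp only [this]
        rw [Finset.sum_comm]
        refine Finset.sum_eq_zero fun i _ => ?_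
        rw [← Finset.sum_smul]
        have := congrFun hw i
        simp only [Matrix.mulVec, dotProduct, Pi.zero_apply] at this
        rw [this, zero_smul]
      rcases mul_eq_zero.mp this with h | h
      · exact hx0 h
      · apply hw0
        funext j
        exact Fintype.linearIndependent_iff.mp b.linearIndependent w h j
    have hNx : 0 ≤ N x := apply_nonneg N x
    have hadj : ∀ i j, |(A.adjugate i j : ℝ)| ≤ d.factorial * (1 + N x) ^ d := by
      intro i j
      rw [Matrix.adjugate_apply]
      have h1 : (((A.updateRow j (Pi.single i 1)).det : ℤ) : ℝ) = ((A.updateRow j (Pi.single i 1)).map (Int.castRingHom ℝ)).det := by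
        exact (Int.castRingHom ℝ).map_det _
      rw [h1]
      have h2 := Matrix.det_le (A := (A.updateRow j (Pi.single i 1)).map (Int.castRingHom ℝ)) (abv := AbsoluteValue.abs) (x := 1 + N x) (by
        intro k l
        simp only [Matrix.map_apply, Matrix.updateRow_apply, AbsoluteValue.abs_apply]
        split_ifs
        · rw [Pi.single_apply]; split_ifs <;> simp <;> linarith
        · have := NM_entry (Fin d) A k l
          rw [hN]
          simp only [Int.coe_castRingHom]
          linarith)
      simpa using h2
    have hmain : A.det * v i0 = ev x * ∑ j, v j * A.adjugate j i0 := by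
      have h1 : Matrix.vecMul v (A.map (Int.castRingHom ℝ) * (A.adjugate).map (Int.castRingHom ℝ)) i0 = A.det * v i0 := by
        rw [← Matrix.map_mul, Matrix.mul_adjugate]
        simp only [Matrix.vecMul, dotProduct, Matrix.map_apply, Matrix.smul_apply]
        rw [Finset.sum_eq_single i0]
        · simp [mul_comm]
        · intro b _ hb; simp [hb]
        · simp
      rw [← h1, ← Matrix.vecMul_vecMul, hvφ]
      simp [Matrix.vecMul, dotProduct, Finset.mul_sum, mul_assoc]
    have hd1 : (1:ℝ) ≤ |(A.det : ℝ)| := by exact_mod_cast Int.one_le_abs hdet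
    have h3 : |v i0| ≤ |ev x| * (s * (d.factorial * (1 + N x) ^ d)) := by
      have : |v i0| ≤ |(A.det : ℝ)| * |v i0| := by have := abs_nonneg (v i0); nlinarith
      refine this.trans ?_
      rw [← abs_mul, hmain, abs_mul]
      gcongr
      refine (Finset.abs_sum_le_sum_abs _ _).trans ?_
      rw [hs, Finset.sum_mul]
      refine Finset.sum_le_sum fun j _ => ?_
      rw [abs_mul]
      gcongr
      exact hadj j i0
    have hv0 : 0 < |v i0| := abs_pos.mpr hi0
    have : |ev x| * ((1 + s) * ↑d.factorial / |v i0|) * (1 + N x) ^ d =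
      (|ev x| * ((1 + s) * (↑d.factorial * (1 + N x) ^ d))) / |v i0| := by ring
    rw [this, le_div_iff₀ hv0, one_mul]
    refine h3.trans ?_
    gcongr
    linarith

end ST

namespace ST

theorem machine_alg (α : ℝ) (halg : IsAlgebraic ℚ α) {k : ℕ} (L : Matrix (Fin (k+1)) (Fin (k+1)) ℝ)
    (K0 K1 K2 : Fin (k+1) → Fin (k+1) → ℤ)
    (hL : L * Matrix.of (fun i j => (K0 i j : ℝ) + K1 i j * α + K2 i j * α ^ 2) = 1)
    (c : Fin (k+1) → ℝ) (hc : ∑ i, c i < 0) (A : ℝ) (hA : 0 < A) :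
    ∀ᶠ Q : ℝ in atTop, ∀ i0 j0 : Fin (k+1), i0 ≠ j0 → ¬ Config L c A i0 j0 Q := by
  obtain ⟨R, _, ev, N, hN1, D, cd, hcdN, hcd, ⟨Dn, hDn, θ, hθ⟩, _⟩ := alg_pack α halg
  rw [eventually_all]; intro i0
  rw [eventually_all]; intro j0
  rw [eventually_imp_distrib_left]; intro hij
  have hD1 : (1:ℝ) ≤ Dn := by exact_mod_cast hDn
  have hD0 : (Dn:ℝ) ≠ 0 := by positivity
  let Linv : Matrix (Fin (k+1)) (Fin (k+1)) R := Matrix.of fun i j =>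
    (K0 i j : R) * (Dn : R) ^ 2 + (K1 i j : R) * (Dn : R) * θ + (K2 i j : R) * θ ^ 2
  let L' : Matrix (Fin (k+1)) (Fin (k+1)) ℝ := ((Dn : ℝ) ^ 2)⁻¹ • L
  have hLinv : Linv.map ev = ((Dn : ℝ) ^ 2) • Matrix.of (fun i j => (K0 i j : ℝ) + K1 i j * α + K2 i j * α ^ 2) := by
    ext i j
    simp only [Linv, Matrix.map_apply, Matrix.of_apply, Matrix.smul_apply, map_add, map_mul, map_pow, map_intCast, map_natCast, hθ, smul_eq_mul]
    ring
  have hL' : L' * Linv.map ev = 1 := by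
    rw [hLinv, Matrix.smul_mul, Matrix.mul_smul, smul_smul, hL, inv_mul_cancel₀ (by positivity), one_smul]
  have := machine ev N hN1 D cd hcdN hcd L' Linv hL' c hc A hA i0 j0 hij
  filter_upwards [this] with Q hQ
  rintro ⟨x, b, h1, h2, h3, h4⟩
  refine hQ ⟨x, b, h1, h2, fun t i => ?_, h4⟩
  have : ∑ l, L' i l * b t l = ((Dn : ℝ) ^ 2)⁻¹ * ∑ l, L i l * b t l := by
    rw [Finset.mul_sum]; refine Finset.sum_congr rfl fun l _ => ?_
    simp [L', mul_assoc]
  rw [this, abs_mul, abs_of_nonneg (by positivity)]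
  refine le_trans ?_ (h3 t i)
  have h5 : ((Dn : ℝ) ^ 2)⁻¹ ≤ 1 := inv_le_one_of_one_le₀ (one_le_pow₀ hD1)
  exact mul_le_of_le_one_left (abs_nonneg _) h5

lemma rs_nat {R : Type*} [CommRing R] (N : RingSeminorm R) (hN1 : N 1 ≤ 1) (n : ℕ) : N (n : R) ≤ n := by
  induction n with
  | zero => simp
  | succ n ih =>
    push_cast
    exact (map_add_le_add N _ _).trans (by linarith)

lemma rs_int {R : Type*} [CommRing R] (N : RingSeminorm R) (hN1 : N 1 ≤ 1) (n : ℤ) : N (n : R) ≤ |(n:ℝ)| := by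
  rcases Int.natAbs_eq n with h | h
  · rw [h]; simpa using rs_nat N hN1 n.natAbs
  · rw [h]; simpa using rs_nat N hN1 n.natAbs

theorem liouville2 (α : ℝ) (halg : IsAlgebraic ℚ α) : ∃ (C : ℝ) (d : ℕ), 0 < C ∧ ∀ (b e c : ℤ) (H : ℝ),
    1 ≤ H → |(b:ℝ)| ≤ H → |(e:ℝ)| ≤ H → |(c:ℝ)| ≤ H → (b + e * α + c * α ^ 2 : ℝ) ≠ 0 →
    1 ≤ |(b + e * α + c * α ^ 2 : ℝ)| * C * H ^ d := by
  obtain ⟨R, _, ev, N, hN1, D, cd, hcdN, hcd, ⟨Dn, hDn, θ, hθ⟩, C, d, hC, hlio⟩ := alg_pack α halg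
  have hD1 : (1:ℝ) ≤ Dn := by exact_mod_cast hDn
  have hθ0 : 0 ≤ N θ := apply_nonneg N θ
  set E : ℝ := 1 + (Dn:ℝ)^2 + Dn * N θ + N θ ^ 2 with hE
  have hE0 : 0 < E := by positivity
  refine ⟨(Dn:ℝ)^2 * C * E ^ d, d, by positivity, ?_⟩
  intro b e c H hH hb he hc hne
  set x : R := (b : R) * (Dn : R) ^ 2 + (e : R) * ((Dn : R) * θ) + (c : R) * θ ^ 2 with hx
  have hevx : ev x = (Dn:ℝ)^2 * (b + e * α + c * α ^ 2 : ℝ) := by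
    simp only [hx, map_add, map_mul, map_pow, map_intCast, map_natCast, hθ]; ring
  have hH0 : 0 ≤ H := by linarith
  have hND : N (Dn : R) ≤ Dn := rs_nat N hN1 Dn
  have hNx : N x ≤ H * (Dn:ℝ)^2 + H * (Dn * N θ) + H * N θ ^ 2 := by
    refine (map_add_le_add N _ _).trans (add_le_add ((map_add_le_add N _ _).trans (add_le_add ?_ ?_)) ?_)
    · refine (map_mul_le_mul N _ _).trans (mul_le_mul ((rs_int N hN1 b).trans hb) ?_ (apply_nonneg N _) hH0)
      rw [pow_two, pow_two]
      exact (map_mul_le_mul N _ _).trans (mul_le_mul hND hND (apply_nonneg N _) (by positivity))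
    · refine (map_mul_le_mul N _ _).trans (mul_le_mul ((rs_int N hN1 e).trans he) ?_ (apply_nonneg N _) hH0)
      exact (map_mul_le_mul N _ _).trans (mul_le_mul hND le_rfl (apply_nonneg N _) (by positivity))
    · refine (map_mul_le_mul N _ _).trans (mul_le_mul ((rs_int N hN1 c).trans hc) ?_ (apply_nonneg N _) hH0)
      rw [pow_two, pow_two]
      exact (map_mul_le_mul N _ _)
  have h1 : 1 + N x ≤ H * E := by rw [hE]; nlinarith
  have h2 := hlio x (by rw [hevx]; exact mul_ne_zero (by positivity) hne)
  refine h2.trans ?_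
  rw [hevx, abs_mul, abs_of_nonneg (by positivity : (0:ℝ) ≤ (Dn:ℝ)^2)]
  have h3 : (1 + N x) ^ d ≤ (H * E) ^ d := pow_le_pow_left₀ (by have := apply_nonneg N x; linarith) h1 d
  calc _ ≤ (Dn:ℝ)^2 * |(b + e * α + c * α ^ 2 : ℝ)| * C * (H * E) ^ d := by gcongr
    _ = _ := by rw [mul_pow]; ring

end ST

namespace ST

/-- cross product -/
def cr {R : Type*} [CommRing R] (a b : Fin 3 → R) : Fin 3 → R :=
  ![a 1 * b 2 - a 2 * b 1, a 2 * b 0 - a 0 * b 2, a 0 * b 1 - a 1 * b 0]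

/-- dot product -/
def dt {R : Type*} [CommRing R] (a b : Fin 3 → R) : R := a 0 * b 0 + a 1 * b 1 + a 2 * b 2

@[simp] lemma cr_0 {R : Type*} [CommRing R] (a b : Fin 3 → R) : cr a b 0 = a 1 * b 2 - a 2 * b 1 := rfl
@[simp] lemma cr_1 {R : Type*} [CommRing R] (a b : Fin 3 → R) : cr a b 1 = a 2 * b 0 - a 0 * b 2 := rfl
@[simp] lemma cr_2 {R : Type*} [CommRing R] (a b : Fin 3 → R) : cr a b 2 = a 0 * b 1 - a 1 * b 0 := rfl

lemma ext3 {R : Type*} {a b : Fin 3 → R} (h0 : a 0 = b 0) (h1 : a 1 = b 1) (h2 : a 2 = b 2) : a = b := by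
  funext i; fin_cases i <;> assumption

lemma norm3_le {v : Fin 3 → ℝ} {B : ℝ} (h0 : |v 0| ≤ B) (h1 : |v 1| ≤ B) (h2 : |v 2| ≤ B) : ‖v‖ ≤ B := by
  rw [pi_norm_le_iff_of_nonneg ((abs_nonneg _).trans h0)]
  intro i; rw [Real.norm_eq_abs]; fin_cases i <;> assumption

lemma abs_le_norm3 (v : Fin 3 → ℝ) (i : Fin 3) : |v i| ≤ ‖v‖ := norm_le_pi_norm v i

lemma exists_dom (v : Fin 3 → ℝ) : ∃ i, |v i| = ‖v‖ := by
  obtain ⟨i, -, hi⟩ := Finset.exists_max_image (Finset.univ : Finset (Fin 3)) (fun i => |v i|) ⟨0, Finset.mem_univ _⟩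
  exact ⟨i, le_antisymm (abs_le_norm3 v i) (norm3_le (hi 0 (Finset.mem_univ _)) (hi 1 (Finset.mem_univ _)) (hi 2 (Finset.mem_univ _)))⟩

lemma exists_min3 (φ : (Fin 3 → ℤ) →+ (Fin 3 → ℝ)) (C : ℝ) (hφ : ∀ P l, |(P l : ℝ)| ≤ C * ‖φ P‖) (hC : 0 ≤ C)
    (S : Set (Fin 3 → ℤ)) (P1 : Fin 3 → ℤ) (hP1 : P1 ∈ S) : ∃ P0 ∈ S, ∀ P ∈ S, ‖φ P0‖ ≤ ‖φ P‖ := by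
  set B := ‖φ P1‖
  set m : ℤ := ⌈C * B⌉ with hm
  have hfin : (S ∩ {P | ‖φ P‖ ≤ B}).Finite := by
    refine (Set.finite_Icc (fun _ : Fin 3 => -m) (fun _ => m)).subset ?_
    rintro P ⟨_, hP⟩
    have : ∀ l, |P l| ≤ m := by
      intro l
      have h1 : |(P l : ℝ)| ≤ m := (hφ P l).trans ((mul_le_mul_of_nonneg_left hP hC).trans (Int.le_ceil _))
      exact_mod_cast h1
    exact ⟨fun l => (abs_le.mp (this l)).1, fun l => (abs_le.mp (this l)).2⟩
  obtain ⟨P0, hP0, hmin⟩ := Set.exists_min_image _ (fun P => ‖φ P‖) hfin ⟨P1, hP1, show ‖φ P1‖ ≤ B from le_rfl⟩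
  refine ⟨P0, hP0.1, fun P hP => ?_⟩
  by_cases h : ‖φ P‖ ≤ B
  · exact hmin P ⟨hP, h⟩
  · exact hP0.2.trans (not_le.mp h).le

lemma prim3 (φ : (Fin 3 → ℤ) →+ (Fin 3 → ℝ)) (hinj : ∀ P, P ≠ 0 → 0 < ‖φ P‖)
    (S : Set (Fin 3 → ℤ)) (P0 : Fin 3 → ℤ) (hP0 : P0 ≠ 0) (hS : ∀ (g : ℤ) (P1 : Fin 3 → ℤ), P0 = g • P1 → P1 ∈ S)
    (hmin : ∀ P ∈ S, P ≠ 0 → ‖φ P0‖ ≤ ‖φ P‖) : ∃ c : Fin 3 → ℤ, dt c P0 = 1 := by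
  set I := Ideal.span (Set.range P0)
  obtain ⟨g, hg⟩ := (IsPrincipalIdealRing.principal I).principal
  have hgd : ∀ l, ∃ r, P0 l = g * r := by
    intro l
    have : P0 l ∈ I := Ideal.subset_span ⟨l, rfl⟩
    rw [hg] at this
    obtain ⟨r, hr⟩ := Ideal.mem_span_singleton'.mp this
    exact ⟨r, by rw [← hr, mul_comm]⟩
  choose r hr using hgd
  have hP0r : P0 = g • r := by funext l; rw [hr l]; rfl
  have hr0 : r ≠ 0 := by rintro rfl; apply hP0; rw [hP0r, smul_zero]
  have h1 := hmin r (hS g r hP0r) hr0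
  have h2 : ‖φ P0‖ = |(g:ℝ)| * ‖φ r‖ := by
    rw [hP0r, map_zsmul, ← Int.cast_smul_eq_zsmul ℝ, norm_smul, Real.norm_eq_abs]
  have h3 := hinj r hr0
  have hg1 : |(g:ℝ)| ≤ 1 := by
    by_contra h; push Not at h; nlinarith
  have hg1' : |g| ≤ 1 := by exact_mod_cast hg1
  have hg0 : g ≠ 0 := by rintro rfl; apply hP0; rw [hP0r, zero_smul]
  have hgI : g ∈ I := by rw [hg]; exact Ideal.mem_span_singleton_self g
  obtain ⟨c, hc⟩ := Ideal.mem_span_range_iff_exists_fun.mp hgI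
  have hgg : g * g = 1 := by
    have := abs_le.mp hg1'
    have : g = 1 ∨ g = -1 := by omega
    rcases this with h | h <;> simp [h]
  refine ⟨g • c, ?_⟩
  simp only [Fin.sum_univ_three] at hc
  simp only [dt, Pi.smul_apply, smul_eq_mul]
  linear_combination g * hc + hgg

lemma red3 (v v' : Fin 3 → ℝ) (k : Fin 3) (hk : |v k| = ‖v‖) (hv : 0 < ‖v‖) (hv' : |v' k| ≤ ‖v‖ / 2) (B : ℝ)
    (hB : ‖cr v v'‖ ≤ B) : ‖v'‖ ≤ B / ‖v‖ + ‖v‖ / 2 := by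
  have key : ∀ a b c s : ℝ, |a| = ‖v‖ → |b| ≤ ‖v‖ → |c| ≤ ‖v‖ / 2 → |a * s - b * c| ≤ B → |s| ≤ B / ‖v‖ + ‖v‖ / 2 := by
    intro a b c s ha hb hc h
    have h1 : |a * s| ≤ B + |b| * |c| := by
      rw [← abs_mul]; have := abs_sub_abs_le_abs_sub (a * s) (b * c); linarith
    have h2 : |b| * |c| ≤ ‖v‖ * (‖v‖ / 2) := mul_le_mul hb hc (abs_nonneg _) hv.le
    rw [abs_mul, ha] at h1
    have : |s| ≤ (B + ‖v‖ * (‖v‖ / 2)) / ‖v‖ := by rw [le_div_iff₀ hv]; linarith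
    refine this.trans (le_of_eq ?_)
    field_simp
  have hB0 : 0 ≤ B / ‖v‖ := div_nonneg ((norm_nonneg _).trans hB) hv.le
  have c0 := (abs_le_norm3 (cr v v') 0).trans hB
  have c1 := (abs_le_norm3 (cr v v') 1).trans hB
  have c2 := (abs_le_norm3 (cr v v') 2).trans hB
  rw [cr_0] at c0; rw [cr_1] at c1; rw [cr_2] at c2
  have c0' : |v 2 * v' 1 - v 1 * v' 2| ≤ B := by rw [abs_sub_comm]; exact c0
  have c1' : |v 0 * v' 2 - v 2 * v' 0| ≤ B := by rw [abs_sub_comm]; exact c1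
  have c2' : |v 1 * v' 0 - v 0 * v' 1| ≤ B := by rw [abs_sub_comm]; exact c2
  have n := abs_le_norm3 v
  fin_cases k <;> simp only [Fin.zero_eta, Fin.mk_one, Fin.reduceFinMk] at hk hv' <;> apply norm3_le
  · linarith
  · exact key _ _ _ _ hk (n 1) hv' c2
  · exact key _ _ _ _ hk (n 2) hv' c1'
  · exact key _ _ _ _ hk (n 0) hv' c2'
  · linarith
  · exact key _ _ _ _ hk (n 2) hv' c0
  · exact key _ _ _ _ hk (n 0) hv' c1
  · exact key _ _ _ _ hk (n 1) hv' c0'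
  · linarith

lemma round_red (a b : ℝ) (ha : a ≠ 0) : ∃ m : ℤ, |b - m * a| ≤ |a| / 2 := by
  refine ⟨round (b / a), ?_⟩
  have h := abs_sub_round (b / a)
  have : b - round (b / a) * a = (b / a - round (b / a)) * a := by field_simp
  rw [this, abs_mul]
  nlinarith [abs_nonneg a]

lemma red2 (a b c d s t : ℝ) (h : a * d - b * c ≠ 0) : ∃ m n : ℤ, |s - m * a - n * c| ≤ |a| / 2 + |c| / 2 ∧
    |t - m * b - n * d| ≤ |b| / 2 + |d| / 2 := by
  set x := (s * d - t * c) / (a * d - b * c) with hx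
  set y := (a * t - b * s) / (a * d - b * c) with hy
  have h1 : s = x * a + y * c := by rw [hx, hy, div_mul_eq_mul_div, div_mul_eq_mul_div, ← add_div, eq_div_iff h]; ring
  have h2 : t = x * b + y * d := by rw [hx, hy, div_mul_eq_mul_div, div_mul_eq_mul_div, ← add_div, eq_div_iff h]; ring
  have hx1 := abs_sub_round x
  have hy1 := abs_sub_round y
  refine ⟨round x, round y, ?_, ?_⟩
  · have : s - round x * a - round y * c = (x - round x) * a + (y - round y) * c := by rw [h1]; ring
    rw [this]
    refine (abs_add_le _ _).trans ?_
    rw [abs_mul, abs_mul]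
    nlinarith [abs_nonneg a, abs_nonneg c]
  · have : t - round x * b - round y * d = (x - round x) * b + (y - round y) * d := by rw [h2]; ring
    rw [this]
    refine (abs_add_le _ _).trans ?_
    rw [abs_mul, abs_mul]
    nlinarith [abs_nonneg b, abs_nonneg d]

theorem lattice3 (G : ℝ) (hG : 0 < G) (φ ψ : (Fin 3 → ℤ) →+ (Fin 3 → ℝ)) (C : ℝ) (hC : 0 ≤ C)
    (hφ : ∀ P l, |(P l : ℝ)| ≤ C * ‖φ P‖) (hψ : ∀ P l, |(P l : ℝ)| ≤ C * ‖ψ P‖)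
    (hdot : ∀ P y, dt (φ P) (ψ y) = (dt P y : ℤ))
    (hcr1 : ∀ y y', cr (ψ y) (ψ y') = G • φ (cr y y'))
    (hcr2 : ∀ P P', cr (φ P) (φ P') = G⁻¹ • ψ (cr P P')) :
    ∃ (P0 P2 y y1 y2 : Fin 3 → ℤ) (i : Fin 3), P0 ≠ 0 ∧ y ≠ 0 ∧ dt y2 P0 = 1 ∧ |φ P0 i| = ‖φ P0‖ ∧
      dt y P0 = 0 ∧ dt y1 P0 = 0 ∧ dt y P2 = 0 ∧ cr y y1 = P0 ∧ cr P2 P0 = y ∧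
      |φ P2 i| ≤ ‖φ P0‖ / 2 ∧ 0 < ‖φ P0‖ ∧ 0 < ‖ψ y‖ ∧ ‖φ P2‖ ≤ 2 * ‖ψ y‖ / (G * ‖φ P0‖) ∧ ‖ψ y‖ ≤ ‖ψ y1‖ ∧
      ‖ψ y1‖ ≤ 2 * G * ‖φ P0‖ / ‖ψ y‖ ∧ ‖ψ y1‖ ≤ 4 / ‖φ P0‖ ∧ ‖ψ y2‖ ≤ 9 / ‖φ P0‖ := by
  have pos : ∀ (χ : (Fin 3 → ℤ) →+ (Fin 3 → ℝ)), (∀ P l, |(P l : ℝ)| ≤ C * ‖χ P‖) → ∀ P, P ≠ 0 → 0 < ‖χ P‖ := by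
    intro χ hχ P hP
    by_contra h
    have h0 : ‖χ P‖ = 0 := le_antisymm (not_lt.mp h) (norm_nonneg _)
    apply hP
    funext l
    have := hχ P l
    rw [h0, mul_zero, abs_nonpos_iff] at this
    exact_mod_cast this
  have posφ := pos φ hφ
  have posψ := pos ψ hψ
  -- shortest P0
  obtain ⟨P0, hP0, hP0min⟩ := exists_min3 φ C hφ hC {P | P ≠ 0} (fun _ => 1) (by
    intro h; have := congrFun h 0; simp at this)
  have hP0' : P0 ≠ 0 := hP0
  obtain ⟨i, hi⟩ := exists_dom (φ P0)
  have hlam := posφ P0 hP0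
  obtain ⟨z, hz⟩ := prim3 φ posφ Set.univ P0 hP0 (fun _ _ _ => trivial) (fun P _ hP => hP0min P hP)
  -- shortest y
  obtain ⟨v, hv0, hv⟩ : ∃ v : Fin 3 → ℤ, v ≠ 0 ∧ dt v P0 = 0 := by
    by_cases h : P0 0 = 0
    · refine ⟨![1, 0, 0], ?_, ?_⟩
      · intro h; have := congrFun h 0; simp at this
      · simp [dt, h]
    · refine ⟨![P0 1, -P0 0, 0], ?_, ?_⟩
      · intro h'; have := congrFun h' 1; simp at this; exact h this
      · simp [dt]; ring
  obtain ⟨y, ⟨hy0, hyP⟩, hymin⟩ := exists_min3 ψ C hψ hC {y | y ≠ 0 ∧ dt y P0 = 0} v ⟨hv0, hv⟩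
  obtain ⟨Ps, hPs⟩ := prim3 ψ posψ {y | dt y P0 = 0} y hy0 (by
    intro g y1 hg
    have hg0 : g ≠ 0 := by rintro rfl; apply hy0; rw [hg, zero_smul]
    have : g * dt y1 P0 = 0 := by
      rw [← hyP, hg]; simp only [dt, Pi.smul_apply, smul_eq_mul]; ring
    exact (mul_eq_zero.mp this).resolve_left hg0) (fun P hP h => hymin P ⟨h, hP⟩)
  have hη := posψ y hy0
  obtain ⟨k, hk⟩ := exists_dom (ψ y)
  -- y1
  obtain ⟨y1, hy1, hy1k⟩ : ∃ y1, cr y y1 = P0 ∧ |ψ y1 k| ≤ ‖ψ y‖ / 2 := by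
    obtain ⟨m, hm⟩ := round_red (ψ y k) (ψ (cr P0 Ps) k) (by rw [← abs_pos, hk]; exact hη)
    refine ⟨cr P0 Ps - m • y, ?_, ?_⟩
    · simp only [dt] at hPs hyP
      apply ext3 <;> simp only [cr_0, cr_1, cr_2, Pi.sub_apply, Pi.smul_apply, smul_eq_mul]
      · linear_combination P0 0 * hPs - Ps 0 * hyP
      · linear_combination P0 1 * hPs - Ps 1 * hyP
      · linear_combination P0 2 * hPs - Ps 2 * hyP
    · rw [hk] at hm
      rw [map_sub, map_zsmul]
      simpa using hm
  have hy1P : dt y1 P0 = 0 := by rw [← hy1]; simp [dt]; ring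
  have hy10 : y1 ≠ 0 := by
    rintro rfl; apply hP0'; rw [← hy1]; apply ext3 <;> simp
  have hyy1 : ‖ψ y‖ ≤ ‖ψ y1‖ := hymin y1 ⟨hy10, hy1P⟩
  have hy1n : ‖ψ y1‖ ≤ 2 * G * ‖φ P0‖ / ‖ψ y‖ := by
    have := red3 (ψ y) (ψ y1) k hk hη hy1k (G * ‖φ P0‖) (by
      rw [hcr1, hy1, norm_smul, Real.norm_eq_abs, abs_of_pos hG])
    have h2 : 2 * G * ‖φ P0‖ / ‖ψ y‖ = 2 * (G * ‖φ P0‖ / ‖ψ y‖) := by ring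
    rw [h2]; linarith
  -- P2
  obtain ⟨P2, hP2, hP2y, hP2i⟩ : ∃ P2, cr P2 P0 = y ∧ dt y P2 = 0 ∧ |φ P2 i| ≤ ‖φ P0‖ / 2 := by
    obtain ⟨m, hm⟩ := round_red (φ P0 i) (φ (cr z y) i) (by rw [← abs_pos, hi]; exact hlam)
    refine ⟨cr z y - m • P0, ?_, ?_, ?_⟩
    · simp only [dt] at hz hyP
      apply ext3 <;> simp only [cr_0, cr_1, cr_2, Pi.sub_apply, Pi.smul_apply, smul_eq_mul]
      · linear_combination y 0 * hz - z 0 * hyP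
      · linear_combination y 1 * hz - z 1 * hyP
      · linear_combination y 2 * hz - z 2 * hyP
    · simp only [dt] at hyP ⊢
      simp only [cr_0, cr_1, cr_2, Pi.sub_apply, Pi.smul_apply, smul_eq_mul]
      linear_combination - m * hyP
    · rw [hi] at hm
      rw [map_sub, map_zsmul]
      simpa using hm
  have hP20 : P2 ≠ 0 := by
    rintro rfl; apply hy0; rw [← hP2]; apply ext3 <;> simp
  have hP2n : ‖φ P2‖ ≤ G⁻¹ * ‖ψ y‖ / ‖φ P0‖ + ‖φ P0‖ / 2 := by
    refine red3 (φ P0) (φ P2) i hi hlam hP2i (G⁻¹ * ‖ψ y‖) ?_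
    have : cr (φ P0) (φ P2) = - cr (φ P2) (φ P0) := by
      apply ext3 <;> simp <;> ring
    rw [this, norm_neg, hcr2, hP2, norm_smul, Real.norm_eq_abs, abs_of_pos (inv_pos.mpr hG)]
  have hP2min := hP0min P2 hP20
  have hdiv : G⁻¹ * ‖ψ y‖ / ‖φ P0‖ = ‖ψ y‖ / (G * ‖φ P0‖) := by field_simp
  rw [hdiv] at hP2n
  have hylow : ‖φ P0‖ / 2 ≤ ‖ψ y‖ / (G * ‖φ P0‖) := by linarith
  have hylow' : G * ‖φ P0‖ ^ 2 ≤ 2 * ‖ψ y‖ := by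
    rw [le_div_iff₀ (by positivity)] at hylow; linarith
  have hy14 : ‖ψ y1‖ ≤ 4 / ‖φ P0‖ := by
    refine hy1n.trans ?_
    rw [div_le_div_iff₀ hη hlam]; linarith
  -- y2
  have hcr := hcr1 y y1
  rw [hy1] at hcr
  have hne : φ P0 i ≠ 0 := by rw [← abs_pos, hi]; exact hlam
  have hcri : cr (ψ y) (ψ y1) i ≠ 0 := by
    rw [hcr]; exact mul_ne_zero hG.ne' hne
  have hbound : ∀ j, |ψ y j| / 2 + |ψ y1 j| / 2 ≤ 4 / ‖φ P0‖ := by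
    intro j; have := abs_le_norm3 (ψ y) j; have := abs_le_norm3 (ψ y1) j; linarith
  obtain ⟨m, n, hmn⟩ : ∃ m n : ℤ, ∀ j, j ≠ i → |ψ (z - m • y - n • y1) j| ≤ 4 / ‖φ P0‖ := by
    have e : ∀ m n : ℤ, ∀ j, ψ (z - m • y - n • y1) j = ψ z j - m * ψ y j - n * ψ y1 j := by
      intro m n j; rw [map_sub, map_sub, map_zsmul, map_zsmul]; simp
    simp only [e]
    fin_cases i <;> simp only [Fin.zero_eta, Fin.mk_one, Fin.reduceFinMk, cr_0, cr_1, cr_2] at hcri ⊢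
    · obtain ⟨m, n, h1, h2⟩ := red2 _ _ _ _ (ψ z 1) (ψ z 2) hcri
      refine ⟨m, n, fun j hj => ?_⟩
      fin_cases j
      · exact absurd rfl hj
      · exact h1.trans (hbound 1)
      · exact h2.trans (hbound 2)
    · obtain ⟨m, n, h1, h2⟩ := red2 _ _ _ _ (ψ z 2) (ψ z 0) hcri
      refine ⟨m, n, fun j hj => ?_⟩
      fin_cases j
      · exact h2.trans (hbound 0)
      · exact absurd rfl hj
      · exact h1.trans (hbound 2)
    · obtain ⟨m, n, h1, h2⟩ := red2 _ _ _ _ (ψ z 0) (ψ z 1) hcri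
      refine ⟨m, n, fun j hj => ?_⟩
      fin_cases j
      · exact h1.trans (hbound 0)
      · exact h2.trans (hbound 1)
      · exact absurd rfl hj
  set y2 := z - m • y - n • y1 with hy2
  have hy2P : dt y2 P0 = 1 := by
    simp only [dt] at hz hyP hy1P ⊢
    simp only [hy2, Pi.sub_apply, Pi.smul_apply, smul_eq_mul]
    linear_combination hz - m * hyP - n * hy1P
  have hy2n : ‖ψ y2‖ ≤ 9 / ‖φ P0‖ := by
    have hd := hdot P0 y2
    have : dt P0 y2 = 1 := by rw [← hy2P]; simp only [dt]; ring
    rw [this] at hd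
    have key : ∀ a b c s t r : ℝ, |a| = ‖φ P0‖ → |b| ≤ ‖φ P0‖ → |c| ≤ ‖φ P0‖ → |t| ≤ 4 / ‖φ P0‖ → |r| ≤ 4 / ‖φ P0‖ →
        a * s + b * t + c * r = 1 → |s| ≤ 9 / ‖φ P0‖ := by
      intro a b c s t r ha hb hc ht hr h
      rw [le_div_iff₀ hlam, ← ha, mul_comm, ← abs_mul]
      have h1 : a * s = 1 - b * t - c * r := by linarith
      have h2 : ∀ b t : ℝ, |b| ≤ ‖φ P0‖ → |t| ≤ 4 / ‖φ P0‖ → |b * t| ≤ 4 := by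
        intro b t hb ht
        rw [abs_mul]
        calc |b| * |t| ≤ ‖φ P0‖ * (4 / ‖φ P0‖) := mul_le_mul hb ht (abs_nonneg _) hlam.le
          _ = 4 := by field_simp
      have h3 := abs_le.mp (h2 b t hb ht)
      have h4 := abs_le.mp (h2 c r hc hr)
      rw [h1, abs_le]; constructor <;> linarith
    have h49 : 4 / ‖φ P0‖ ≤ 9 / ‖φ P0‖ := by gcongr; norm_num
    have nn := abs_le_norm3 (φ P0)
    simp only [dt, Int.cast_one] at hd
    clear_value y2
    clear hcri
    fin_cases i <;> simp only [Fin.zero_eta, Fin.mk_one, Fin.reduceFinMk] at hi hmn <;> apply norm3_le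
    · exact key _ _ _ _ _ _ hi (nn 1) (nn 2) (hmn 1 (by decide)) (hmn 2 (by decide)) hd
    · exact (hmn 1 (by decide)).trans h49
    · exact (hmn 2 (by decide)).trans h49
    · exact (hmn 0 (by decide)).trans h49
    · exact key _ _ _ _ _ _ hi (nn 0) (nn 2) (hmn 0 (by decide)) (hmn 2 (by decide)) (by linarith)
    · exact (hmn 2 (by decide)).trans h49
    · exact (hmn 0 (by decide)).trans h49
    · exact (hmn 1 (by decide)).trans h49
    · exact key _ _ _ _ _ _ hi (nn 0) (nn 1) (hmn 0 (by decide)) (hmn 1 (by decide)) (by linarith)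
  refine ⟨P0, P2, y, y1, y2, i, hP0', hy0, hy2P, hi, hyP, hy1P, hP2y, hy1, hP2, hP2i, hlam, hη, ?_, hyy1, hy1n, hy14, hy2n⟩
  refine hP2n.trans ?_
  have : 2 * ‖ψ y‖ / (G * ‖φ P0‖) = 2 * (‖ψ y‖ / (G * ‖φ P0‖)) := by ring
  rw [this]; linarith

end ST

namespace ST

/-- forms on quadratics -/
def Lp (α : ℝ) : Matrix (Fin 3) (Fin 3) ℝ := !![1, α, α ^ 2; 0, 1, 2 * α; 0, 0, 1]
/-- dual forms -/
def Ld (α : ℝ) : Matrix (Fin 3) (Fin 3) ℝ := !![1, 0, 0; -α, 1, 0; α ^ 2, -(2 * α), 1]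

/-- scaled forms -/
noncomputable def phi (L : Matrix (Fin 3) (Fin 3) ℝ) (g : Fin 3 → ℝ) : (Fin 3 → ℤ) →+ (Fin 3 → ℝ) where
  toFun P i := (∑ l, L i l * P l) * g i
  map_zero' := by funext i; simp
  map_add' P P' := by
    funext i; simp only [Pi.add_apply, Int.cast_add, mul_add, Finset.sum_add_distrib, add_mul]

lemma phi_apply (L : Matrix (Fin 3) (Fin 3) ℝ) (g : Fin 3 → ℝ) (P : Fin 3 → ℤ) (i : Fin 3) :
    phi L g P i = (L i 0 * P 0 + L i 1 * P 1 + L i 2 * P 2) * g i := by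
  simp [phi, Fin.sum_univ_three]

lemma phi_bound (L Li : Matrix (Fin 3) (Fin 3) ℝ) (hL : Li * L = 1) (g : Fin 3 → ℝ) (hg : ∀ i, 0 < g i) (P : Fin 3 → ℤ) (l : Fin 3) :
    |(P l : ℝ)| ≤ (∑ l, ∑ i, |Li l i| / g i) * ‖phi L g P‖ := by
  have h1 : (P l : ℝ) = ∑ i, Li l i / g i * phi L g P i := by
    have h2 : ∑ i, Li l i / g i * phi L g P i = (Li.mulVec (L.mulVec (fun l => (P l : ℝ)))) l := by
      simp only [Matrix.mulVec, dotProduct]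
      refine Finset.sum_congr rfl fun i _ => ?_
      have := (hg i).ne'
      simp only [phi, AddMonoidHom.coe_mk, ZeroHom.coe_mk]
      field_simp
    rw [h2, Matrix.mulVec_mulVec, hL, Matrix.one_mulVec]
  rw [h1]
  have h3 : (∑ i, |Li l i| / g i) ≤ ∑ l, ∑ i, |Li l i| / g i :=
    Finset.single_le_sum (f := fun l => ∑ i, |Li l i| / g i) (fun l _ => Finset.sum_nonneg fun i _ => div_nonneg (abs_nonneg _) (hg i).le) (Finset.mem_univ l)
  refine (Finset.abs_sum_le_sum_abs _ _).trans (le_trans ?_ (mul_le_mul_of_nonneg_right h3 (norm_nonneg _)))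
  rw [Finset.sum_mul]
  refine Finset.sum_le_sum fun i _ => ?_
  rw [abs_mul, abs_div, abs_of_pos (hg i)]
  exact mul_le_mul_of_nonneg_left (abs_le_norm3 _ i) (div_nonneg (abs_nonneg _) (hg i).le)

lemma Lp_inv (α : ℝ) : Lp α * !![1, -α, α ^ 2; 0, 1, -(2 * α); 0, 0, 1] = 1 := by
  ext i j; fin_cases i <;> fin_cases j <;> simp [Lp, Matrix.mul_apply, Fin.sum_univ_three] <;> ring

lemma Ld_inv (α : ℝ) : Ld α * !![1, 0, 0; α, 1, 0; α ^ 2, 2 * α, 1] = 1 := by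
  ext i j; fin_cases i <;> fin_cases j <;> simp [Ld, Matrix.mul_apply, Fin.sum_univ_three] <;> ring

theorem lat_alpha (α : ℝ) (g : Fin 3 → ℝ) (hg : ∀ i, 0 < g i) :
    ∃ (P0 P2 y y1 y2 : Fin 3 → ℤ) (i : Fin 3), P0 ≠ 0 ∧ y ≠ 0 ∧ dt y2 P0 = 1 ∧ |phi (Lp α) g⁻¹ P0 i| = ‖phi (Lp α) g⁻¹ P0‖ ∧
      dt y P0 = 0 ∧ dt y1 P0 = 0 ∧ dt y P2 = 0 ∧ cr y y1 = P0 ∧ cr P2 P0 = y ∧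
      |phi (Lp α) g⁻¹ P2 i| ≤ ‖phi (Lp α) g⁻¹ P0‖ / 2 ∧ 0 < ‖phi (Lp α) g⁻¹ P0‖ ∧ 0 < ‖phi (Ld α) g y‖ ∧
      ‖phi (Lp α) g⁻¹ P2‖ ≤ 2 * ‖phi (Ld α) g y‖ / ((g 0 * g 1 * g 2) * ‖phi (Lp α) g⁻¹ P0‖) ∧ ‖phi (Ld α) g y‖ ≤ ‖phi (Ld α) g y1‖ ∧
      ‖phi (Ld α) g y1‖ ≤ 2 * (g 0 * g 1 * g 2) * ‖phi (Lp α) g⁻¹ P0‖ / ‖phi (Ld α) g y‖ ∧ ‖phi (Ld α) g y1‖ ≤ 4 / ‖phi (Lp α) g⁻¹ P0‖ ∧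
      ‖phi (Ld α) g y2‖ ≤ 9 / ‖phi (Lp α) g⁻¹ P0‖ := by
  have hg' : ∀ i, 0 < g⁻¹ i := fun i => inv_pos.mpr (hg i)
  have g0 := (hg 0).ne'
  have g1 := (hg 1).ne'
  have g2 := (hg 2).ne'
  have b1 := phi_bound (Lp α) _ (mul_eq_one_comm.mp (Lp_inv α)) g⁻¹ hg'
  have b2 := phi_bound (Ld α) _ (mul_eq_one_comm.mp (Ld_inv α)) g hg
  set C1 := ∑ l, ∑ i, |(!![1, -α, α ^ 2; 0, 1, -(2 * α); 0, 0, 1] : Matrix (Fin 3) (Fin 3) ℝ) l i| / g⁻¹ i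
  set C2 := ∑ l, ∑ i, |(!![1, 0, 0; α, 1, 0; α ^ 2, 2 * α, 1] : Matrix (Fin 3) (Fin 3) ℝ) l i| / g i
  have hC1 : 0 ≤ C1 := Finset.sum_nonneg fun l _ => Finset.sum_nonneg fun i _ => div_nonneg (abs_nonneg _) (hg' i).le
  have hC2 : 0 ≤ C2 := Finset.sum_nonneg fun l _ => Finset.sum_nonneg fun i _ => div_nonneg (abs_nonneg _) (hg i).le
  refine lattice3 (g 0 * g 1 * g 2) (mul_pos (mul_pos (hg 0) (hg 1)) (hg 2)) (phi (Lp α) g⁻¹) (phi (Ld α) g) (C1 + C2) (by positivity) ?_ ?_ ?_ ?_ ?_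
  · intro P l; exact (b1 P l).trans (mul_le_mul_of_nonneg_right (by linarith) (norm_nonneg _))
  · intro P l; exact (b2 P l).trans (mul_le_mul_of_nonneg_right (by linarith) (norm_nonneg _))
  · intro P y
    simp [dt, phi_apply, Lp, Ld]
    field_simp
    ring
  · intro P y
    apply ext3 <;> simp [cr, phi_apply, Lp, Ld] <;> field_simp <;> ring
  · intro P y
    apply ext3 <;> simp [cr, phi_apply, Lp, Ld] <;> field_simp <;> ring

lemma denA (x z : Fin 3 → ℤ) (h : dt z x = 1) (i0 : Fin 3) (hx : x i0 ≠ 0) : ∃ j, i0 ≠ j ∧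
    |x i0| ≤ (((x j : ℚ) / x i0).den : ℤ) ^ 2 := by
  have hdvd : ∀ j, x i0 ∣ x j * (((x j : ℚ) / x i0).den : ℤ) := by
    intro j
    obtain ⟨c, h1, h2⟩ := Rat.exists_eq_mul_div_num_and_eq_mul_div_den (x j) hx
    refine ⟨((x j : ℚ) / x i0).num, ?_⟩
    linear_combination (((x j : ℚ) / x i0).den : ℤ) * h1 - ((x j : ℚ) / x i0).num * h2
  obtain ⟨d, hd⟩ : ∃ d : Fin 3 → ℤ, ∀ j, d j = (((x j : ℚ) / x i0).den : ℤ) := ⟨_, fun _ => rfl⟩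
  have hd0 : ∀ j, 0 < d j := fun j => by rw [hd]; exact Int.natCast_pos.mpr (Rat.den_pos _)
  simp only [← hd] at hdvd ⊢
  clear hd
  have key : ∀ j k, i0 ≠ j → i0 ≠ k → (∀ l, x i0 ∣ x l * (d j * d k)) → ∃ j, i0 ≠ j ∧ |x i0| ≤ d j ^ 2 := by
    intro j k hj hk hl
    have h1 : x i0 ∣ d j * d k := by
      have : d j * d k = z 0 * (x 0 * (d j * d k)) + z 1 * (x 1 * (d j * d k)) + z 2 * (x 2 * (d j * d k)) := by
        simp only [dt] at h; linear_combination - (d j * d k) * h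
      rw [this]
      exact dvd_add (dvd_add ((hl 0).mul_left _) ((hl 1).mul_left _)) ((hl 2).mul_left _)
    have h2 : |x i0| ≤ d j * d k := Int.le_of_dvd (mul_pos (hd0 j) (hd0 k)) ((abs_dvd _ _).mpr h1)
    rcases le_total (d j) (d k) with h3 | h3
    · exact ⟨k, hk, by nlinarith [hd0 j, hd0 k]⟩
    · exact ⟨j, hj, by nlinarith [hd0 j, hd0 k]⟩
  have hself : ∀ m, x i0 ∣ x i0 * m := fun m => dvd_mul_right _ _
  have hl1 : ∀ l m, x i0 ∣ x l * (d l * m) := fun l m => by rw [← mul_assoc]; exact (hdvd l).mul_right _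
  have hl2 : ∀ l m, x i0 ∣ x l * (m * d l) := fun l m => by rw [mul_comm m]; exact hl1 l m
  fin_cases i0
  · refine key 1 2 (by decide) (by decide) (fun l => ?_)
    fin_cases l
    · exact hself _
    · exact hl1 1 _
    · exact hl2 2 _
  · refine key 0 2 (by decide) (by decide) (fun l => ?_)
    fin_cases l
    · exact hl1 0 _
    · exact hself _
    · exact hl2 2 _
  · refine key 0 1 (by decide) (by decide) (fun l => ?_)
    fin_cases l
    · exact hl1 0 _
    · exact hl2 1 _
    · exact hself _

/-- packaged Liouville -/
theorem liou_pack (α : ℝ) (halg : IsAlgebraic ℚ α)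
    (hquad : ∀ b e c : ℤ, (b + e * α + c * α ^ 2 : ℝ) = 0 → b = 0 ∧ e = 0 ∧ c = 0) :
    ∃ A : ℝ, 0 < A ∧ ∀ᶠ Q : ℝ in atTop,
      (∀ x z : Fin 3 → ℤ, dt z x = 1 → |(x 0 + x 1 * α + x 2 * α ^ 2 : ℝ)| ≤ Q ^ (-1/2 : ℝ) →
        ∃ i0 j0, i0 ≠ j0 ∧ Q ^ A ≤ (((x j0 : ℚ) / (x i0)).den : ℝ)) ∧
      (∀ y0 y1 : ℤ, y0 ≠ 0 → |(y1 - α * y0 : ℝ)| ≤ Q ^ (-1/2 : ℝ) → Q ^ A ≤ (((y1 : ℚ) / y0).den : ℝ)) := by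
  obtain ⟨C, d, hC, hlio⟩ := liouville2 α halg
  set D := d + 1 with hD
  have hD0 : (0:ℝ) < D := by rw [hD]; positivity
  set E : ℝ := C * (|α| + 1) ^ D with hE
  have hE0 : 0 < E := by positivity
  refine ⟨1 / (8 * D), by positivity, ?_⟩
  filter_upwards [(tendsto_rpow_atTop (by norm_num : (0:ℝ) < 1/4)).eventually_ge_atTop (C + E), eventually_ge_atTop 1] with Q hQ hQ1
  have hQ0 : 0 < Q := by linarith
  have hlio' : ∀ (b e c : ℤ) (H : ℝ), 1 ≤ H → |(b:ℝ)| ≤ H → |(e:ℝ)| ≤ H → |(c:ℝ)| ≤ H → (b ≠ 0 ∨ e ≠ 0 ∨ c ≠ 0) →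
      |(b + e * α + c * α ^ 2 : ℝ)| ≤ Q ^ (-1/2 : ℝ) → Q ^ (1/2 : ℝ) ≤ C * H ^ D := by
    intro b e c H hH hb he hc hne hs
    have h1 := hlio b e c H hH hb he hc (fun h => by have := hquad b e c h; tauto)
    have h2 : H ^ d ≤ H ^ D := pow_le_pow_right₀ hH (by omega)
    have h3 : 1 ≤ Q ^ (-1/2 : ℝ) * (C * H ^ D) := by
      refine h1.trans ?_
      rw [mul_assoc]
      exact mul_le_mul hs (mul_le_mul_of_nonneg_left h2 hC.le) (by positivity) (by positivity)
    have h4 : Q ^ (1/2 : ℝ) * Q ^ (-1/2 : ℝ) = 1 := by rw [← Real.rpow_add hQ0]; norm_num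
    calc Q ^ (1/2 : ℝ) = Q ^ (1/2 : ℝ) * 1 := by ring
      _ ≤ Q ^ (1/2 : ℝ) * (Q ^ (-1/2 : ℝ) * (C * H ^ D)) := by gcongr
      _ = C * H ^ D := by rw [← mul_assoc, h4, one_mul]
  have hQq : Q ^ (1/4 : ℝ) * Q ^ (1/4 : ℝ) = Q ^ (1/2 : ℝ) := by rw [← Real.rpow_add hQ0]; norm_num
  have hQq0 : 0 < Q ^ (1/4 : ℝ) := Real.rpow_pos_of_pos hQ0 _
  have hroot : ∀ q : ℝ, 0 ≤ q → Q ^ (1/8 : ℝ) ≤ q ^ D → Q ^ (1 / (8 * D) : ℝ) ≤ q := by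
    intro q hq h
    have h1 : (Q ^ (1 / (8 * D) : ℝ)) ^ D = Q ^ (1/8 : ℝ) := by
      rw [← Real.rpow_natCast, ← Real.rpow_mul hQ0.le]; congr 1; field_simp
    rw [← h1] at h
    exact le_of_pow_le_pow_left₀ (by omega) hq h
  have hQ84 : Q ^ (1/8 : ℝ) ≤ Q ^ (1/4 : ℝ) := Real.rpow_le_rpow_of_exponent_le hQ1 (by norm_num)
  constructor
  · intro x z hz hs
    obtain ⟨i0, -, hi0⟩ := Finset.exists_max_image (Finset.univ : Finset (Fin 3)) (fun i => |x i|) ⟨0, Finset.mem_univ _⟩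
    have hxi0 : x i0 ≠ 0 := by
      intro h0
      have : ∀ l, x l = 0 := fun l => by
        have := hi0 l (Finset.mem_univ _); rw [h0, abs_zero] at this; exact abs_nonpos_iff.mp this
      simp [dt, this] at hz
    obtain ⟨j, hj, hden⟩ := denA x z hz i0 hxi0
    refine ⟨i0, j, hj, ?_⟩
    have hb : ∀ l, |(x l : ℝ)| ≤ |(x i0 : ℝ)| := fun l => by exact_mod_cast hi0 l (Finset.mem_univ _)
    have h1 : (1:ℝ) ≤ |(x i0 : ℝ)| := by exact_mod_cast Int.one_le_abs hxi0
    have h2 := hlio' (x 0) (x 1) (x 2) _ h1 (hb 0) (hb 1) (hb 2) (by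
      by_contra hcon; push Not at hcon
      simp [dt, hcon] at hz) hs
    set q : ℝ := (((x j : ℚ) / (x i0)).den : ℝ) with hq
    have h3 : |(x i0 : ℝ)| ≤ q ^ 2 := by rw [hq]; exact_mod_cast hden
    have hq0 : 0 ≤ q := by positivity
    apply hroot q hq0
    have h4 : Q ^ (1/4 : ℝ) ≤ (q ^ D) ^ 2 := by
      have : C * |(x i0 : ℝ)| ^ D ≤ Q ^ (1/4 : ℝ) * (q ^ D) ^ 2 := by
        rw [pow_right_comm]
        exact mul_le_mul (by linarith) (pow_le_pow_left₀ (abs_nonneg _) h3 _) (by positivity) hQq0.le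
      rw [← hQq] at h2
      exact le_of_mul_le_mul_left (h2.trans this) hQq0
    have h5 : Q ^ (1/4 : ℝ) = (Q ^ (1/8 : ℝ)) ^ 2 := by
      rw [← Real.rpow_natCast, ← Real.rpow_mul hQ0.le]; norm_num
    rw [h5] at h4
    exact le_of_pow_le_pow_left₀ two_ne_zero (by positivity) h4
  · intro y0 y1 hy0 hs
    obtain ⟨c, h1, h2⟩ := Rat.exists_eq_mul_div_num_and_eq_mul_div_den y1 hy0
    set q : ℕ := ((y1 : ℚ) / y0).den with hq
    set a : ℤ := ((y1 : ℚ) / y0).num with ha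
    have hc0 : c ≠ 0 := by rintro rfl; simp at h2; exact hy0 h2
    have hc1 : (1:ℝ) ≤ |(c:ℝ)| := by exact_mod_cast Int.one_le_abs hc0
    have hq1 : (1:ℝ) ≤ q := Nat.one_le_cast.mpr (Rat.den_pos ((y1 : ℚ) / y0))
    have h3 : (y1 - α * y0 : ℝ) = c * (a - α * q) := by
      rw [h1, h2]; push_cast; ring
    have h4 : |(a - α * q : ℝ)| ≤ Q ^ (-1/2 : ℝ) := by
      rw [h3, abs_mul] at hs
      have := abs_nonneg (a - α * q : ℝ)
      nlinarith
    have hle1 : Q ^ (-1/2 : ℝ) ≤ 1 := Real.rpow_le_one_of_one_le_of_nonpos hQ1 (by norm_num)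
    have h5 : |(a : ℝ)| ≤ (|α| + 1) * q := by
      have e2 := abs_add_le (a - α * q : ℝ) (α * q)
      rw [sub_add_cancel] at e2
      rw [abs_mul, abs_of_nonneg (by positivity : (0:ℝ) ≤ q)] at e2
      linarith
    have h6 : (q:ℝ) ≤ (|α| + 1) * q := by have := abs_nonneg α; nlinarith
    have h7 := hlio' a (-(q:ℤ)) 0 ((|α| + 1) * q) (hq1.trans h6) h5 (by push_cast; rw [abs_neg, abs_of_nonneg (by positivity)]; exact h6)
      (by simp; positivity) (Or.inr (Or.inl (by
        have : 0 < q := Rat.den_pos _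
        omega))) (by
        have : ((a:ℝ) + ((-(q:ℤ) : ℤ) : ℝ) * α + ((0:ℤ):ℝ) * α ^ 2) = a - α * q := by push_cast; ring
        rw [this]; exact h4)
    apply hroot q (by positivity)
    refine hQ84.trans ?_
    have : C * ((|α| + 1) * q) ^ D ≤ Q ^ (1/4 : ℝ) * (q:ℝ) ^ D := by
      rw [mul_pow, ← mul_assoc, ← hE]
      exact mul_le_mul_of_nonneg_right (by linarith) (by positivity)
    rw [← hQq] at h7
    exact le_of_mul_le_mul_left (h7.trans this) hQq0

end ST

namespace ST

theorem machine_Lp (α : ℝ) (halg : IsAlgebraic ℚ α) (c : Fin 3 → ℝ) (hc : ∑ i, c i < 0) (A : ℝ) (hA : 0 < A) :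
    ∀ᶠ Q : ℝ in atTop, ∀ i0 j0 : Fin 3, i0 ≠ j0 → ¬ Config (k := 2) (Lp α) c A i0 j0 Q := by
  refine machine_alg (k := 2) α halg (Lp α) ![![1,0,0],![0,1,0],![0,0,1]] ![![0,-1,0],![0,0,-2],![0,0,0]] ![![0,0,1],![0,0,0],![0,0,0]] ?_ c hc A hA
  rw [← Lp_inv α]
  congr 1
  ext i j; fin_cases i <;> fin_cases j <;> simp

theorem machine_Ld (α : ℝ) (halg : IsAlgebraic ℚ α) (c : Fin 3 → ℝ) (hc : ∑ i, c i < 0) (A : ℝ) (hA : 0 < A) :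
    ∀ᶠ Q : ℝ in atTop, ∀ i0 j0 : Fin 3, i0 ≠ j0 → ¬ Config (k := 2) (Ld α) c A i0 j0 Q := by
  refine machine_alg (k := 2) α halg (Ld α) ![![1,0,0],![0,1,0],![0,0,1]] ![![0,0,0],![1,0,0],![0,2,0]] ![![0,0,0],![0,0,0],![1,0,0]] ?_ c hc A hA
  rw [← Ld_inv α]
  congr 1
  ext i j; fin_cases i <;> fin_cases j <;> simp

lemma indep2 (y y1 P0 : Fin 3 → ℤ) (h : cr y y1 = P0) (hP : P0 ≠ 0) (s t : ℚ) (hv : ∀ l, s * y l + t * y1 l = 0) : s = 0 ∧ t = 0 := by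
  have key : ∀ l, s * P0 l = 0 ∧ t * P0 l = 0 := by
    intro l
    rw [← h]
    have h0 := hv 0
    have h1 := hv 1
    have h2 := hv 2
    fin_cases l <;> simp [-mul_eq_zero] <;> constructor
    · linear_combination y1 2 * h1 - y1 1 * h2
    · linear_combination - y 2 * h1 + y 1 * h2
    · linear_combination y1 0 * h2 - y1 2 * h0
    · linear_combination - y 0 * h2 + y 2 * h0
    · linear_combination y1 1 * h0 - y1 0 * h1
    · linear_combination - y 1 * h0 + y 0 * h1
  by_contra hcon
  apply hP
  funext l
  have := key l
  by_contra hl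
  have hl' : (P0 l : ℚ) ≠ 0 := by exact_mod_cast hl
  exact hcon ⟨(mul_eq_zero.mp this.1).resolve_right hl', (mul_eq_zero.mp this.2).resolve_right hl'⟩

set_option maxHeartbeats 1000000 in
theorem propT (α : ℝ) (halg : IsAlgebraic ℚ α)
    (hquad : ∀ b e c : ℤ, (b + e * α + c * α ^ 2 : ℝ) = 0 → b = 0 ∧ e = 0 ∧ c = 0) (ρ : ℝ) (hρ : 0 ≤ ρ) :
    ∀ᶠ Q : ℝ in atTop, ∃ y : Fin 3 → Fin 3 → ℤ, (∀ v : Fin 3 → ℚ, (∀ l, ∑ t, v t * y t l = 0) → v = 0) ∧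
      ∀ t, |(y t 0 : ℝ)| ≤ Q ^ (2 + 2 * ρ - 0.55 : ℝ) ∧ |(y t 1 - α * y t 0 : ℝ)| ≤ Q ^ (-0.55 : ℝ) ∧
        |(y t 2 - 2 * α * y t 1 + α ^ 2 * y t 0 : ℝ)| ≤ Q ^ (-(2 * ρ) - 0.55 : ℝ) := by
  obtain ⟨A, hA, hliou⟩ := liou_pack α halg hquad
  set w : Fin 3 → ℝ := ![-2 - 2 * ρ, 0, 2 * ρ] with hw
  have hwsum : w 0 + w 1 + w 2 = -2 := by simp [hw]
  have m1 := machine_Ld α halg (fun i => - w i + (-(2/3) - 0.01)) (by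
    rw [Fin.sum_univ_three]; linarith) A hA
  have m2 : ∀ i : Fin 3, ∀ᶠ Q : ℝ in atTop, ∀ i0 j0 : Fin 3, i0 ≠ j0 →
      ¬ Config (k := 2) (Lp α) (fun j => w j + (if j = i then 0.6 else 2/3 + 0.02)) A i0 j0 Q := by
    intro i
    refine machine_Lp α halg _ ?_ A hA
    rw [Fin.sum_univ_three]
    fin_cases i <;> simp <;> linarith
  have m2' := eventually_all.mpr m2
  filter_upwards [hliou, m1, m2', (tendsto_rpow_atTop (by norm_num : (0:ℝ) < 0.01)).eventually_ge_atTop 9, eventually_ge_atTop 1]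
    with Q hL hM1 hM2 hQ9 hQ1
  have hQ0 : 0 < Q := by linarith
  obtain ⟨P0, P2, y, y1, y2, i, hP0, hy0, hy2P, hi, hyP, hy1P, hP2y, hy1, hP2, hP2i, hlam, hη, hP2n, hyy1, hy1n, hy14, hy2n⟩ :=
    lat_alpha α (fun i => Q ^ w i) (fun i => Real.rpow_pos_of_pos hQ0 _)
  have hG : Q ^ w 0 * Q ^ w 1 * Q ^ w 2 = Q ^ (-2 : ℝ) := by
    rw [← Real.rpow_add hQ0, ← Real.rpow_add hQ0, hwsum]
  simp only [hG] at hP2n hy1n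
  set lam := ‖phi (Lp α) (fun i => Q ^ w i)⁻¹ P0‖ with hlamdef
  have rp : ∀ s t : ℝ, Q ^ s * Q ^ t = Q ^ (s + t) := fun s t => (Real.rpow_add hQ0 s t).symm
  have mono : ∀ {s t : ℝ}, s ≤ t → Q ^ s ≤ Q ^ t := fun h => Real.rpow_le_rpow_of_exponent_le hQ1 h
  have rpos : ∀ s : ℝ, 0 < Q ^ s := fun s => Real.rpow_pos_of_pos hQ0 _
  have conv1 : ∀ (z : Fin 3 → ℤ) (β : ℝ) (i : Fin 3), |phi (Ld α) (fun i => Q ^ w i) z i| ≤ Q ^ β → |∑ l, Ld α i l * z l| ≤ Q ^ (- w i + β) := by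
    intro z β i h
    have h1 : phi (Ld α) (fun i => Q ^ w i) z i = (∑ l, Ld α i l * z l) * Q ^ w i := rfl
    rw [h1, abs_mul, abs_of_pos (rpos _)] at h
    have h2 : |∑ l, Ld α i l * z l| = |∑ l, Ld α i l * z l| * Q ^ w i * Q ^ (- w i) := by
      rw [mul_assoc, rp, add_neg_cancel, Real.rpow_zero, mul_one]
    rw [h2, ← rp, mul_comm (Q ^ (- w i))]
    exact mul_le_mul_of_nonneg_right h (rpos _).le
  have conv2 : ∀ (z : Fin 3 → ℤ) (β : ℝ) (i : Fin 3), |phi (Lp α) (fun i => Q ^ w i)⁻¹ z i| ≤ Q ^ β → |∑ l, Lp α i l * z l| ≤ Q ^ (w i + β) := by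
    intro z β i h
    have h1 : phi (Lp α) (fun i => Q ^ w i)⁻¹ z i = (∑ l, Lp α i l * z l) * (Q ^ w i)⁻¹ := rfl
    rw [h1, abs_mul, abs_of_pos (inv_pos.mpr (rpos _))] at h
    have h2 : |∑ l, Lp α i l * z l| = |∑ l, Lp α i l * z l| * (Q ^ w i)⁻¹ * Q ^ (w i) := by
      rw [mul_assoc, inv_mul_cancel₀ (rpos _).ne', mul_one]
    rw [h2, ← rp, mul_comm (Q ^ (w i))]
    exact mul_le_mul_of_nonneg_right h (rpos _).le
  by_cases hcase : Q ^ (0.6 : ℝ) ≤ lam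
  · have hall : 9 / lam ≤ Q ^ (-0.55 : ℝ) := by
      rw [div_le_iff₀ hlam]
      calc (9:ℝ) ≤ Q ^ (0.01 : ℝ) := hQ9
        _ ≤ Q ^ (0.05 : ℝ) := mono (by norm_num)
        _ = Q ^ (-0.55 : ℝ) * Q ^ (0.6 : ℝ) := by rw [rp]; norm_num
        _ ≤ _ := by gcongr
    have h49 : 4 / lam ≤ 9 / lam := by gcongr; norm_num
    have hb : ∀ t, ‖phi (Ld α) (fun i => Q ^ w i) ((![y, y1, y2] : Fin 3 → Fin 3 → ℤ) t)‖ ≤ Q ^ (-0.55 : ℝ) := by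
      intro t; fin_cases t
      · exact (hyy1.trans hy14).trans (h49.trans hall)
      · exact hy14.trans (h49.trans hall)
      · exact hy2n.trans hall
    refine ⟨![y, y1, y2], ?_, ?_⟩
    · intro v hv
      simp only [Fin.sum_univ_three] at hv
      have hv' : ∀ l, v 0 * y l + v 1 * y1 l + v 2 * y2 l = 0 := hv
      have cP : ((y 0 : ℚ) * P0 0 + y 1 * P0 1 + y 2 * P0 2) = 0 := by simp only [dt] at hyP; exact_mod_cast hyP
      have cP1 : ((y1 0 : ℚ) * P0 0 + y1 1 * P0 1 + y1 2 * P0 2) = 0 := by simp only [dt] at hy1P; exact_mod_cast hy1P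
      have cP2 : ((y2 0 : ℚ) * P0 0 + y2 1 * P0 1 + y2 2 * P0 2) = 1 := by simp only [dt] at hy2P; exact_mod_cast hy2P
      have h2 : v 2 = 0 := by
        linear_combination P0 0 * hv' 0 + P0 1 * hv' 1 + P0 2 * hv' 2 - v 0 * cP - v 1 * cP1 - v 2 * cP2
      have h01 := indep2 y y1 P0 hy1 hP0 (v 0) (v 1) (fun l => by have := hv' l; rw [h2] at this; linarith)
      exact ext3 h01.1 h01.2 h2
    · intro t
      have h := fun i => conv1 _ (-0.55) i ((abs_le_norm3 _ i).trans (hb t))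
      generalize (![y, y1, y2] : Fin 3 → Fin 3 → ℤ) t = z at h
      have h0 := h 0
      have h1 := h 1
      have h2 := h 2
      simp [Fin.sum_univ_three, Ld, hw] at h0 h1 h2
      refine ⟨?_, ?_, ?_⟩
      · refine h0.trans (le_of_eq ?_); congr 1; ring
      · refine le_trans (le_of_eq ?_) (h1.trans (le_of_eq ?_))
        · congr 1; ring
        · norm_num
      · refine le_trans (le_of_eq ?_) (h2.trans (le_of_eq ?_))
        · congr 1; ring
        · congr 1
  · exfalso
    push Not at hcase
    -- dual machine
    have hp0 : ∀ j, |phi (Lp α) (fun i => Q ^ w i)⁻¹ P0 j| ≤ Q ^ (0.6 : ℝ) := fun j => (abs_le_norm3 _ j).trans hcase.le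
    have hP0α : |(P0 0 + P0 1 * α + P0 2 * α ^ 2 : ℝ)| ≤ Q ^ (-1/2 : ℝ) := by
      have := conv2 P0 0.6 0 (hp0 0)
      simp only [Fin.sum_univ_three, Lp, hw] at this
      refine le_trans (le_of_eq ?_) (this.trans (mono ?_))
      · congr 1; simp; ring
      · simp; linarith
    obtain ⟨i0, j0, hij, hden⟩ := hL.1 P0 y2 hy2P hP0α
    have hy1big : Q ^ (-(2/3) - 0.01 : ℝ) < ‖phi (Ld α) (fun i => Q ^ w i) y1‖ := by
      by_contra hcon
      push Not at hcon
      refine hM1 i0 j0 hij ⟨P0, ![y, y1], ?_, ?_, ?_, hden⟩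
      · intro v hv
        have := indep2 y y1 P0 hy1 hP0 (v 0) (v 1) (fun l => by have := hv l; simpa [Fin.sum_univ_two] using this)
        funext t; fin_cases t
        · exact this.1
        · exact this.2
      · intro t; rw [Fin.sum_univ_three]
        simp only [dt] at hyP hy1P
        fin_cases t
        · simp; linarith
        · simp; linarith
      · intro t i
        refine conv1 _ _ i ?_
        fin_cases t
        · exact (abs_le_norm3 _ i).trans (hyy1.trans hcon)
        · exact (abs_le_norm3 _ i).trans hcon
    set ny := ‖phi (Ld α) (fun i => Q ^ w i) y‖ with hny
    have hnyle : ny ≤ 2 * lam * Q ^ (-(4/3) + 0.01 : ℝ) := by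
      rw [le_div_iff₀ hη] at hy1n
      have h1 : Q ^ (-(2/3) - 0.01 : ℝ) * ny ≤ 2 * Q ^ (-2 : ℝ) * lam :=
        (mul_le_mul_of_nonneg_right hy1big.le hη.le).trans hy1n
      have h2 : Q ^ (-2 : ℝ) = Q ^ (-(2/3) - 0.01 : ℝ) * Q ^ (-(4/3) + 0.01 : ℝ) := by rw [rp]; norm_num
      rw [h2] at h1
      refine le_of_mul_le_mul_left (h1.trans (le_of_eq ?_)) (rpos (-(2/3) - 0.01 : ℝ))
      ring
    have hny7 : ny ≤ Q ^ (-0.7 : ℝ) := by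
      calc ny ≤ 2 * lam * Q ^ (-(4/3) + 0.01 : ℝ) := hnyle
        _ ≤ Q ^ (0.01 : ℝ) * Q ^ (0.6 : ℝ) * Q ^ (-(4/3) + 0.01 : ℝ) := by gcongr; linarith
        _ = Q ^ (0.01 + 0.6 + (-(4/3) + 0.01) : ℝ) := by rw [rp, rp]
        _ ≤ _ := mono (by norm_num)
    have hP2le : ‖phi (Lp α) (fun i => Q ^ w i)⁻¹ P2‖ ≤ Q ^ (2/3 + 0.02 : ℝ) := by
      refine hP2n.trans ?_
      rw [div_le_iff₀ (mul_pos (rpos _) hlam)]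
      calc 2 * ny ≤ 2 * (2 * lam * Q ^ (-(4/3) + 0.01 : ℝ)) := by gcongr
        _ = 4 * (Q ^ (-(4/3) + 0.01 : ℝ) * lam) := by ring
        _ ≤ Q ^ (0.01 : ℝ) * (Q ^ (-(4/3) + 0.01 : ℝ) * lam) := by gcongr; linarith
        _ = Q ^ (2/3 + 0.02 : ℝ) * (Q ^ (-2 : ℝ) * lam) := by
          rw [← mul_assoc, ← mul_assoc, rp, rp]; norm_num
    -- y has y 0 ≠ 0
    have hyc := fun i => conv1 y (-0.7) i ((abs_le_norm3 _ i).trans hny7)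
    have hd1 : |(y 1 - α * y 0 : ℝ)| ≤ Q ^ (-0.7 : ℝ) := by
      have := hyc 1
      simp [Fin.sum_univ_three, Ld, hw] at this
      refine le_trans (le_of_eq ?_) (this.trans (le_of_eq ?_))
      · congr 1; ring
      · norm_num
    have hd2 : |(y 2 - 2 * α * y 1 + α ^ 2 * y 0 : ℝ)| ≤ Q ^ (-0.7 : ℝ) := by
      have := hyc 2
      simp only [Fin.sum_univ_three, Ld, hw] at this
      refine le_trans (le_of_eq ?_) (this.trans (mono ?_))
      · congr 1; simp; ring
      · simp; linarith
    have hQlt : Q ^ (-0.7 : ℝ) < 1 := by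
      refine Real.rpow_lt_one_of_one_lt_of_neg ?_ (by norm_num)
      by_contra h
      have : Q = 1 := le_antisymm (not_lt.mp h) hQ1
      rw [this, Real.one_rpow] at hQ9
      norm_num at hQ9
    have hy00 : y 0 ≠ 0 := by
      intro h0
      rw [h0] at hd1 hd2
      have e1 : y 1 = 0 := by
        have : |(y 1 : ℝ)| < 1 := by refine lt_of_le_of_lt ?_ hQlt; simpa using hd1
        have : |y 1| < 1 := by exact_mod_cast this
        exact Int.abs_lt_one_iff.mp this
      rw [e1] at hd2
      have e2 : y 2 = 0 := by
        have : |(y 2 : ℝ)| < 1 := by refine lt_of_le_of_lt ?_ hQlt; simpa using hd2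
        have : |y 2| < 1 := by exact_mod_cast this
        exact Int.abs_lt_one_iff.mp this
      exact hy0 (ext3 h0 e1 e2)
    have hden2 := hL.2 (y 0) (y 1) hy00 (hd1.trans (mono (by norm_num)))
    refine hM2 i 0 1 (by decide) ⟨y, ![P0, P2], ?_, ?_, ?_, hden2⟩
    · intro v hv
      have := indep2 P2 P0 y hP2 hy0 (v 1) (v 0) (fun l => by have := hv l; simp [Fin.sum_univ_two] at this; linarith)
      funext t; fin_cases t
      · exact this.2
      · exact this.1
    · intro t; rw [Fin.sum_univ_three]
      simp only [dt] at hyP hP2y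
      fin_cases t
      · simp; linarith
      · simp; linarith
    · intro t j
      refine conv2 _ _ j ?_
      by_cases hji : j = i
      · rw [if_pos hji]
        fin_cases t
        · exact hp0 j
        · rw [hji]; refine hP2i.trans ?_
          linarith
      · rw [if_neg hji]
        fin_cases t
        · exact (hp0 j).trans (mono (by norm_num))
        · exact (abs_le_norm3 _ j).trans hP2le

end ST

namespace ST

section CF
variable (a : ℕ → ℕ)

lemma den_rec (n : ℕ) : cfDen a (n+2) = a (n + 2) * cfDen a (n + 1) + cfDen a n := rfl
lemma num_rec (n : ℕ) : cfNum a (n+2) = a (n + 2) * cfNum a (n + 1) + cfNum a n := rfl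

lemma den_pos (ha : ∀ n, 1 ≤ n → 1 ≤ a n) : ∀ n, 1 ≤ cfDen a n := by
  intro n
  induction n using Nat.twoStepInduction with
  | zero => exact le_rfl
  | one => exact ha 1 le_rfl
  | more n h0 h1 => rw [den_rec]; omega

lemma den_mono (ha : ∀ n, 1 ≤ n → 1 ≤ a n) : Monotone (cfDen a) := by
  refine monotone_nat_of_le_succ fun n => ?_
  cases n with
  | zero => exact ha 1 le_rfl
  | succ n =>
    rw [den_rec]
    have := ha (n+2) (by omega)
    nlinarith

lemma det_rec (n : ℕ) : (cfNum a (n+1) : ℝ) * cfDen a n - cfNum a n * cfDen a (n+1) = (-1) ^ n := by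
  induction n with
  | zero => simp [cfNum, cfDen]
  | succ n ih =>
    rw [den_rec, num_rec]; push_cast
    rw [pow_succ, ← ih]; ring

lemma D_bound (ha : ∀ n, 1 ≤ n → 1 ≤ a n) (n k : ℕ) :
    0 ≤ (-1:ℝ) ^ n * ((cfNum a (n+k) : ℝ) * cfDen a n - cfNum a n * cfDen a (n+k)) ∧
    (-1:ℝ) ^ n * ((cfNum a (n+k) : ℝ) * cfDen a n - cfNum a n * cfDen a (n+k)) * cfDen a (n+1) ≤ cfDen a (n+k) := by
  induction k using Nat.twoStepInduction with
  | zero => simp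
  | one =>
    rw [det_rec]
    have : (-1:ℝ) ^ n * (-1) ^ n = 1 := by rw [← mul_pow]; norm_num
    rw [this]; simp
  | more k h0 h1 =>
    have e1 : n + (k + 2) = (n + k) + 2 := by ring
    have e2 : n + (k + 1) = (n + k) + 1 := by ring
    rw [e2] at h1
    rw [e1, den_rec, num_rec]; push_cast
    set A : ℝ := ((a (n + k + 2) : ℕ) : ℝ)
    have hA : 0 ≤ A := by positivity
    have e : (-1:ℝ) ^ n * ((A * cfNum a (n+k+1) + cfNum a (n+k)) * cfDen a n - cfNum a n * (A * cfDen a (n+k+1) + cfDen a (n+k))) =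
      A * ((-1:ℝ) ^ n * ((cfNum a (n+k+1) : ℝ) * cfDen a n - cfNum a n * cfDen a (n+k+1))) +
      (-1:ℝ) ^ n * ((cfNum a (n+k) : ℝ) * cfDen a n - cfNum a n * cfDen a (n+k)) := by ring
    rw [e]
    constructor
    · exact add_nonneg (mul_nonneg hA h1.1) h0.1
    · rw [add_mul, mul_assoc]
      exact add_le_add (mul_le_mul_of_nonneg_left h1.2 hA) h0.2

/-- the small quantity -/
noncomputable def del (α : ℝ) (n : ℕ) : ℝ := α * cfDen a n - cfNum a n

lemma del_rec (α : ℝ) (n : ℕ) : del a α (n+2) = a (n+2) * del a α (n+1) + del a α n := by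
  simp only [del]; rw [den_rec, num_rec]; push_cast; ring

variable {a}
lemma del_bound (ha : ∀ n, 1 ≤ n → 1 ≤ a n) (α : ℝ)
    (hα : Tendsto (fun n => (cfNum a n : ℝ) / cfDen a n) atTop (𝓝 α)) (n : ℕ) :
    0 ≤ (-1:ℝ) ^ n * del a α n ∧ (-1:ℝ) ^ n * del a α n * cfDen a (n+1) ≤ 1 := by
  have h1 : Tendsto (fun k => (-1:ℝ) ^ n * ((cfNum a (k+n) : ℝ) / cfDen a (k+n) * cfDen a n - cfNum a n)) atTop
      (𝓝 ((-1:ℝ) ^ n * del a α n)) := by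
    simp only [del]
    exact (((hα.comp (tendsto_add_atTop_nat n)).mul_const _).sub_const _).const_mul _
  have h2 : ∀ k, (-1:ℝ) ^ n * ((cfNum a (k+n) : ℝ) / cfDen a (k+n) * cfDen a n - cfNum a n) =
      (-1:ℝ) ^ n * ((cfNum a (n+k) : ℝ) * cfDen a n - cfNum a n * cfDen a (n+k)) / cfDen a (n+k) := by
    intro k
    rw [add_comm k n]
    have : (cfDen a (n+k) : ℝ) ≠ 0 := by have := den_pos a ha (n+k); positivity
    field_simp
  have hp : ∀ k, (0:ℝ) < cfDen a k := fun k => by exact_mod_cast den_pos a ha k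
  constructor
  · refine ge_of_tendsto' h1 fun k => ?_
    rw [h2]; exact div_nonneg (D_bound a ha n k).1 (hp _).le
  · refine le_of_tendsto' (h1.mul_const _) fun k => ?_
    rw [h2, div_mul_eq_mul_div, div_le_one (hp _)]
    exact (D_bound a ha n k).2

lemma abs_del (ha : ∀ n, 1 ≤ n → 1 ≤ a n) (α : ℝ)
    (hα : Tendsto (fun n => (cfNum a n : ℝ) / cfDen a n) atTop (𝓝 α)) (n : ℕ) :
    |del a α n| * cfDen a (n+1) ≤ 1 := by
  have h := del_bound ha α hα n
  have : |del a α n| = (-1:ℝ) ^ n * del a α n := by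
    rw [← abs_of_nonneg h.1, abs_mul, abs_pow]; simp
  rw [this]; exact h.2

lemma del_pos (ha : ∀ n, 1 ≤ n → 1 ≤ a n) (α : ℝ)
    (hα : Tendsto (fun n => (cfNum a n : ℝ) / cfDen a n) atTop (𝓝 α)) (n : ℕ) : 0 < (-1:ℝ) ^ n * del a α n := by
  rcases (del_bound ha α hα n).1.lt_or_eq with h | h
  · exact h
  exfalso
  have h0 : del a α n = 0 := by
    rcases mul_eq_zero.mp h.symm with h | h
    · exact absurd h (pow_ne_zero _ (by norm_num))
    · exact h
  have h1 := (del_bound ha α hα (n+1)).1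
  have h2 := (del_bound ha α hα (n+2)).1
  have h3 := (del_bound ha α hα (n+3)).1
  have hs2 : del a α (n+2) = a (n+2) * del a α (n+1) := by rw [del_rec, h0, add_zero]
  have ha2 : (1:ℝ) ≤ a (n+2) := by exact_mod_cast ha (n+2) (by omega)
  have h4 : (-1:ℝ) ^ (n+1) * del a α (n+1) = 0 := by
    rw [hs2] at h2
    have e : (-1:ℝ) ^ (n+2) * (a (n+2) * del a α (n+1)) = - (a (n+2) * ((-1:ℝ) ^ (n+1) * del a α (n+1))) := by ring
    rw [e] at h2
    nlinarith
  have h5 : del a α (n+1) = 0 := by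
    rcases mul_eq_zero.mp h4 with h | h
    · exact absurd h (pow_ne_zero _ (by norm_num))
    · exact h
  have hd := det_rec a n
  simp only [del] at h0 h5
  have : ((-1:ℝ)) ^ n = 0 := by rw [← hd]; linear_combination - (cfDen a n : ℝ) * h5 + cfDen a (n+1) * h0
  exact pow_ne_zero _ (by norm_num) this

theorem lagrange (ha : ∀ n, 1 ≤ n → 1 ≤ a n) (α : ℝ)
    (hα : Tendsto (fun n => (cfNum a n : ℝ) / cfDen a n) atTop (𝓝 α)) (hnp : ¬ EventuallyPeriodic a)
    (b e c : ℤ) (hq : (b + e * α + c * α ^ 2 : ℝ) = 0) : b = 0 ∧ e = 0 ∧ c = 0 := by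
  by_contra hne
  have hpos := del_pos ha α hα
  have hd0 : ∀ n, del a α n ≠ 0 := fun n h => by have := hpos n; rw [h, mul_zero] at this; exact lt_irrefl _ this
  -- complete quotients
  set t : ℕ → ℝ := fun n => - del a α n / del a α (n+1) with ht
  have htpos : ∀ n, 0 < t n := by
    intro n
    have h1 := hpos n
    have h2 := hpos (n+1)
    have : t n = ((-1:ℝ) ^ n * del a α n) / ((-1:ℝ) ^ (n+1) * del a α (n+1)) := by
      simp only [ht]; rw [pow_succ]
      have := hd0 (n+1)
      have h3 : (-1:ℝ) ^ n ≠ 0 := pow_ne_zero _ (by norm_num)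
      field_simp
    rw [this]; exact div_pos h1 h2
  have htrec : ∀ n, t n = a (n+2) + 1 / t (n+1) := by
    intro n
    have h1 := hd0 n
    have h2 := hd0 (n+1)
    have h3 := hd0 (n+2)
    have e1 : 1 / t (n+1) = - del a α (n+2) / del a α (n+1) := by
      simp only [ht]; rw [one_div, inv_div, div_neg, neg_div]
    rw [e1, del_rec]; simp only [ht]; field_simp; ring
  have ht1 : ∀ n, 1 < t n := by
    intro n
    rw [htrec]
    have : (1:ℝ) ≤ a (n+2) := by exact_mod_cast ha (n+2) (by omega)
    have := one_div_pos.mpr (htpos (n+1))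
    linarith
  have hinv : ∀ n, 0 < 1 / t (n+1) ∧ 1 / t (n+1) < 1 := fun n =>
    ⟨one_div_pos.mpr (htpos _), by rw [div_lt_one (htpos _)]; exact ht1 _⟩
  have hstep : ∀ m n, t m = t n → a (m+2) = a (n+2) ∧ t (m+1) = t (n+1) := by
    intro m n h
    rw [htrec m, htrec n] at h
    have h1 := hinv m
    have h2 := hinv n
    have h3 : a (m+2) = a (n+2) := by
      rcases lt_trichotomy (a (m+2)) (a (n+2)) with h4 | h4 | h4
      · have : (a (m+2) : ℝ) + 1 ≤ a (n+2) := by exact_mod_cast h4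
        linarith
      · exact h4
      · have : (a (n+2) : ℝ) + 1 ≤ a (m+2) := by exact_mod_cast h4
        linarith
    refine ⟨h3, ?_⟩
    rw [h3] at h
    have h5 : 1 / t (m+1) = 1 / t (n+1) := by linarith
    rw [one_div, one_div] at h5
    exact inv_injective h5
  have hinj : ∀ m n, m < n → t m ≠ t n := by
    intro m n hmn h
    apply hnp
    have hall : ∀ k, t (m+k) = t (n+k) := by
      intro k
      induction k with
      | zero => exact h
      | succ k ih => exact (hstep _ _ ih).2
    refine ⟨m+2, n - m, by omega, fun k hk => ?_⟩
    have := (hstep _ _ (hall (k - (m+2)))).1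
    have e1 : m + (k - (m+2)) + 2 = k := by omega
    have e2 : n + (k - (m+2)) + 2 = k + (n - m) := by omega
    rw [e1, e2] at this
    exact this.symm
  -- the forms
  set F : ℕ → ℤ := fun n => c * cfNum a n ^ 2 + e * cfNum a n * cfDen a n + b * cfDen a n ^ 2 with hF
  set B : ℕ → ℤ := fun n => 2 * c * cfNum a (n+1) * cfNum a n + e * (cfNum a (n+1) * cfDen a n + cfNum a n * cfDen a (n+1)) +
    2 * b * cfDen a (n+1) * cfDen a n with hB
  have hroot : ∀ n, (F (n+1) : ℝ) * t n ^ 2 + B n * t n + F n = 0 := by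
    intro n
    have h2 := hd0 (n+1)
    have hdel1 : del a α (n+1) = α * cfDen a (n+1) - cfNum a (n+1) := rfl
    have hdel0 : del a α n = α * cfDen a n - cfNum a n := rfl
    have key : (F (n+1) : ℝ) * del a α n ^ 2 - B n * del a α n * del a α (n+1) + F n * del a α (n+1) ^ 2 = 0 := by
      simp only [hF, hB]; push_cast
      rw [hdel1, hdel0]
      linear_combination ((cfNum a (n+1) * cfDen a n - cfNum a n * cfDen a (n+1) : ℝ)) ^ 2 * hq
    have : (F (n+1) : ℝ) * t n ^ 2 + B n * t n + F n = ((F (n+1) : ℝ) * del a α n ^ 2 - B n * del a α n * del a α (n+1) + F n * del a α (n+1) ^ 2) / del a α (n+1) ^ 2 := by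
      simp only [ht]; field_simp; ring
    rw [this, key, zero_div]
  set K : ℝ := 4 * (|2 * c * α + e| + |(c:ℝ)|) with hK
  have hab := abs_del ha α hα
  have hq1 : ∀ n, (1:ℝ) ≤ cfDen a n := fun n => by exact_mod_cast den_pos a ha n
  have hqm : ∀ n, (cfDen a n : ℝ) ≤ cfDen a (n+1) := fun n => by exact_mod_cast den_mono a ha (Nat.le_succ n)
  have hdle : ∀ n, |del a α n| ≤ 1 := by
    intro n
    have h1 := hab n; have h2 := hq1 (n+1); have := abs_nonneg (del a α n); nlinarith
  have hdq : ∀ n, |del a α n * cfDen a n| ≤ 1 := by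
    intro n
    rw [abs_mul, abs_of_nonneg (by positivity : (0:ℝ) ≤ cfDen a n)]
    exact (mul_le_mul_of_nonneg_left (hqm n) (abs_nonneg _)).trans (hab n)
  have hdq' : ∀ n, |del a α n * cfDen a (n+1)| ≤ 1 := by
    intro n
    rw [abs_mul, abs_of_nonneg (by positivity : (0:ℝ) ≤ cfDen a (n+1))]
    exact hab n
  have hdq'' : ∀ n, |del a α (n+1) * cfDen a n| ≤ 1 := by
    intro n
    rw [abs_mul, abs_of_nonneg (by positivity : (0:ℝ) ≤ cfDen a n)]
    exact (mul_le_mul_of_nonneg_left ((hqm n).trans (hqm (n+1))) (abs_nonneg _)).trans (hab (n+1))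
  have gen : ∀ (x y : ℝ) , |x| ≤ 2 → |y| ≤ 2 → |-(2 * c * α + e) * x + c * y| ≤ K := by
    intro x y hx hy
    refine (abs_add_le _ _).trans ?_
    rw [abs_mul, abs_mul, abs_neg, hK]
    have := abs_nonneg (2 * c * α + e : ℝ); have := abs_nonneg (c:ℝ)
    nlinarith
  have hFb : ∀ n, |(F n : ℝ)| ≤ K := by
    intro n
    have : (F n : ℝ) = -(2 * c * α + e) * (del a α n * cfDen a n) + c * (del a α n * del a α n) := by
      simp only [hF, del]; push_cast
      linear_combination (cfDen a n : ℝ) ^ 2 * hq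
    rw [this]
    refine gen _ _ (by linarith [hdq n]) ?_
    rw [abs_mul]
    have h1 := hdle n; have := abs_nonneg (del a α n); nlinarith
  have hBb : ∀ n, |(B n : ℝ)| ≤ K := by
    intro n
    have : (B n : ℝ) = -(2 * c * α + e) * (del a α n * cfDen a (n+1) + del a α (n+1) * cfDen a n) + c * (2 * (del a α n * del a α (n+1))) := by
      simp only [hB, del]; push_cast
      linear_combination 2 * (cfDen a n : ℝ) * cfDen a (n+1) * hq
    rw [this]
    refine gen _ _ ((abs_add_le _ _).trans (by linarith [hdq' n, hdq'' n])) ?_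
    rw [abs_mul, abs_mul, abs_two]
    have h1 := hdle n; have := abs_nonneg (del a α n); have h2 := hdle (n+1); have := abs_nonneg (del a α (n+1))
    have : |del a α n| * |del a α (n+1)| ≤ 1 * 1 := mul_le_mul h1 h2 (abs_nonneg _) zero_le_one
    linarith
  set m : ℤ := ⌈K⌉ with hm
  have tr : ∀ z : ℤ, |(z:ℝ)| ≤ K → z ∈ Set.Icc (-m) m := by
    intro z hz
    have h1 : |(z:ℝ)| ≤ m := hz.trans (Int.le_ceil K)
    have h2 : |z| ≤ m := by exact_mod_cast h1
    exact abs_le.mp h2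
  let g : ℕ → (Set.Icc (-m) m × Set.Icc (-m) m × Set.Icc (-m) m) := fun n =>
    (⟨F (n+1), tr _ (hFb _)⟩, ⟨B n, tr _ (hBb _)⟩, ⟨F n, tr _ (hFb _)⟩)
  obtain ⟨yv, hyv⟩ := Finite.exists_infinite_fiber g
  have hinf : (g ⁻¹' {yv}).Infinite := Set.infinite_coe_iff.mp hyv
  obtain ⟨n1, hn1⟩ := hinf.nonempty
  obtain ⟨n2, hn2, h12⟩ := hinf.exists_gt n1
  obtain ⟨n3, hn3, h23⟩ := hinf.exists_gt n2
  have same : ∀ n n', g n = yv → g n' = yv → F (n+1) = F (n'+1) ∧ B n = B n' ∧ F n = F n' := by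
    intro n n' h h'
    have h := h.trans h'.symm
    simp only [g, Prod.mk.injEq, Subtype.mk.injEq] at h
    exact h
  have s2 := same n2 n1 hn2 hn1
  have s3 := same n3 n1 hn3 hn1
  have r1 := hroot n1
  have r2 := hroot n2
  have r3 := hroot n3
  rw [s2.1, s2.2.1, s2.2.2] at r2
  rw [s3.1, s3.2.1, s3.2.2] at r3
  have d12 : t n1 - t n2 ≠ 0 := sub_ne_zero.mpr (hinj _ _ h12)
  have d13 : t n1 - t n3 ≠ 0 := sub_ne_zero.mpr (hinj _ _ (h12.trans h23))
  have d23 : t n2 - t n3 ≠ 0 := sub_ne_zero.mpr (hinj _ _ h23)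
  have l12 : (F (n1+1) : ℝ) * (t n1 + t n2) + B n1 = 0 :=
    mul_left_cancel₀ d12 (by linear_combination r1 - r2)
  have l13 : (F (n1+1) : ℝ) * (t n1 + t n3) + B n1 = 0 :=
    mul_left_cancel₀ d13 (by linear_combination r1 - r3)
  have hA0 : (F (n1+1) : ℝ) = 0 := mul_left_cancel₀ d23 (by linear_combination l12 - l13)
  have hB0 : (B n1 : ℝ) = 0 := by rw [hA0] at l12; linarith
  have hC0 : (F n1 : ℝ) = 0 := by rw [hA0, hB0] at r1; linarith
  have hD := det_rec a n1
  have hD2 : ((cfNum a (n1+1) : ℝ) * cfDen a n1 - cfNum a n1 * cfDen a (n1+1)) ^ 2 = 1 := by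
    rw [hD, ← pow_mul, mul_comm, pow_mul]; norm_num
  simp only [hF, hB] at hA0 hB0 hC0
  push_cast at hA0 hB0 hC0
  apply hne
  refine ⟨?_, ?_, ?_⟩
  · have : (b:ℝ) = 0 := by
      linear_combination (cfNum a n1 : ℝ) ^ 2 * hA0 - (cfNum a n1 : ℝ) * cfNum a (n1+1) * hB0 + (cfNum a (n1+1) : ℝ) ^ 2 * hC0 - (b:ℝ) * hD2
    exact_mod_cast this
  · have : (e:ℝ) = 0 := by
      linear_combination -2 * (cfNum a n1 : ℝ) * cfDen a n1 * hA0 + ((cfNum a n1 : ℝ) * cfDen a (n1+1) + cfDen a n1 * cfNum a (n1+1)) * hB0 - 2 * (cfNum a (n1+1) : ℝ) * cfDen a (n1+1) * hC0 - (e:ℝ) * hD2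
    exact_mod_cast this
  · have : (c:ℝ) = 0 := by
      linear_combination (cfDen a n1 : ℝ) ^ 2 * hA0 - (cfDen a n1 : ℝ) * cfDen a (n1+1) * hB0 + (cfDen a (n1+1) : ℝ) ^ 2 * hC0 - (c:ℝ) * hD2
    exact_mod_cast this

end CF
end ST

namespace ST

/-- elementary generator -/
def Gm (x : ℕ) : Matrix (Fin 2) (Fin 2) ℤ := !![(x : ℤ), 1; 1, 0]

/-- product matrix of a word -/
def ML (l : List ℕ) : Matrix (Fin 2) (Fin 2) ℤ := (l.map Gm).prod

lemma ML_append (l m : List ℕ) : ML (l ++ m) = ML l * ML m := by simp [ML]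

lemma Gm_T (x : ℕ) : (Gm x).transpose = Gm x := by
  ext i j; fin_cases i <;> fin_cases j <;> simp [Gm]

lemma ML_reverse (l : List ℕ) : ML l.reverse = (ML l).transpose := by
  induction l with
  | nil => simp [ML]
  | cons x l ih =>
    rw [List.reverse_cons, ML_append, ih]
    have : ML (x :: l) = Gm x * ML l := by simp [ML]
    rw [this, Matrix.transpose_mul, Gm_T]
    simp [ML]

/-- second column -/
def cq (a : ℕ → ℕ) : ℕ → ℕ
  | 0 => 0
  | n+1 => cfDen a n
/-- second column -/
def cp (a : ℕ → ℕ) : ℕ → ℕ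
  | 0 => 1
  | n+1 => cfNum a n

/-- convergent matrix -/
def Mx (a : ℕ → ℕ) (n : ℕ) : Matrix (Fin 2) (Fin 2) ℤ := !![(cfDen a n : ℤ), (cq a n : ℤ); (cfNum a n : ℤ), (cp a n : ℤ)]

lemma Mx_succ (a : ℕ → ℕ) (n : ℕ) : Mx a (n+1) = Mx a n * Gm (a (n+1)) := by
  cases n with
  | zero => ext i j; fin_cases i <;> fin_cases j <;> simp [Mx, Gm, cq, cp, cfDen, cfNum]
  | succ n =>
    ext i j; fin_cases i <;> fin_cases j <;> simp [Mx, Gm, cq, cp, cfDen, cfNum] <;> ring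

lemma Mx_zero (a : ℕ → ℕ) : Mx a 0 = 1 := by
  ext i j; fin_cases i <;> fin_cases j <;> simp [Mx, cq, cp, cfDen, cfNum]

lemma initial_of_append {l m : List ℕ} {a : ℕ → ℕ} (h : IsPrefixOfSeq (l ++ m) a) : IsPrefixOfSeq l a := by
  intro i hi
  have := h i (by rw [List.length_append]; omega)
  rwa [List.getD_append _ _ _ _ hi] at this

lemma ML_eq_Mx {a : ℕ → ℕ} (l : List ℕ) (h : IsPrefixOfSeq l a) : ML l = Mx a l.length := by
  induction l using List.reverseRecOn with
  | nil => rw [List.length_nil, Mx_zero]; simp [ML]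
  | append_singleton l x ih =>
    have h1 := ih (initial_of_append h)
    have h2 := h l.length (by simp)
    rw [ML_append, h1, List.length_append, List.length_singleton, Mx_succ]
    have : x = a (l.length + 1) := by
      rw [← h2]; simp
    rw [← this]; simp [ML]

lemma Mx_det (a : ℕ → ℕ) (n : ℕ) : (Mx a n).det = 1 ∨ (Mx a n).det = -1 := by
  induction n with
  | zero => left; rw [Mx_zero]; simp
  | succ n ih =>
    rw [Mx_succ, Matrix.det_mul]
    have : (Gm (a (n+1))).det = -1 := by simp [Gm, Matrix.det_fin_two]
    rw [this]
    rcases ih with h | h <;> rw [h] <;> simp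

lemma cq_le {a : ℕ → ℕ} (ha : ∀ n, 1 ≤ n → 1 ≤ a n) (n : ℕ) : (cq a n : ℝ) ≤ cfDen a n := by
  cases n with
  | zero => simp [cq]
  | succ n => simp only [cq]; exact_mod_cast den_mono a ha (Nat.le_succ n)

lemma del_le {a : ℕ → ℕ} (ha : ∀ n, 1 ≤ n → 1 ≤ a n) (α : ℝ)
    (hα : Tendsto (fun n => (cfNum a n : ℝ) / cfDen a n) atTop (𝓝 α)) (n : ℕ) :
    |α * cfDen a n - cfNum a n| ≤ 1 / cfDen a n ∧ |α * cq a n - cp a n| ≤ 1 / cfDen a n := by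
  have hq : ∀ n, (0:ℝ) < cfDen a n := fun n => by exact_mod_cast den_pos a ha n
  constructor
  · rw [le_div_iff₀ (hq n)]
    have h1 := abs_del ha α hα n
    have h2 : (cfDen a n : ℝ) ≤ cfDen a (n+1) := by exact_mod_cast den_mono a ha (Nat.le_succ n)
    exact (mul_le_mul_of_nonneg_left h2 (abs_nonneg _)).trans h1
  · cases n with
    | zero => simp [cq, cp, cfDen]
    | succ n =>
      rw [le_div_iff₀ (hq _)]
      exact abs_del ha α hα n

lemma two_prod {x y z w A B : ℝ} (hx : |x| ≤ A) (hy : |y| ≤ A) (hz : |z| ≤ B) (hw : |w| ≤ B) :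
    |x * z + y * w| ≤ 2 * (A * B) := by
  have hA : 0 ≤ A := (abs_nonneg _).trans hx
  refine (abs_add_le _ _).trans ?_
  rw [abs_mul, abs_mul]
  have := mul_le_mul hx hz (abs_nonneg _) hA
  have := mul_le_mul hy hw (abs_nonneg _) hA
  linarith

theorem structN {a : ℕ → ℕ} (ha : ∀ n, 1 ≤ n → 1 ≤ a n) (α : ℝ)
    (hα : Tendsto (fun n => (cfNum a n : ℝ) / cfDen a n) atTop (𝓝 α)) (U V W : List ℕ)
    (h : IsPrefixOfSeq (W ++ U ++ V ++ U.reverse) a) (r u v : ℕ) (hr : W.length = r) (hu : U.length = u) (hv : V.length = v) :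
    ∃ m11 m12 m21 m22 : ℤ, (m11 * m22 - m12 * m21 = 1 ∨ m11 * m22 - m12 * m21 = -1) ∧
      |(α ^ 2 * m11 - α * m12 - α * m21 + m22 : ℝ)| ≤ 2 * (1 / cfDen a (r + u + v + u) * (1 / cfDen a r)) ∧
      |(α * m11 - m21 : ℝ)| ≤ 2 * (1 / cfDen a (r + u + v + u) * cfDen a r) ∧
      |(α * m11 - m12 : ℝ)| ≤ 2 * (cfDen a (r + u + v) * (1 / cfDen a (r + u))) ∧
      |(m11 : ℝ)| ≤ 2 * (cfDen a (r + u + v + u) * cfDen a r) ∧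
      (cfDen a (r + u + v + u) : ℤ) ≤ m11 := by
  have p3 := initial_of_append h
  have p2 := initial_of_append p3
  have p1 := initial_of_append p2
  have e4 := ML_eq_Mx _ h
  have e3 := ML_eq_Mx _ p3
  have e2 := ML_eq_Mx _ p2
  have e1 := ML_eq_Mx _ p1
  simp only [List.length_append, List.length_reverse, hr, hu, hv] at e4 e3 e2 e1
  rw [ML_append, ML_reverse, e3] at e4
  rw [ML_append, e1] at e2
  have key : Mx a (r + u + v + u) * (Mx a r).transpose = Mx a (r + u + v) * (Mx a (r + u)).transpose := by
    rw [← e4, ← e2, Matrix.transpose_mul, Matrix.mul_assoc]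
  set n := r + u + v + u
  set m := r + u + v
  set k := r + u
  have hq : ∀ n, (0:ℝ) < cfDen a n := fun n => by exact_mod_cast den_pos a ha n
  have hcq : ∀ n, |(cq a n : ℝ)| ≤ cfDen a n := fun n => by
    rw [abs_of_nonneg (by positivity)]; exact cq_le ha n
  have hqq : ∀ n, |(cfDen a n : ℝ)| ≤ cfDen a n := fun n => by
    rw [abs_of_nonneg (by positivity)]
  have hd := del_le ha α hα
  have k00 := congrFun (congrFun key 0) 0
  have k01 := congrFun (congrFun key 0) 1
  have k10 := congrFun (congrFun key 1) 0
  have k11 := congrFun (congrFun key 1) 1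
  have hdet : (Mx a n * (Mx a r).transpose).det = 1 ∨ (Mx a n * (Mx a r).transpose).det = -1 := by
    rw [Matrix.det_mul, Matrix.det_transpose]
    rcases Mx_det a n with h | h <;> rcases Mx_det a r with h' | h' <;> rw [h, h'] <;> simp
  rw [Matrix.det_fin_two] at hdet
  simp [Mx, Matrix.mul_apply, Fin.sum_univ_two] at k00 k01 k10 k11 hdet
  refine ⟨cfDen a n * cfDen a r + cq a n * cq a r, cfDen a n * cfNum a r + cq a n * cp a r,
    cfNum a n * cfDen a r + cp a n * cq a r, cfNum a n * cfNum a r + cp a n * cp a r, hdet, ?_, ?_, ?_, ?_, ?_⟩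
  · convert two_prod (hd n).1 (hd n).2 (hd r).1 (hd r).2 using 2
    push_cast; ring
  · convert two_prod (hd n).1 (hd n).2 (hqq r) (hcq r) using 2
    push_cast; ring
  · rw [k00, k01]
    convert two_prod (hqq m) (hcq m) (hd k).1 (hd k).2 using 2
    push_cast; ring
  · convert two_prod (hqq n) (hcq n) (hqq r) (hcq r) using 2
    push_cast; ring
  · have h1 : (1:ℤ) ≤ cfDen a r := by exact_mod_cast den_pos a ha r
    have h2 : (1:ℤ) ≤ cfDen a n := by exact_mod_cast den_pos a ha n
    have : (0:ℤ) ≤ cq a n * cq a r := by positivity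
    nlinarith

lemma den_pow {a : ℕ → ℕ} (ha : ∀ n, 1 ≤ n → 1 ≤ a n) (n : ℕ) : 2 ^ n ≤ cfDen a (2 * n) := by
  induction n with
  | zero => simp [cfDen]
  | succ n ih =>
    rw [show 2 * (n+1) = 2 * n + 2 by ring, den_rec, pow_succ]
    have h1 := ha (2*n+2) (by omega)
    have h2 := den_mono a ha (Nat.le_succ (2*n))
    simp only [Nat.succ_eq_add_one] at h2
    nlinarith

theorem growth {a : ℕ → ℕ} (ha : ∀ n, 1 ≤ n → 1 ≤ a n)
    (hconv : ∃ L : ℝ, Tendsto (fun ℓ : ℕ => (cfDen a ℓ : ℝ) ^ (1 / (ℓ : ℝ))) atTop (𝓝 L)) :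
    ∃ Λ : ℝ, 0 < Λ ∧ Tendsto (fun ℓ : ℕ => Real.log (cfDen a ℓ) / ℓ) atTop (𝓝 Λ) := by
  obtain ⟨L, hL⟩ := hconv
  have hq : ∀ n, (0:ℝ) < cfDen a n := fun n => by exact_mod_cast den_pos a ha n
  have h2 : (2:ℝ) ^ (1/2 : ℝ) ≤ L := by
    have ht : Tendsto (fun n : ℕ => 2 * n) atTop atTop := tendsto_id.const_mul_atTop' (by norm_num)
    refine ge_of_tendsto (hL.comp ht) ?_
    filter_upwards [eventually_ge_atTop 1] with n hn
    have hn' : (0:ℝ) < n := by exact_mod_cast hn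
    have h1 : ((2:ℝ) ^ n) ≤ cfDen a (2*n) := by exact_mod_cast den_pow ha n
    have e : (2:ℝ) ^ (1/2 : ℝ) = ((2:ℝ) ^ n) ^ (1 / ((2 * n : ℕ) : ℝ)) := by
      rw [← Real.rpow_natCast, ← Real.rpow_mul (by norm_num)]
      congr 1; push_cast; field_simp
    simp only [Function.comp]
    rw [e]
    exact Real.rpow_le_rpow (by positivity) h1 (by positivity)
  have h3 : (1:ℝ) < L := lt_of_lt_of_le (Real.one_lt_rpow (by norm_num) (by norm_num)) h2
  refine ⟨Real.log L, Real.log_pos h3, ?_⟩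
  have := hL.log (by linarith)
  refine this.congr fun n => ?_
  rw [Real.log_rpow (hq n)]; ring

theorem growth_sub {a : ℕ → ℕ} {Λ : ℝ} 
    (hΛ : Tendsto (fun ℓ : ℕ => Real.log (cfDen a ℓ) / ℓ) atTop (𝓝 Λ)) (k u : ℕ → ℕ) (κ : ℝ)
    (hu : Tendsto u atTop atTop) (hk : Tendsto (fun n => (k n : ℝ) / u n) atTop (𝓝 κ)) :
    Tendsto (fun n => Real.log (cfDen a (k n)) / u n) atTop (𝓝 (Λ * κ)) := by
  have hbd : ∀ ε > 0, ∃ C : ℝ, ∀ l : ℕ, |Real.log (cfDen a l) - Λ * l| ≤ ε * l + C := by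
    intro ε hε
    obtain ⟨n0, hn0⟩ := Metric.tendsto_atTop.mp hΛ ε hε
    refine ⟨∑ l ∈ Finset.range n0, |Real.log (cfDen a l) - Λ * l| + |Real.log (cfDen a 0) - Λ * (0:ℕ)|, fun l => ?_⟩
    have hs : 0 ≤ ∑ l ∈ Finset.range n0, |Real.log (cfDen a l) - Λ * l| := Finset.sum_nonneg fun _ _ => abs_nonneg _
    by_cases hl : l < n0
    · have := Finset.single_le_sum (f := fun l : ℕ => |Real.log (cfDen a l) - Λ * l|) (fun _ _ => abs_nonneg _) (Finset.mem_range.mpr hl)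
      have h1 : 0 ≤ ε * l := by positivity
      have h2 := abs_nonneg (Real.log (cfDen a 0) - Λ * (0:ℕ))
      linarith
    · rcases Nat.eq_zero_or_pos l with h0 | h0
      · subst h0
        have h1 : 0 ≤ ε * ((0:ℕ):ℝ) := by positivity
        linarith
      have h0' : (0:ℝ) < l := by exact_mod_cast h0
      have h1 := hn0 l (not_lt.mp hl)
      rw [Real.dist_eq] at h1
      have e : Real.log (cfDen a l) - Λ * l = (Real.log (cfDen a l) / l - Λ) * l := by field_simp
      have h3 : |Real.log (cfDen a l) - Λ * l| ≤ ε * l := by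
        rw [e, abs_mul, abs_of_pos h0']; exact mul_le_mul_of_nonneg_right h1.le h0'.le
      have h2 := abs_nonneg (Real.log (cfDen a 0) - Λ * (0:ℕ))
      linarith
  have huR : Tendsto (fun n => (u n : ℝ)) atTop atTop := tendsto_natCast_atTop_atTop.comp hu
  have hz : Tendsto (fun n => (Real.log (cfDen a (k n)) - Λ * k n) / u n) atTop (𝓝 0) := by
    rw [Metric.tendsto_atTop']
    intro ε hε
    obtain ⟨C, hC⟩ := hbd (ε / (2 * (|κ| + 1))) (by positivity)
    have t1 : Tendsto (fun n => ε / (2 * (|κ| + 1)) * ((k n : ℝ) / u n) + C / u n) atTop (𝓝 (ε / (2 * (|κ| + 1)) * κ + 0)) :=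
      (hk.const_mul _).add (tendsto_const_nhds.div_atTop huR)
    have hlt : ε / (2 * (|κ| + 1)) * κ + 0 < ε := by
      rw [add_zero, div_mul_eq_mul_div, div_lt_iff₀ (by positivity)]
      have := le_abs_self κ; have := abs_nonneg κ
      nlinarith
    have t2 := (t1.eventually_lt_const hlt).and (huR.eventually_gt_atTop 0)
    obtain ⟨N, hN⟩ := eventually_atTop.mp t2
    refine ⟨N, fun n hn => ?_⟩
    obtain ⟨h1, h2⟩ := hN n hn.le
    rw [Real.dist_eq, sub_zero, abs_div, abs_of_pos h2]
    refine lt_of_le_of_lt ?_ h1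
    rw [div_le_iff₀ h2, add_mul, div_mul_cancel₀ _ h2.ne', mul_assoc, div_mul_cancel₀ _ h2.ne']
    exact hC _
  have := (hk.const_mul Λ).add hz
  rw [add_zero] at this
  refine this.congr fun n => ?_
  ring

end ST

namespace ST

/-- the four linear forms -/
noncomputable def L4 (α : ℝ) : Matrix (Fin (3+1)) (Fin (3+1)) ℝ := !![0,0,0,1; 0,1,0,α; 0,0,1,α; 1,α,α,α^2]

lemma L4_inv (α : ℝ) : L4 α * !![α^2,-α,-α,1; -α,1,0,0; -α,0,1,0; 1,0,0,0] = 1 := by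
  ext i j
  fin_cases i <;> fin_cases j <;> simp [L4, Matrix.mul_apply, Fin.sum_univ_four] <;> ring

theorem machine_L4 (α : ℝ) (halg : IsAlgebraic ℚ α) (c : Fin (3+1) → ℝ) (hc : ∑ i, c i < 0) (A : ℝ) (hA : 0 < A) :
    ∀ᶠ Q : ℝ in atTop, ∀ i0 j0 : Fin (3+1), i0 ≠ j0 → ¬ Config (k := 3) (L4 α) c A i0 j0 Q := by
  refine machine_alg (k := 3) α halg (L4 α) ![![0,0,0,1],![0,1,0,0],![0,0,1,0],![1,0,0,0]]
    ![![0,-1,-1,0],![-1,0,0,0],![-1,0,0,0],![0,0,0,0]] ![![1,0,0,0],![0,0,0,0],![0,0,0,0],![0,0,0,0]] ?_ c hc A hA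
  rw [← L4_inv α]
  congr 1
  ext i j; fin_cases i <;> fin_cases j <;> simp

lemma sum2_le {Q e1 e2 f1 f2 g x1 x2 z1 z2 : ℝ} (hQ : 1 ≤ Q) (hQ2 : 2 ≤ Q ^ (0.02:ℝ))
    (h1 : |x1| ≤ Q ^ e1) (h2 : |x2| ≤ Q ^ e2) (k1 : |z1| ≤ Q ^ f1) (k2 : |z2| ≤ Q ^ f2)
    (hg1 : e1 + f1 + 0.02 ≤ g) (hg2 : e2 + f2 + 0.02 ≤ g) : |x1 * z1 + x2 * z2| ≤ Q ^ g := by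
  have hQ0 : 0 < Q := by linarith
  have b : ∀ {x z e f : ℝ}, |x| ≤ Q ^ e → |z| ≤ Q ^ f → e + f + 0.02 ≤ g → |x * z| ≤ Q ^ (g - 0.02) := by
    intro x z e f hx hz hg
    rw [abs_mul]
    refine (mul_le_mul hx hz (abs_nonneg _) (by positivity)).trans ?_
    rw [← Real.rpow_add hQ0]
    exact Real.rpow_le_rpow_of_exponent_le hQ (by linarith)
  have := b h1 k1 hg1
  have := b h2 k2 hg2
  refine (abs_add_le _ _).trans ?_
  have e : Q ^ g = Q ^ (g - 0.02) * Q ^ (0.02:ℝ) := by rw [← Real.rpow_add hQ0]; congr 1; ring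
  have : 0 < Q ^ (g - 0.02) := by positivity
  rw [e]; nlinarith

set_option maxHeartbeats 1000000 in
theorem mkConfig (α ρ ν Q : ℝ) (hQ : 1 ≤ Q) (hQ2 : 2 ≤ Q ^ (0.02:ℝ)) (hρ : 0 ≤ ρ) (hν : 0 ≤ ν)
    (m11 m12 m21 m22 : ℤ) (hdet : m11 * m22 - m12 * m21 = 1 ∨ m11 * m22 - m12 * m21 = -1)
    (hss : |(α ^ 2 * m11 - α * m12 - α * m21 + m22 : ℝ)| ≤ Q ^ (-(2 + 2 * ρ + ν) + 0.02))
    (hsl : |(α * m11 - m21 : ℝ)| ≤ Q ^ (-(2 + ν) + 0.02))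
    (hls : |(α * m11 - m12 : ℝ)| ≤ Q ^ (ν + 0.02))
    (hll : |(m11 : ℝ)| ≤ Q ^ ((2 + 2 * ρ + ν) + 0.02))
    (hm : Q ^ (1:ℝ) ≤ m11)
    (y : Fin 3 → Fin 3 → ℤ) (hy : ∀ v : Fin 3 → ℚ, (∀ l, ∑ t, v t * y t l = 0) → v = 0)
    (hyb : ∀ t, |(y t 0 : ℝ)| ≤ Q ^ (2 + 2 * ρ - 0.55 : ℝ) ∧ |(y t 1 - α * y t 0 : ℝ)| ≤ Q ^ (-0.55 : ℝ) ∧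
        |(y t 2 - 2 * α * y t 1 + α ^ 2 * y t 0 : ℝ)| ≤ Q ^ (-(2 * ρ) - 0.55 : ℝ)) :
    Config (k := 3) (L4 α) ![2 + 2 * ρ + ν - 0.55 + 0.04, 2 + ν - 0.55 + 0.04, - ν - 0.55 + 0.04, -(2 + 2 * ρ + ν) - 0.55 + 0.04] 1 0 1 Q := by
  have hm0 : 0 < m11 := by
    have : (0:ℝ) < m11 := lt_of_lt_of_le (by positivity) hm
    exact_mod_cast this
  refine ⟨![m11, m21, m12, m22], fun t => ![y t 1 * m22 - y t 2 * m21, - y t 1 * m12 + y t 2 * m11,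
    - y t 0 * m22 + y t 1 * m21, y t 0 * m12 - y t 1 * m11], ?_, ?_, ?_, ?_⟩
  · intro v hv
    apply hy
    have v0 := hv 0
    have v1 := hv 1
    have v2 := hv 2
    have v3 := hv 3
    simp [Fin.sum_univ_three] at v0 v1 v2 v3
    have hdQ : ((m11:ℚ) * m22 - m12 * m21) ≠ 0 := by
      have : (m11 * m22 - m12 * m21 : ℤ) ≠ 0 := by rcases hdet with h | h <;> rw [h] <;> norm_num
      exact_mod_cast this
    intro l
    apply mul_left_cancel₀ hdQ
    rw [mul_zero, Fin.sum_univ_three]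
    fin_cases l <;> simp only [Fin.zero_eta, Fin.mk_one, Fin.reduceFinMk]
    · linear_combination - (m11:ℚ) * v2 - m21 * v3
    · linear_combination (m11:ℚ) * v0 + m21 * v1
    · linear_combination (m12:ℚ) * v0 + m22 * v1
  · intro t
    simp [Fin.sum_univ_four]; ring
  · intro t i
    obtain ⟨b0, b1, b2⟩ := hyb t
    have b0' := b0
    have b1' := b1
    rw [← abs_neg] at b0' b1'
    fin_cases i
    · convert sum2_le (g := 2 + 2 * ρ + ν - 0.55 + 0.04) hQ hQ2 b0' b1' hls hll (by linarith) (by linarith) using 2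
      · simp [L4, Fin.sum_univ_four]; ring
      · rfl
    · convert sum2_le (g := 2 + ν - 0.55 + 0.04) hQ hQ2 b1 b2 hls hll (by linarith) (by linarith) using 2
      · simp [L4, Fin.sum_univ_four]; ring
      · rfl
    · convert sum2_le (g := - ν - 0.55 + 0.04) hQ hQ2 b0' b1' hss hsl (by linarith) (by linarith) using 2
      · simp [L4, Fin.sum_univ_four]; ring
      · rfl
    · convert sum2_le (g := -(2 + 2 * ρ + ν) - 0.55 + 0.04) hQ hQ2 b1 b2 hss hsl (by linarith) (by linarith) using 2
      · simp [L4, Fin.sum_univ_four]; ring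
      · rfl
  · have hcop : IsCoprime m21 m11 := by
      rcases hdet with h | h
      · exact ⟨-m12, m22, by linear_combination h⟩
      · exact ⟨m12, -m22, by linear_combination -h⟩
    have := Rat.den_div_eq_of_coprime hm0 (Int.isCoprime_iff_gcd_eq_one.mp hcop)
    simp only [Matrix.cons_val_zero, Matrix.cons_val_one]
    refine hm.trans (le_of_eq ?_)
    have h2 : (((((m21:ℚ) / m11).den : ℤ)) : ℝ) = m11 := by rw [this]
    rw [← h2]; push_cast; rfl

lemma le_rpow_of_log {X Λ u e : ℝ} (hX : 0 < X) (h : Real.log X ≤ Λ * u * e) : X ≤ (Real.exp (Λ * u)) ^ e := by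
  rw [← Real.exp_mul]
  exact (Real.log_le_iff_le_exp hX).mp h

set_option maxHeartbeats 1000000 in
theorem main (a : ℕ → ℕ) (ha : ∀ n, 1 ≤ n → 1 ≤ a n)
    (α : ℝ)
    (hα : Tendsto (fun n => (cfNum a n : ℝ) / cfDen a n) atTop (𝓝 α))
    (hconv : ∃ L : ℝ, Tendsto (fun ℓ : ℕ => (cfDen a ℓ : ℝ) ^ (1 / (ℓ : ℝ))) atTop (𝓝 L))
    (w w' : ℚ) (hw : 0 < w) (hw' : 1 < w')
    (hcond : ConditionStarStar w w' a) :
    Transcendental ℚ α := by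
  intro halg
  obtain ⟨hnp, U, V, W, hpre, hV, hW, hmono⟩ := hcond
  obtain ⟨Λ, hΛ, hgr⟩ := growth ha hconv
  have hq : ∀ n, (0:ℝ) < cfDen a n := fun n => by exact_mod_cast den_pos a ha n
  set u : ℕ → ℕ := fun n => (U (n+1)).length with hu
  set v : ℕ → ℕ := fun n => (V (n+1)).length with hv
  set r : ℕ → ℕ := fun n => (W (n+1)).length with hr
  have hum : StrictMono u := fun i j h => hmono (Nat.succ_lt_succ h)
  have hupos : ∀ n, 1 ≤ u n := by
    intro n
    have : (U n).length < (U (n+1)).length := hmono (Nat.lt_succ_self n)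
    simp only [hu]; omega
  have huR : ∀ n, (0:ℝ) < u n := fun n => by exact_mod_cast hupos n
  have hmem : ∀ n, (((r n : ℝ) / u n, (v n : ℝ) / u n) : ℝ × ℝ) ∈ Set.Icc (0:ℝ) 1 ×ˢ Set.Icc (0:ℝ) w := by
    intro n
    have h1 : ((v n : ℚ)) ≤ w * u n := hV (n+1) (by omega)
    have h2 : w' * ((r n : ℚ)) ≤ u n := hW (n+1) (by omega)
    have h1' : ((v n : ℝ)) ≤ w * u n := by exact_mod_cast h1
    have h3 : (r n : ℚ) ≤ u n := by
      have : (0:ℚ) ≤ r n := by positivity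
      nlinarith
    have h3' : (r n : ℝ) ≤ u n := by exact_mod_cast h3
    refine ⟨⟨by positivity, ?_⟩, ⟨by positivity, ?_⟩⟩
    · exact (div_le_one (huR n)).mpr h3'
    · exact (div_le_iff₀ (huR n)).mpr h1'
  obtain ⟨⟨ρ, ν⟩, hρν, φ, hφ, hlim⟩ := (isCompact_Icc.prod isCompact_Icc).tendsto_subseq hmem
  have hρ : 0 ≤ ρ := hρν.1.1
  have hν : 0 ≤ ν := hρν.2.1
  have hlr : Tendsto (fun n => (r (φ n) : ℝ) / u (φ n)) atTop (𝓝 ρ) := (continuous_fst.tendsto _).comp hlim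
  have hlv : Tendsto (fun n => (v (φ n) : ℝ) / u (φ n)) atTop (𝓝 ν) := (continuous_snd.tendsto _).comp hlim
  have hlu : Tendsto (fun n => u (φ n)) atTop atTop := hum.tendsto_atTop.comp hφ.tendsto_atTop
  have huRt : Tendsto (fun n => (u (φ n) : ℝ)) atTop atTop := tendsto_natCast_atTop_atTop.comp hlu
  have g1 := growth_sub hgr (fun n => r (φ n)) _ ρ hlu hlr
  have g2 := growth_sub hgr (fun n => r (φ n) + u (φ n)) _ (ρ + 1) hlu (by
    refine (hlr.add_const 1).congr fun n => ?_
    have := (huR (φ n)).ne'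
    push_cast; field_simp)
  have g3 := growth_sub hgr (fun n => r (φ n) + u (φ n) + v (φ n)) _ (ρ + 1 + ν) hlu (by
    refine ((hlr.add_const 1).add hlv).congr fun n => ?_
    have := (huR (φ n)).ne'
    push_cast; field_simp)
  have g4 := growth_sub hgr (fun n => r (φ n) + u (φ n) + v (φ n) + u (φ n)) _ (ρ + 1 + ν + 1) hlu (by
    refine (((hlr.add_const 1).add hlv).add_const 1).congr fun n => ?_
    have := (huR (φ n)).ne'
    push_cast; field_simp)
  have gc : Tendsto (fun n => Real.log 2 / u (φ n)) atTop (𝓝 0) := tendsto_const_nhds.div_atTop huRt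
  have hη : 0 < Λ * 0.02 := by positivity
  have t1 := ((gc.sub g4).sub g1).eventually_le_const (u := Λ * (-(2 + 2 * ρ + ν) + 0.02)) (by linarith)
  have t2 := ((gc.sub g4).add g1).eventually_le_const (u := Λ * (-(2 + ν) + 0.02)) (by linarith)
  have t3 := ((gc.add g3).sub g2).eventually_le_const (u := Λ * (ν + 0.02)) (by linarith)
  have t4 := ((gc.add g4).add g1).eventually_le_const (u := Λ * ((2 + 2 * ρ + ν) + 0.02)) (by linarith)
  have t5 := g4.eventually_const_le (u := Λ * 1) (by
    have : 0 ≤ Λ * ρ := by positivity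
    have : 0 ≤ Λ * ν := by positivity
    linarith)
  have hQt : Tendsto (fun n => Real.exp (Λ * u (φ n))) atTop atTop :=
    Real.tendsto_exp_atTop.comp (huRt.const_mul_atTop hΛ)
  have eT := hQt.eventually (propT α halg (lagrange ha α hα hnp) ρ hρ)
  have eM := hQt.eventually (machine_L4 α halg ![2 + 2 * ρ + ν - 0.55 + 0.04, 2 + ν - 0.55 + 0.04, - ν - 0.55 + 0.04, -(2 + 2 * ρ + ν) - 0.55 + 0.04]
    (by simp [Fin.sum_univ_four]; linarith) 1 one_pos)
  have e1 := hQt.eventually (eventually_ge_atTop 1)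
  have e2 := hQt.eventually ((tendsto_rpow_atTop (by norm_num : (0:ℝ) < 0.02)).eventually_ge_atTop 2)
  obtain ⟨n, t1, t2, t3, t4, t5, ⟨y, hy, hyb⟩, eM, e1, e2⟩ :=
    (t1.and (t2.and (t3.and (t4.and (t5.and (eT.and (eM.and (e1.and e2)))))))).exists
  obtain ⟨m11, m12, m21, m22, hdet, hss, hsl, hls, hll, hm⟩ := structN ha α hα (U (φ n + 1)) (V (φ n + 1)) (W (φ n + 1))
    (hpre _ (by omega)) (r (φ n)) (u (φ n)) (v (φ n)) rfl rfl rfl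
  have hun := huR (φ n)
  set Un : ℝ := ((u (φ n) : ℕ) : ℝ) with hUn
  have cvt : ∀ {X e : ℝ}, X / Un ≤ Λ * e → X ≤ Λ * Un * e := by
    intro X e h
    rw [div_le_iff₀ hun] at h
    linarith
  have q1 := hq (r (φ n))
  have q2 := hq (r (φ n) + u (φ n))
  have q3 := hq (r (φ n) + u (φ n) + v (φ n))
  have q4 := hq (r (φ n) + u (φ n) + v (φ n) + u (φ n))
  refine eM 0 1 (by decide) (mkConfig α ρ ν _ e1 e2 hρ hν m11 m12 m21 m22 hdet (hss.trans ?_) (hsl.trans ?_) (hls.trans ?_) (hll.trans ?_) ?_ y hy hyb)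
  · refine le_rpow_of_log (by positivity) (cvt ?_)
    rw [Real.log_mul (by norm_num) (by positivity), Real.log_mul (by positivity) (by positivity), one_div, one_div, Real.log_inv, Real.log_inv]
    refine le_trans (le_of_eq ?_) t1
    ring
  · refine le_rpow_of_log (by positivity) (cvt ?_)
    rw [Real.log_mul (by norm_num) (by positivity), Real.log_mul (by positivity) (by positivity), one_div, Real.log_inv]
    refine le_trans (le_of_eq ?_) t2
    ring
  · refine le_rpow_of_log (by positivity) (cvt ?_)
    rw [Real.log_mul (by norm_num) (by positivity), Real.log_mul (by positivity) (by positivity), one_div, Real.log_inv]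
    refine le_trans (le_of_eq ?_) t3
    ring
  · refine le_rpow_of_log (by positivity) (cvt ?_)
    rw [Real.log_mul (by norm_num) (by positivity), Real.log_mul (by positivity) (by positivity)]
    refine le_trans (le_of_eq ?_) t4
    ring
  · have h1 : ((cfDen a (r (φ n) + u (φ n) + v (φ n) + u (φ n)) : ℤ) : ℝ) ≤ m11 := by exact_mod_cast hm
    refine le_trans ?_ h1
    rw [← Real.exp_mul, mul_one]
    push_cast
    rw [← Real.le_log_iff_exp_le q4]
    rw [mul_one, le_div_iff₀ hun] at t5
    exact t5

end ST

/-- Corollary 1: if `(q_ℓ^{1/ℓ})` converges and `a` satisfies Condition `(*)_{w,w'}`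
with `w' > 1`, then `α` is transcendental. -/
theorem statement3 (a : ℕ → ℕ) (ha : ∀ n, 1 ≤ n → 1 ≤ a n)
    (α : ℝ)
    (hα : Tendsto (fun n => (cfNum a n : ℝ) / cfDen a n) atTop (𝓝 α))
    (hconv : ∃ L : ℝ, Tendsto (fun ℓ : ℕ => (cfDen a ℓ : ℝ) ^ (1 / (ℓ : ℝ))) atTop (𝓝 L))
    (w w' : ℚ) (hw : 0 < w) (hw' : 1 < w')
    (hcond : ConditionStarStar w w' a) :
    Transcendental ℚ α := by
  exact ST.main a ha α hα hconv w w' hw hw' hcond
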